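/- There exists c ∈ ℂ such that the Julia set of f_c(z) = z² + c has Hausdorff dimension 2: if K_c = {z ∈ ℂ : the orbit of z under f_c is bounded} and J_c = ∂K_c is its topological frontier, then dim_H(J_c) = 2 for some c. (Shishikura: there are quadratic Julia sets of Hausdorff dimension 2.) -/

import Mathlib

section ShiDev
open Complex Set Filter Topology Metric

namespace Shi

/-! ### Complex analysis tools -/

lemma exists_log_ball {c : ℂ} {r : ℝ} {f : ℂ → ℂ} (hf : DifferentiableOn ℂ f (ball c r))
    (h0 : ∀ z ∈ ball c r, f z ≠ 0) {w : ℂ} (hw : exp w = f c) :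
    ∃ g : ℂ → ℂ, DifferentiableOn ℂ g (ball c r) ∧ g c = w ∧ ∀ z ∈ ball c r, exp (g z) = f z := by
  rcases le_or_gt r 0 with hr | hr
  · have : ball c r = ∅ := ball_eq_empty.2 hr
    exact ⟨fun _ => w, by simp [this], rfl, by simp [this]⟩
  have hd : DifferentiableOn ℂ (fun z => deriv f z / f z) (ball c r) :=
    (hf.deriv isOpen_ball).div hf h0
  obtain ⟨G, hG⟩ := hd.isExactOn_ball
  have hcm : c ∈ ball c r := mem_ball_self hr
  refine ⟨fun z => G z - G c + w, ?_, by simp, ?_⟩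
  · intro z hz
    exact (((hG z hz).sub_const _).add_const _).differentiableAt.differentiableWithinAt
  intro z hz
  have key : ∀ z ∈ ball c r, HasDerivAt (fun z => f z * exp (-(G z - G c + w))) 0 z := by
    intro z hz
    have h1 : HasDerivAt f (deriv f z) z :=
      (hf.differentiableAt (isOpen_ball.mem_nhds hz)).hasDerivAt
    have h2 := h1.mul (((((hG z hz).sub_const (G c)).add_const w).neg).cexp)
    have h3 : deriv f z / f z * f z = deriv f z := div_mul_cancel₀ _ (h0 z hz)
    refine HasDerivAt.congr_deriv h2 ?_
    linear_combination -exp (-(G z - G c + w)) * h3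
  have hc := isOpen_ball.is_const_of_deriv_eq_zero (convex_ball c r).isPreconnected
    (fun z hz => (key z hz).differentiableAt.differentiableWithinAt)
    (fun z hz => (key z hz).deriv) hz hcm
  simp only [sub_self, zero_add, exp_neg] at hc
  rw [← hw, mul_inv_cancel₀ (exp_ne_zero _)] at hc
  field_simp at hc
  exact hc.symm

lemma exists_sqrt_ball {c : ℂ} {r : ℝ} {f : ℂ → ℂ} (hf : DifferentiableOn ℂ f (ball c r))
    (h0 : ∀ z ∈ ball c r, f z ≠ 0) {w : ℂ} (hw : w ^ 2 = f c) :
    ∃ g : ℂ → ℂ, DifferentiableOn ℂ g (ball c r) ∧ g c = w ∧ ∀ z ∈ ball c r, g z ^ 2 = f z := by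
  rcases le_or_gt r 0 with hr | hr
  · have : ball c r = ∅ := ball_eq_empty.2 hr
    exact ⟨fun _ => w, by simp [this], rfl, by simp [this]⟩
  have hcm : c ∈ ball c r := mem_ball_self hr
  have hw0 : w ≠ 0 := by
    rintro rfl
    exact h0 c hcm (by rw [← hw]; simp)
  obtain ⟨g, hg, hgc, hge⟩ := exists_log_ball hf h0 (w := 2 * log w) (by
    rw [two_mul, exp_add, exp_log hw0, ← hw, sq])
  refine ⟨fun z => exp (g z / 2), ?_, ?_, ?_⟩
  · exact (hg.div_const 2).cexp
  · simp only [hgc]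
    rw [mul_div_cancel_left₀ _ (two_ne_zero), exp_log hw0]
  · intro z hz
    rw [← exp_nat_mul, ← hge z hz]
    congr 1
    push_cast
    ring

lemma taylor_one {ζ : ℂ} {t M : ℝ} {H : ℂ → ℂ} (hH : DifferentiableOn ℂ H (ball ζ t))
    (hM : ∀ x ∈ ball ζ t, ‖H x - H ζ‖ ≤ M) {x : ℂ} (hx : x ∈ ball ζ t) :
    ‖H x - H ζ - deriv H ζ * (x - ζ)‖ ≤ 2 * M * ‖x - ζ‖ ^ 2 / t ^ 2 := by
  have ht : 0 < t := by
    by_contra h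
    rw [ball_eq_empty.2 (not_lt.1 h)] at hx
    exact hx
  have hnb : ball ζ t ∈ 𝓝 ζ := ball_mem_nhds ζ ht
  have hd : DifferentiableOn ℂ (dslope H ζ) (ball ζ t) := (Complex.differentiableOn_dslope hnb).2 hH
  have hM0 : 0 ≤ M := (norm_nonneg _).trans (hM ζ (mem_ball_self ht))
  have hb : ∀ y ∈ ball ζ t, ‖dslope H ζ y‖ ≤ M / t := fun y hy =>
    Complex.norm_dslope_le_div_of_mapsTo_ball hH (fun z hz => by
      simpa [dist_eq_norm] using hM z hz) hy
  have h2 := Complex.dist_le_div_mul_dist_of_mapsTo_ball (R₂ := 2 * M / t) hd (fun y hy => by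
    rw [mem_closedBall, dist_eq_norm]
    refine (norm_sub_le _ _).trans ?_
    have h3 := hb y hy
    have h4 := hb ζ (mem_ball_self ht)
    calc _ ≤ M / t + M / t := add_le_add h3 h4
      _ = _ := by ring) hx
  rw [dist_eq_norm, dist_eq_norm, dslope_same] at h2
  have h5 : H x - H ζ = (x - ζ) * dslope H ζ x := by
    have := sub_smul_dslope H ζ x
    simpa [smul_eq_mul] using this.symm
  rw [h5]
  have : (x - ζ) * dslope H ζ x - deriv H ζ * (x - ζ) = (dslope H ζ x - deriv H ζ) * (x - ζ) := by
    ring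
  rw [this, norm_mul]
  calc _ ≤ (2 * M / t / t * ‖x - ζ‖) * ‖x - ζ‖ := by gcongr
    _ = _ := by field_simp

lemma frequently_ne_of_deriv {ζ : ℂ} {H : ℂ → ℂ}
    (hd : deriv H ζ ≠ 0) : ∃ᶠ z in 𝓝 ζ, H z ≠ H ζ := by
  have h := (differentiableAt_of_deriv_ne_zero hd).hasDerivAt.eventually_ne (c := H ζ) hd
  exact (h.frequently).filter_mono nhdsWithin_le_nhds

lemma cover_of_deriv {ζ : ℂ} {t M σ : ℝ} {H : ℂ → ℂ} (hH : DifferentiableOn ℂ H (ball ζ t))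
    (hM : ∀ x ∈ ball ζ t, ‖H x - H ζ‖ ≤ M) (hσ : 0 < σ) (hσt : σ < t) (hd : deriv H ζ ≠ 0) :
    ball (H ζ) ((‖deriv H ζ‖ * σ - 2 * M * σ ^ 2 / t ^ 2) / 2) ⊆ H '' closedBall ζ σ := by
  refine DiffContOnCl.ball_subset_image_closedBall (DifferentiableOn.diffContOnCl (hH.mono ?_)) hσ ?_
    (frequently_ne_of_deriv hd)
  · rw [closure_ball _ hσ.ne']
    exact closedBall_subset_ball hσt
  · intro z hz
    have hz' : ‖z - ζ‖ = σ := by simpa [dist_eq_norm] using hz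
    have h := taylor_one hH hM (x := z) (by rw [mem_ball, dist_eq_norm, hz']; exact hσt)
    rw [hz'] at h
    have h2 : ‖deriv H ζ * (z - ζ)‖ = ‖deriv H ζ‖ * σ := by rw [norm_mul, hz']
    have h3 := norm_sub_norm_le (deriv H ζ * (z - ζ)) (H z - H ζ)
    rw [h2, norm_sub_rev (deriv H ζ * (z - ζ))] at h3
    linarith

/-- weak Bloch theorem -/
lemma bloch {c : ℂ} {R b : ℝ} {g : ℂ → ℂ} (hR : 0 < R) (hb : 0 < b)
    (hg : DifferentiableOn ℂ g (ball c R))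
    (hn : ∀ w, ¬ ball w b ⊆ g '' ball c R) : ‖deriv g c‖ ≤ 64 * b / R := by
  have main : ∀ r, 0 < r → r < R → r * ‖deriv g c‖ ≤ 64 * b := by
    intro r hr hrR
    have hgd : ContinuousOn (deriv g) (ball c R) := (hg.deriv isOpen_ball).continuousOn
    have hsub : closedBall c r ⊆ ball c R := closedBall_subset_ball hrR
    have hcont : ContinuousOn (fun w => (r - ‖w - c‖) * ‖deriv g w‖) (closedBall c r) := by
      apply ContinuousOn.mul
      · fun_prop
      · exact (hgd.mono hsub).norm
    obtain ⟨w, hw, hmax⟩ := (isCompact_closedBall c r).exists_isMaxOn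
      ⟨c, mem_closedBall_self hr.le⟩ hcont
    have hmax' : ∀ x ∈ closedBall c r, (r - ‖x - c‖) * ‖deriv g x‖ ≤ (r - ‖w - c‖) * ‖deriv g w‖ :=
      fun x hx => hmax hx
    have h1 := hmax' c (mem_closedBall_self hr.le)
    simp only [sub_self, norm_zero, sub_zero] at h1
    refine h1.trans ?_
    by_contra hlt
    push Not at hlt
    have hwr : ‖w - c‖ ≤ r := by simpa [dist_eq_norm] using hw
    set m := ‖deriv g w‖ with hm
    have hwr' : ‖w - c‖ < r := by
      rcases hwr.lt_or_eq with h | h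
      · exact h
      · rw [h] at hlt; simp at hlt; linarith
    have hm0 : 0 < m := by
      rcases (norm_nonneg (deriv g w)).lt_or_eq with h | h
      · exact h
      · rw [← hm] at h; rw [← h] at hlt; simp at hlt; linarith
    set t := (r - ‖w - c‖) / 2 with ht
    have ht0 : 0 < t := by rw [ht]; linarith
    have hxs : ∀ x ∈ ball w t, x ∈ closedBall c r ∧ ‖deriv g x‖ ≤ 2 * m := by
      intro x hx
      have hx' : ‖x - w‖ < t := by simpa [dist_eq_norm] using hx
      have h3 : ‖x - c‖ ≤ ‖x - w‖ + ‖w - c‖ := by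
        have := norm_add_le (x - w) (w - c); simpa using this
      have h4 : t ≤ r - ‖x - c‖ := by linarith
      have h5 : x ∈ closedBall c r := by simp [dist_eq_norm]; linarith
      refine ⟨h5, ?_⟩
      have h6 := hmax' x h5
      have h7 : t * ‖deriv g x‖ ≤ 2 * t * m := by
        calc _ ≤ (r - ‖x - c‖) * ‖deriv g x‖ := by gcongr
          _ ≤ _ := h6
          _ = _ := by rw [ht]; ring
      nlinarith
    have hgw : DifferentiableOn ℂ g (ball w t) := hg.mono fun x hx => hsub (hxs x hx).1
    have hM : ∀ x ∈ ball w t, ‖g x - g w‖ ≤ 2 * m * t := by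
      intro x hx
      have := Convex.norm_image_sub_le_of_norm_deriv_le (f := g) (s := ball w t) (C := 2 * m)
        (fun y hy => hgw.differentiableAt (isOpen_ball.mem_nhds hy)) (fun y hy => (hxs y hy).2)
        (convex_ball w t) (mem_ball_self ht0) hx
      refine this.trans ?_
      have hx' : ‖x - w‖ < t := by simpa [dist_eq_norm] using hx
      gcongr
    have hc := cover_of_deriv hgw hM (σ := t / 8) (by positivity) (by linarith)
      (by rw [← norm_pos_iff]; exact hm0)
    apply hn (g w)
    refine (ball_subset_ball ?_).trans (hc.trans (image_mono ?_))
    · rw [← hm]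
      have : (m * (t / 8) - 2 * (2 * m * t) * (t / 8) ^ 2 / t ^ 2) / 2 = m * t / 32 := by
        field_simp; ring
      rw [this]
      have : (r - ‖w - c‖) * m = 2 * t * m := by rw [ht]; ring
      rw [this] at hlt
      nlinarith
    · intro x hx
      exact hsub (hxs x (closedBall_subset_ball (by linarith) hx)).1
  rw [le_div_iff₀ hR]
  have hlim : Tendsto (fun r : ℝ => r * ‖deriv g c‖) (𝓝[<] R) (𝓝 (R * ‖deriv g c‖)) :=
    ((continuous_id.mul continuous_const).tendsto R).mono_left nhdsWithin_le_nhds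
  have := le_of_tendsto hlim (by
    filter_upwards [Ioo_mem_nhdsLT hR] with r hr
    exact main r hr.1 hr.2)
  linarith

lemma exists_cosh_sq_int (w : ℂ) : ∃ w', ‖w' - w‖ < 3 ∧ ∃ k : ℤ, cosh w' ^ 2 = k := by
  -- real part
  have hreal : ∀ t : ℝ, 0 ≤ t → ∃ a : ℝ, |a - t| ≤ 1 ∧ ∃ m : ℤ, Real.cosh a ^ 2 = m := by
    intro t ht
    set m : ℤ := ⌊Real.cosh t ^ 2⌋ with hm
    have hm1 : (1 : ℤ) ≤ m := by
      rw [hm, Int.le_floor]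
      have := Real.one_le_cosh t
      push_cast
      nlinarith
    have hle : (m : ℝ) ≤ Real.cosh t ^ 2 := Int.floor_le _
    have hlt : Real.cosh t ^ 2 < m + 1 := Int.lt_floor_add_one _
    have hm1' : (1 : ℝ) ≤ m := by exact_mod_cast hm1
    obtain ⟨a, ha, hae⟩ := intermediate_value_Icc ht
      (f := fun x => Real.cosh x ^ 2) (by fun_prop) (show (m : ℝ) ∈ _ by
        constructor
        · simpa using hm1'
        · exact hle)
    refine ⟨a, ?_, m, hae⟩
    rw [abs_le]
    refine ⟨?_, by linarith [ha.2]⟩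
    by_contra hcon
    push Not at hcon
    have h1 : Real.cosh (a + 1) ≤ Real.cosh t := by
      rw [Real.cosh_le_cosh, abs_of_nonneg (by linarith [ha.1]), abs_of_nonneg ht]
      linarith
    have h2 : Real.cosh a * Real.cosh 1 ≤ Real.cosh (a + 1) := by
      rw [Real.cosh_add]
      have := Real.sinh_nonneg_iff.2 ha.1
      have := Real.sinh_nonneg_iff.2 (zero_le_one)
      nlinarith
    have h3 : (3 / 2 : ℝ) ≤ Real.cosh 1 := by
      have h7 := Real.exp_one_gt_d9
      have h8 := Real.exp_one_lt_d9
      have h9 : Real.exp (-1) * Real.exp 1 = 1 := by rw [← Real.exp_add]; simp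
      rw [Real.cosh_eq]
      nlinarith
    have h4 := Real.one_le_cosh a
    simp only at hae
    have h5 : 3 / 2 * Real.cosh a ≤ Real.cosh t := by nlinarith
    have h6 : (3 / 2 * Real.cosh a) ^ 2 ≤ Real.cosh t ^ 2 := by
      apply pow_le_pow_left₀ (by linarith) h5
    nlinarith
  obtain ⟨a, ha, m, hm⟩ : ∃ a : ℝ, |a - w.re| ≤ 1 ∧ ∃ m : ℤ, Real.cosh a ^ 2 = m := by
    rcases le_total 0 w.re with h | h
    · exact hreal _ h
    · obtain ⟨a, ha, m, hm⟩ := hreal (-w.re) (by linarith)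
      refine ⟨-a, ?_, m, by simpa using hm⟩
      rw [← abs_neg]; convert ha using 2; ring
  set n : ℤ := round (w.im / Real.pi) with hn
  have hr := abs_sub_round (w.im / Real.pi)
  rw [← hn] at hr
  have hpi := Real.pi_pos
  have h2 : |(n : ℝ) * Real.pi - w.im| ≤ Real.pi / 2 := by
    have : (n : ℝ) * Real.pi - w.im = -((w.im / Real.pi - n) * Real.pi) := by field_simp; ring
    rw [this, abs_neg, abs_mul, abs_of_pos hpi]
    nlinarith
  refine ⟨a + (n * Real.pi : ℝ) * I, ?_, m, ?_⟩
  · have h3 : ‖(a + (n * Real.pi : ℝ) * I : ℂ) - w‖ ≤ |a - w.re| + |(n : ℝ) * Real.pi - w.im| := by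
      refine (Complex.norm_le_abs_re_add_abs_im _).trans (le_of_eq ?_)
      simp
    have := Real.pi_lt_d2
    linarith
  · have h4 : cosh (a + (n * Real.pi : ℝ) * I) ^ 2 = cosh a ^ 2 := by
      rw [cosh_add, cosh_mul_I, sinh_mul_I]
      have hs : sin ((n * Real.pi : ℝ) : ℂ) = 0 := by
        push_cast; exact Complex.sin_int_mul_pi n
      have hc : cos ((n * Real.pi : ℝ) : ℂ) ^ 2 = 1 := by
        have := Complex.sin_sq_add_cos_sq ((n * Real.pi : ℝ) : ℂ)
        rw [hs] at this; simpa using this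
      rw [hs]
      simp only [zero_mul, mul_zero, add_zero, mul_pow, hc, mul_one]
    rw [h4]
    exact_mod_cast congrArg (fun x : ℝ => (x : ℂ)) hm

lemma norm_cosh_le (z : ℂ) : ‖cosh z‖ ≤ Real.exp ‖z‖ := by
  rw [Complex.cosh]
  have h1 : ‖exp z‖ ≤ Real.exp ‖z‖ := Complex.norm_exp_le_exp_norm z
  have h2 : ‖exp (-z)‖ ≤ Real.exp ‖z‖ := by
    have := Complex.norm_exp_le_exp_norm (-z); rwa [norm_neg] at this
  rw [norm_div]
  have h3 := norm_add_le (exp z) (exp (-z))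
  simp only [Complex.norm_ofNat]
  linarith

/-- Schottky -/
lemma schottky (v : ℂ) : ∃ C > 0, ∀ (R : ℝ) (c : ℂ) (F : ℂ → ℂ), 0 < R →
    DifferentiableOn ℂ F (ball c R) → (∀ z ∈ ball c R, F z ≠ 0 ∧ F z ≠ 1) → F c = v →
    ∀ z ∈ ball c (R / 2), ‖F z‖ ≤ C := by
  set h0 : ℂ := log v / (2 * Real.pi * I) with hh0
  obtain ⟨r0, hr0⟩ := IsAlgClosed.exists_pow_nat_eq h0 (n := 2) (by norm_num)
  obtain ⟨r1, hr1⟩ := IsAlgClosed.exists_pow_nat_eq (h0 - 1) (n := 2) (by norm_num)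
  set g0 : ℂ := log (r0 + r1) with hg0
  set T : ℝ := ‖g0‖ + 192 with hT
  refine ⟨Real.exp (2 * Real.pi * (Real.exp T) ^ 2), by positivity, ?_⟩
  intro R c F hR hF hne hFc
  have hcm : c ∈ ball c R := mem_ball_self hR
  have hpi : (2 * Real.pi * I : ℂ) ≠ 0 := by simp [Real.pi_ne_zero]
  obtain ⟨L, hL, hLc, hLe⟩ := exists_log_ball hF (fun z hz => (hne z hz).1) (w := log v)
    (by rw [hFc, exp_log]; rw [← hFc]; exact (hne c hcm).1)
  set h : ℂ → ℂ := fun z => L z / (2 * Real.pi * I) with hh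
  have hd : DifferentiableOn ℂ h (ball c R) := hL.div_const _
  have hexp : ∀ z ∈ ball c R, exp (2 * Real.pi * I * h z) = F z := by
    intro z hz
    rw [← hLe z hz, hh]; congr 1; field_simp
  have hInt : ∀ z ∈ ball c R, ∀ k : ℤ, h z ≠ k := by
    intro z hz k hk
    apply (hne z hz).2
    rw [← hexp z hz, hk, mul_comm]
    exact Complex.exp_int_mul_two_pi_mul_I k
  have hhc : h c = h0 := by rw [hh, hh0]; simp only [hLc]
  obtain ⟨s0, hs0, hs0c, hs0e⟩ := exists_sqrt_ball hd
    (fun z hz => by have := hInt z hz 0; simpa using this) (w := r0) (by rw [hr0, hhc])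
  obtain ⟨s1, hs1, hs1c, hs1e⟩ := exists_sqrt_ball (hd.sub_const 1)
    (fun z hz => by have := hInt z hz 1; rw [sub_ne_zero]; simpa using this) (w := r1)
    (by rw [hr1, hhc])
  have hprod : ∀ z ∈ ball c R, (s0 z + s1 z) * (s0 z - s1 z) = 1 := by
    intro z hz
    have e0 := hs0e z hz
    have e1 := hs1e z hz
    linear_combination e0 - e1
  have hsum : ∀ z ∈ ball c R, s0 z + s1 z ≠ 0 := by
    intro z hz h0
    have := hprod z hz
    rw [h0, zero_mul] at this
    exact zero_ne_one this
  obtain ⟨g, hg, hgc, hge⟩ := exists_log_ball (hs0.add hs1) hsum (w := g0)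
    (by
      rw [hg0, exp_log, Pi.add_apply, hs0c, hs1c]
      have := hsum c hcm
      rwa [hs0c, hs1c] at this)
  have hcosh : ∀ z ∈ ball c R, cosh (g z) ^ 2 = h z := by
    intro z hz
    have e : exp (-(g z)) = s0 z - s1 z := by
      rw [exp_neg, hge z hz]
      exact inv_eq_of_mul_eq_one_right (hprod z hz)
    rw [← hs0e z hz, Complex.cosh, e, hge z hz]
    simp only [Pi.add_apply]
    ring
  have hbl : ∀ w ∈ ball c (R / 2), ‖deriv g w‖ ≤ 64 * 3 / (R / 2) := by
    intro w hw
    have hsub : ball w (R / 2) ⊆ ball c R := by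
      apply ball_subset_ball'
      have : dist w c < R / 2 := hw
      linarith
    apply bloch (by positivity) (by norm_num) (hg.mono hsub)
    intro x hx
    obtain ⟨w', hw', k, hk⟩ := exists_cosh_sq_int x
    obtain ⟨y, hy, hyw⟩ := hx (show w' ∈ ball x 3 by rw [mem_ball, dist_eq_norm]; exact hw')
    apply hInt y (hsub hy) k
    rw [← hcosh y (hsub hy), hyw, hk]
  intro z hz
  have hz' : z ∈ ball c R := ball_subset_ball (by linarith) hz
  have hgz : ‖g z‖ ≤ T := by
    have := Convex.norm_image_sub_le_of_norm_deriv_le (f := g) (s := ball c (R / 2))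
      (fun y hy => hg.differentiableAt (isOpen_ball.mem_nhds (ball_subset_ball (by linarith) hy)))
      hbl (convex_ball _ _) (mem_ball_self (by positivity)) hz
    have hz2 : ‖z - c‖ < R / 2 := by simpa [dist_eq_norm] using hz
    have h2 : ‖g z - g c‖ ≤ 192 := by
      refine this.trans ?_
      calc 64 * 3 / (R / 2) * ‖z - c‖ ≤ 64 * 3 / (R / 2) * (R / 2) := by gcongr
        _ = 192 := by field_simp; norm_num
    have h3 := norm_sub_norm_le (g z) (g c)
    rw [hgc] at h3 h2
    rw [hT]; linarith
  rw [← hexp z hz']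
  refine (Complex.norm_exp_le_exp_norm _).trans (Real.exp_le_exp.2 ?_)
  rw [norm_mul, ← hcosh z hz', norm_pow]
  have h5 : ‖(2 * Real.pi * I : ℂ)‖ = 2 * Real.pi := by
    simp [abs_of_pos Real.pi_pos]
  rw [h5]
  have h6 : ‖cosh (g z)‖ ≤ Real.exp T := (norm_cosh_le _).trans (Real.exp_le_exp.2 hgz)
  have := Real.pi_pos
  gcongr

end Shi

open Complex Set Filter Topology Metric

namespace Shi

lemma koebe_omit : ∃ C ≥ (1 : ℝ), ∀ (w v : ℂ) (η : ℝ) (g : ℂ → ℂ), 0 < η →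
    DifferentiableOn ℂ g (ball w η) → InjOn g (ball w η) → v ∉ g '' ball w η →
    ∀ x ∈ ball w (η / 2), ‖g x - v‖ ≤ C * ‖g w - v‖ := by
  obtain ⟨C, hC, hS⟩ := schottky (-1)
  refine ⟨max (C ^ 2) 1, le_max_right _ _, ?_⟩
  intro w v η g hη hg hinj hv x hx
  have hwm : w ∈ ball w η := mem_ball_self hη
  have hne : ∀ z ∈ ball w η, g z - v ≠ 0 := fun z hz h =>
    hv ⟨z, hz, by rwa [sub_eq_zero] at h⟩
  obtain ⟨s, hs, hsw, hse⟩ := exists_sqrt_ball (f := fun z => (g z - v) / (g w - v)) (w := -1)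
    ((hg.sub_const v).div_const _) (fun z hz => div_ne_zero (hne z hz) (hne w hwm))
    (by rw [div_self (hne w hwm)]; norm_num)
  have h1 := hS η w s hη hs (fun z hz => by
    constructor
    · intro h
      have := hse z hz
      rw [h] at this
      exact div_ne_zero (hne z hz) (hne w hwm) (by rw [← this]; norm_num)
    · intro h
      have h2 := hse z hz
      rw [h, one_pow, eq_comm, div_eq_one_iff_eq (hne w hwm)] at h2
      have h3 : z = w := hinj hz hwm (by simpa using h2)
      rw [h3, hsw] at h
      norm_num at h) hsw x hx
  have hx' : x ∈ ball w η := ball_subset_ball (by linarith) hx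
  have h2 : g x - v = s x ^ 2 * (g w - v) := by
    rw [hse x hx', div_mul_cancel₀ _ (hne w hwm)]
  rw [h2, norm_mul, norm_pow]
  gcongr
  exact (pow_le_pow_left₀ (norm_nonneg _) h1 2).trans (le_max_left _ _)

lemma koebe_aux : ∃ K ≥ (1 : ℝ), ∀ (w : ℂ) (η : ℝ) (g : ℂ → ℂ), 0 < η →
    DifferentiableOn ℂ g (ball w η) → InjOn g (ball w η) → deriv g w ≠ 0 →
    ball (g w) (η * ‖deriv g w‖ / K) ⊆ g '' ball w η ∧
    (∀ x ∈ ball w (η / 4), ‖g x - g w‖ ≤ K * η * ‖deriv g w‖) ∧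
    (∀ x ∈ ball w (η / 8), ‖deriv g x‖ ≤ K * ‖deriv g w‖) := by
  obtain ⟨C, hC, hO⟩ := koebe_omit
  refine ⟨64 * (C + 1), by linarith, ?_⟩
  intro w η g hη hg hinj hd
  have hwm : w ∈ ball w η := mem_ball_self hη
  have hb : ∀ x ∈ ball w (η / 4), ‖g x - g w‖ ≤ (C + 1) * η * ‖deriv g w‖ := by
    intro x hx
    -- lower bound for the derivative through the minimum principle
    have hsub : closedBall w (η / 2) ⊆ ball w η := closedBall_subset_ball (by linarith)
    have hds : DifferentiableOn ℂ (dslope g w) (ball w η) :=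
      (Complex.differentiableOn_dslope (ball_mem_nhds w hη)).2 hg
    have hdn : ∀ y ∈ ball w η, dslope g w y ≠ 0 := by
      intro y hy h
      by_cases hyw : y = w
      · rw [hyw, dslope_same] at h; exact hd h
      · have h2 := sub_smul_dslope g w y
        rw [h, smul_zero, eq_comm, sub_eq_zero] at h2
        exact hyw (hinj hy hwm h2)
    have hdc : DiffContOnCl ℂ (fun y => (dslope g w y)⁻¹) (ball w (η / 2)) := by
      apply DifferentiableOn.diffContOnCl
      rw [closure_ball _ (by positivity)]
      exact (hds.mono hsub).inv fun y hy => hdn y (hsub hy)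
    have hex : ∃ y ∈ sphere w (η / 2), ‖deriv g w‖⁻¹ ≤ ‖dslope g w y‖⁻¹ := by
      by_contra hcon
      push Not at hcon
      have hcs : IsCompact (sphere w (η / 2)) := isCompact_sphere _ _
      have hne : (sphere w (η / 2)).Nonempty := NormedSpace.sphere_nonempty.2 (by positivity)
      have hct : ContinuousOn (fun y => ‖(dslope g w y)⁻¹‖) (sphere w (η / 2)) :=
        (hdc.continuousOn.mono (by
          rw [closure_ball _ (by positivity)]; exact sphere_subset_closedBall)).norm
      obtain ⟨y, hy, hmax⟩ := hcs.exists_isMaxOn hne hct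
      have h3 := Complex.norm_le_of_forall_mem_frontier_norm_le isBounded_ball hdc
        (C := ‖(dslope g w y)⁻¹‖) (fun z hz => by
          rw [frontier_ball _ (by positivity)] at hz
          exact hmax hz) (z := w) (subset_closure (mem_ball_self (by positivity)))
      have h4 := hcon y hy
      rw [dslope_same, norm_inv, norm_inv] at h3
      linarith
    obtain ⟨y, hy, hle⟩ := hex
    have hyη : y ∈ ball w η := hsub (sphere_subset_closedBall hy)
    have h5 : ‖dslope g w y‖ ≤ ‖deriv g w‖ :=
      (inv_le_inv₀ (norm_pos_iff.2 hd) (norm_pos_iff.2 (hdn y hyη))).1 hle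
    have hyn : ‖y - w‖ = η / 2 := by simpa [dist_eq_norm] using hy
    have h6 : ‖g y - g w‖ ≤ η / 2 * ‖deriv g w‖ := by
      rw [← sub_smul_dslope g w y, norm_smul, hyn]
      gcongr
    have h7 := hO w (g y) (η / 2) g (by positivity)
      (hg.mono (ball_subset_ball (by linarith))) (hinj.mono (ball_subset_ball (by linarith)))
      (by
        rintro ⟨z, hz, hzy⟩
        have h8 := hinj (ball_subset_ball (by linarith) hz) hyη hzy
        rw [h8, mem_ball, mem_sphere.1 hy] at hz
        exact lt_irrefl _ hz) x (by convert hx using 2; ring)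
    have h9 : ‖g x - g w‖ ≤ ‖g x - g y‖ + ‖g y - g w‖ := by
      have := norm_add_le (g x - g y) (g y - g w); simpa using this
    rw [norm_sub_rev (g w)] at h7
    have := norm_nonneg (deriv g w)
    calc _ ≤ (C + 1) * ‖g y - g w‖ := by linarith
      _ ≤ (C + 1) * (η / 2 * ‖deriv g w‖) := by gcongr
      _ ≤ _ := by nlinarith [mul_nonneg (mul_nonneg (by linarith : (0:ℝ) ≤ C + 1) hη.le) this]
  refine ⟨?_, ?_, ?_⟩
  · intro v hv
    by_contra hcon
    have h1 := hO w v η g hη hg hinj hcon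
    have h2 : ∀ x ∈ ball w (η / 2), ‖g x - g w‖ ≤ (C + 1) * ‖g w - v‖ := by
      intro x hx
      have h9 : ‖g x - g w‖ ≤ ‖g x - v‖ + ‖g w - v‖ := by
        have := norm_sub_le (g x - v) (g w - v); simpa using this
      have := h1 x hx
      linarith
    have h3 := Complex.norm_deriv_le_div_of_mapsTo_ball (hg.mono (ball_subset_ball
      (show η / 2 ≤ η by linarith))) (fun x hx => by
        rw [mem_closedBall, dist_eq_norm]; exact h2 x hx) (by positivity)
    rw [le_div_iff₀ (by positivity)] at h3
    rw [mem_ball, dist_eq_norm, lt_div_iff₀ (by linarith), norm_sub_rev] at hv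
    have := norm_nonneg (g w - v)
    nlinarith
  · intro x hx
    refine (hb x hx).trans ?_
    have := norm_nonneg (deriv g w)
    gcongr
    linarith
  · intro x hx
    have hsub : ball x (η / 8) ⊆ ball w (η / 4) := ball_subset_ball' (by
      have : dist x w < η / 8 := hx
      linarith)
    have h3 := Complex.norm_deriv_le_div_of_mapsTo_ball (f := g) (c := x) (R₁ := η / 8)
      (R₂ := 2 * ((C + 1) * η * ‖deriv g w‖))
      (hg.mono (hsub.trans (ball_subset_ball (by linarith)))) (fun y hy => by
        rw [mem_closedBall, dist_eq_norm]
        have e1 := hb y (hsub hy)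
        have e2 := hb x (hsub (mem_ball_self (by positivity)))
        have h9 : ‖g y - g x‖ ≤ ‖g y - g w‖ + ‖g x - g w‖ := by
          have := norm_sub_le (g y - g w) (g x - g w); simpa using this
        linarith) (by positivity)
    refine h3.trans (le_of_eq_of_le (b := 16 * (C + 1) * ‖deriv g w‖) (by field_simp; norm_num) ?_)
    have := norm_nonneg (deriv g w)
    gcongr
    norm_num

/-- weak Koebe distortion theorem -/
lemma koebe : ∃ K ≥ (1 : ℝ), ∀ (w : ℂ) (η : ℝ) (g : ℂ → ℂ), 0 < η →
    DifferentiableOn ℂ g (ball w η) → InjOn g (ball w η) → (∀ x ∈ ball w η, deriv g x ≠ 0) →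
    ball (g w) (η * ‖deriv g w‖ / K) ⊆ g '' ball w η ∧
    (∀ x ∈ ball w (η / 4), ‖g x - g w‖ ≤ K * η * ‖deriv g w‖) ∧
    (∀ x ∈ ball w (η / 16), ‖deriv g x‖ ≤ K * ‖deriv g w‖ ∧ ‖deriv g w‖ ≤ K * ‖deriv g x‖) := by
  obtain ⟨K, hK, h⟩ := koebe_aux
  refine ⟨K, hK, ?_⟩
  intro w η g hη hg hinj hd
  obtain ⟨h1, h2, h3⟩ := h w η g hη hg hinj (hd w (mem_ball_self hη))
  refine ⟨h1, h2, fun x hx => ⟨h3 x (ball_subset_ball (by linarith) hx), ?_⟩⟩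
  have hxw : dist x w < η / 16 := hx
  have hsub : ball x (η / 2) ⊆ ball w η := ball_subset_ball' (by linarith)
  have h4 := (h x (η / 2) g (by positivity) (hg.mono hsub) (hinj.mono hsub)
    (hd x (ball_subset_ball (by linarith) hx))).2.2 w (by
      rw [mem_ball, dist_comm]; linarith)
  exact h4

end Shi

open Complex Set Filter Topology Metric

namespace Shi

/-! ### Quadratic dynamics: basics -/

/-- the quadratic polynomial -/
def fq (c z : ℂ) : ℂ := z ^ 2 + c

/-- derivative of the iterate -/
def dq (c : ℂ) (n : ℕ) (z : ℂ) : ℂ := ∏ i ∈ Finset.range n, (2 * (fq c)^[i] z)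

/-- filled Julia set -/
def Kset (c : ℂ) : Set ℂ := {z : ℂ | Bornology.IsBounded (Set.range fun n : ℕ => (fq c)^[n] z)}

lemma mem_K_def {c z : ℂ} :
    z ∈ Kset c ↔ Bornology.IsBounded (Set.range fun n : ℕ => (fq c)^[n] z) := Iff.rfl

/-- critical orbit -/
def xi (c : ℂ) (n : ℕ) : ℂ := (fq c)^[n] 0

lemma fq_succ (c : ℂ) (n : ℕ) (z : ℂ) : (fq c)^[n + 1] z = ((fq c)^[n] z) ^ 2 + c := by
  rw [Function.iterate_succ_apply']; rfl

lemma xi_succ (c : ℂ) (n : ℕ) : xi c (n + 1) = xi c n ^ 2 + c := fq_succ c n 0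

lemma xi_zero (c : ℂ) : xi c 0 = 0 := rfl

lemma xi_add (c : ℂ) (m n : ℕ) : (fq c)^[m] (xi c n) = xi c (m + n) := by
  rw [xi, xi, Function.iterate_add_apply]

lemma fq_neg_iter (c : ℂ) (n : ℕ) (hn : n ≠ 0) (z : ℂ) : (fq c)^[n] (-z) = (fq c)^[n] z := by
  obtain ⟨m, rfl⟩ := Nat.exists_eq_succ_of_ne_zero hn
  rw [Nat.succ_eq_add_one, Function.iterate_succ_apply, Function.iterate_succ_apply]
  simp [fq]

lemma differentiable_iter2 (n : ℕ) : Differentiable ℂ (fun p : ℂ × ℂ => (fq p.1)^[n] p.2) := by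
  induction n with
  | zero => simp only [Function.iterate_zero, id_eq]; fun_prop
  | succ n ih =>
    simp only [fq_succ]
    exact (ih.pow 2).add differentiable_fst

lemma continuous_iter2 (n : ℕ) : Continuous (fun p : ℂ × ℂ => (fq p.1)^[n] p.2) :=
  (differentiable_iter2 n).continuous

lemma differentiable_iter (c : ℂ) (n : ℕ) : Differentiable ℂ (fun z => (fq c)^[n] z) :=
  (differentiable_iter2 n).comp (by fun_prop : Differentiable ℂ fun z : ℂ => (c, z))

lemma continuous_iter (c : ℂ) (n : ℕ) : Continuous (fun z => (fq c)^[n] z) :=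
  (differentiable_iter c n).continuous

lemma differentiable_xi (n : ℕ) : Differentiable ℂ (fun c => xi c n) :=
  (differentiable_iter2 n).comp (by fun_prop : Differentiable ℂ fun c : ℂ => (c, (0 : ℂ)))

lemma continuous_dq2 (n : ℕ) : Continuous (fun p : ℂ × ℂ => dq p.1 n p.2) := by
  unfold dq
  exact continuous_finsetProd _ fun i _ => continuous_const.mul (continuous_iter2 i)

lemma continuous_dq (c : ℂ) (n : ℕ) : Continuous (fun z : ℂ => dq c n z) :=
  (continuous_dq2 n).comp (by fun_prop : Continuous fun z : ℂ => (c, z))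

lemma dq_succ (c : ℂ) (n : ℕ) (z : ℂ) : dq c (n + 1) z = dq c n z * (2 * (fq c)^[n] z) := by
  rw [dq, dq, Finset.prod_range_succ]

lemma dq_add (c : ℂ) (m n : ℕ) (z : ℂ) : dq c (m + n) z = dq c m z * dq c n ((fq c)^[m] z) := by
  induction n with
  | zero => simp [dq]
  | succ n ih =>
    rw [← add_assoc, dq_succ, ih, dq_succ, ← Function.iterate_add_apply, add_comm n m]; ring

lemma hasDerivAt_iter (c : ℂ) (n : ℕ) (z : ℂ) :
    HasDerivAt (fun z => (fq c)^[n] z) (dq c n z) z := by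
  induction n with
  | zero => simpa [dq] using hasDerivAt_id' z
  | succ n ih =>
    simp only [fq_succ]
    have := (ih.pow 2).add_const c
    refine this.congr_deriv ?_
    rw [dq_succ]; push_cast; ring

lemma deriv_iter (c : ℂ) (n : ℕ) (z : ℂ) : deriv (fun z => (fq c)^[n] z) z = dq c n z :=
  (hasDerivAt_iter c n z).deriv

lemma dq_eq_zero {c : ℂ} {n : ℕ} {z : ℂ} (h : dq c n z = 0) : ∃ i < n, (fq c)^[i] z = 0 := by
  rw [dq, Finset.prod_eq_zero_iff] at h
  obtain ⟨i, hi, h⟩ := h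
  exact ⟨i, Finset.mem_range.1 hi, by simpa using h⟩

/-! escape -/

lemma norm_fq_ge (c z : ℂ) : ‖z‖ ^ 2 - ‖c‖ ≤ ‖fq c z‖ := by
  rw [fq, ← norm_pow]
  have := norm_sub_norm_le (z ^ 2) (-c)
  simpa using this

lemma norm_fq_le (c z : ℂ) : ‖fq c z‖ ≤ ‖z‖ ^ 2 + ‖c‖ := by
  rw [fq, ← norm_pow]; exact norm_add_le _ _

lemma escape1 {c z : ℂ} (hc : ‖c‖ ≤ 3) (hz : 5 / 2 ≤ ‖z‖) : 13 / 10 * ‖z‖ ≤ ‖fq c z‖ := by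
  have := norm_fq_ge c z
  nlinarith

lemma escape2 {c z : ℂ} (hc : ‖c‖ ≤ 3) (hz : 3 ≤ ‖z‖) : 2 * ‖z‖ ≤ ‖fq c z‖ := by
  have := norm_fq_ge c z
  nlinarith

lemma escape_iter {c z : ℂ} (hc : ‖c‖ ≤ 3) (hz : 5 / 2 ≤ ‖z‖) (n : ℕ) :
    (13 / 10) ^ n * ‖z‖ ≤ ‖(fq c)^[n] z‖ := by
  induction n with
  | zero => simp
  | succ n ih =>
    rw [Function.iterate_succ_apply']
    have h1 : 5 / 2 ≤ ‖(fq c)^[n] z‖ := by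
      have : (1 : ℝ) ≤ (13 / 10) ^ n := one_le_pow₀ (by norm_num)
      nlinarith
    have := escape1 hc h1
    rw [pow_succ]
    linarith

lemma escape_tendsto {c z : ℂ} (hc : ‖c‖ ≤ 3) (hz : 5 / 2 ≤ ‖z‖) :
    Tendsto (fun n => ‖(fq c)^[n] z‖) atTop atTop := by
  refine tendsto_atTop_mono (fun n => escape_iter hc hz n) ?_
  exact (tendsto_pow_atTop_atTop_of_one_lt (by norm_num)).atTop_mul_const (by linarith)

lemma mem_K_of_frequently {c z : ℂ} {R : ℝ} (hc : ‖c‖ ≤ 3)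
    (h : ∃ᶠ n in atTop, ‖(fq c)^[n] z‖ ≤ R) : ∀ n, ‖(fq c)^[n] z‖ < 5 / 2 := by
  intro n
  by_contra hn
  push Not at hn
  have h1 := escape_tendsto hc hn
  have h2 : Tendsto (fun m => ‖(fq c)^[m] z‖) atTop atTop := by
    rw [← tendsto_add_atTop_iff_nat n]
    simpa [Function.iterate_add_apply] using h1
  exact h (by filter_upwards [h2.eventually_gt_atTop R] with m hm; exact not_le.2 hm)

lemma mem_K_iff {c z : ℂ} (hc : ‖c‖ ≤ 3) : z ∈ Kset c ↔ ∀ n, ‖(fq c)^[n] z‖ < 5 / 2 := by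
  constructor
  · intro h
    obtain ⟨R, hR⟩ := isBounded_iff_forall_norm_le.1 (mem_K_def.1 h)
    exact mem_K_of_frequently (R := R) hc (Eventually.frequently
      (Eventually.of_forall fun n => hR _ ⟨n, rfl⟩))
  · intro h
    refine mem_K_def.2 (isBounded_iff_forall_norm_le.2 ⟨5 / 2, ?_⟩)
    rintro _ ⟨n, rfl⟩
    exact (h n).le

lemma mem_K_of_freq {c z : ℂ} {R : ℝ} (hc : ‖c‖ ≤ 3)
    (h : ∃ᶠ n in atTop, ‖(fq c)^[n] z‖ ≤ R) : z ∈ Kset c :=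
  (mem_K_iff hc).2 (mem_K_of_frequently hc h)

lemma mem_K_of_tail {c z : ℂ} {n : ℕ} (hc : ‖c‖ ≤ 3) (h : (fq c)^[n] z ∈ Kset c) : z ∈ Kset c := by
  refine mem_K_of_freq (R := 5 / 2) hc (Eventually.frequently ?_)
  filter_upwards [eventually_ge_atTop n] with m hm
  have := (mem_K_iff hc).1 h (m - n)
  rw [← Function.iterate_add_apply, Nat.sub_add_cancel hm] at this
  exact this.le

lemma iter_mem_K {c z : ℂ} (n : ℕ) (hc : ‖c‖ ≤ 3) (h : z ∈ Kset c) : (fq c)^[n] z ∈ Kset c := by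
  rw [mem_K_iff hc] at h ⊢
  intro m
  rw [← Function.iterate_add_apply]
  exact h _

lemma mem_K_of_eventually_fixed {c z β : ℂ} {n : ℕ} (hc : ‖c‖ ≤ 3) (hβ : fq c β = β)
    (h : (fq c)^[n] z = β) : z ∈ Kset c := by
  apply mem_K_of_tail (n := n) hc
  rw [h]
  refine mem_K_def.2 (isBounded_iff_forall_norm_le.2 ⟨‖β‖, ?_⟩)
  rintro _ ⟨m, rfl⟩
  simp only
  rw [Function.iterate_fixed hβ]

lemma isOpen_compl_K {c : ℂ} (hc : ‖c‖ ≤ 3) : IsOpen (Kset c)ᶜ := by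
  have : (Kset c)ᶜ = ⋃ n, {z | 3 < ‖(fq c)^[n] z‖} := by
    ext z
    simp only [mem_compl_iff, mem_iUnion, mem_ofPred_eq]
    constructor
    · intro h
      rw [mem_K_iff hc] at h
      push Not at h
      obtain ⟨n, hn⟩ := h
      obtain ⟨m, hm⟩ := ((escape_tendsto hc hn).eventually_gt_atTop 3).exists
      exact ⟨m + n, by rwa [Function.iterate_add_apply]⟩
    · rintro ⟨n, hn⟩ h
      have := (mem_K_iff hc).1 h n
      linarith
  rw [this]
  exact isOpen_iUnion fun n => isOpen_lt continuous_const (continuous_iter c n).norm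

lemma isClosed_K {c : ℂ} (hc : ‖c‖ ≤ 3) : IsClosed (Kset c) := ⟨isOpen_compl_K hc⟩

lemma K_subset_ball {c : ℂ} (hc : ‖c‖ ≤ 3) : Kset c ⊆ ball 0 (5 / 2) := by
  intro z hz
  simpa using (mem_K_iff hc).1 hz 0

lemma isCompact_K {c : ℂ} (hc : ‖c‖ ≤ 3) : IsCompact (Kset c) :=
  (isCompact_closedBall (0 : ℂ) (5 / 2)).of_isClosed_subset (isClosed_K hc)
    ((K_subset_ball hc).trans ball_subset_closedBall)

lemma exists_escape_gt {c z : ℂ} (hc : ‖c‖ ≤ 3) (h : z ∉ Kset c) : ∃ n, 3 < ‖(fq c)^[n] z‖ := by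
  rw [mem_K_iff hc] at h
  push Not at h
  obtain ⟨n, hn⟩ := h
  obtain ⟨m, hm⟩ := ((escape_tendsto hc hn).eventually_gt_atTop 3).exists
  exact ⟨m + n, by rwa [Function.iterate_add_apply]⟩

lemma norm_le_of_iter {c x : ℂ} {R : ℝ} (hc : ‖c‖ ≤ 3) (hR : 3 ≤ R) (n : ℕ)
    (h : ‖(fq c)^[n] x‖ ≤ R) : ‖x‖ ≤ R := by
  by_contra hx
  push Not at hx
  have h1 := escape_iter hc (z := x) (by linarith) n
  have : (1 : ℝ) ≤ (13 / 10) ^ n := one_le_pow₀ (by norm_num)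
  nlinarith

/-- lifting a map on a disc through an iterate -/
lemma lift_ball {c t : ℂ} {r : ℝ} (n : ℕ) : ∀ (φ : ℂ → ℂ) (z : ℂ),
    DifferentiableOn ℂ φ (ball t r) →
    (∀ s ∈ ball t r, ∀ j, 1 ≤ j → j ≤ n → φ s ≠ xi c j) → (fq c)^[n] z = φ t →
    ∃ g : ℂ → ℂ, DifferentiableOn ℂ g (ball t r) ∧ g t = z ∧
      ∀ s ∈ ball t r, (fq c)^[n] (g s) = φ s := by
  induction n with
  | zero =>
    intro φ z hφ _ hz
    exact ⟨φ, hφ, by simpa using hz.symm, fun s _ => rfl⟩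
  | succ n ih =>
    intro φ z hφ havoid hz
    rw [fq_succ] at hz
    obtain ⟨ψ, hψ, hψt, hψe⟩ := exists_sqrt_ball (f := fun s => φ s - c) (w := (fq c)^[n] z)
      (hφ.sub_const c) (fun s hs h => havoid s hs 1 le_rfl (by omega) (by
        rw [sub_eq_zero] at h; rw [h, xi_succ, xi_zero]; ring)) (by rw [← hz]; ring)
    obtain ⟨g, hg, hgt, hge⟩ := ih ψ z hψ (fun s hs j hj hjn h =>
      havoid s hs (j + 1) (by omega) (by omega) (by
        rw [xi_succ, ← h, hψe s hs]; ring)) hψt.symm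
    refine ⟨g, hg, hgt, fun s hs => ?_⟩
    rw [fq_succ, hge s hs, hψe s hs]; ring

/-- inverse branches on discs -/
lemma inv_branch {c w z : ℂ} {r : ℝ} (n : ℕ)
    (havoid : ∀ s ∈ ball w r, ∀ j, 1 ≤ j → j ≤ n → s ≠ xi c j) (hz : (fq c)^[n] z = w) :
    ∃ g : ℂ → ℂ, DifferentiableOn ℂ g (ball w r) ∧ g w = z ∧
      (∀ s ∈ ball w r, (fq c)^[n] (g s) = s) ∧ InjOn g (ball w r) ∧
      (∀ s ∈ ball w r, dq c n (g s) * deriv g s = 1) := by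
  obtain ⟨g, hg, hgw, hge⟩ := lift_ball n (fun s => s) z differentiableOn_id havoid hz
  refine ⟨g, hg, hgw, hge, ?_, ?_⟩
  · intro x hx y hy h
    rw [← hge x hx, ← hge y hy, h]
  · intro s hs
    have h1 : HasDerivAt g (deriv g s) s :=
      (hg.differentiableAt (isOpen_ball.mem_nhds hs)).hasDerivAt
    have h2 := (hasDerivAt_iter c n (g s)).comp s h1
    have h3 : HasDerivAt (fun s => s) 1 s := hasDerivAt_id s
    refine (h2.congr_of_eventuallyEq ?_).unique h3
    filter_upwards [isOpen_ball.mem_nhds hs] with x hx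
    exact (hge x hx).symm

end Shi

open Complex Set Filter Topology Metric

namespace Shi

/-! ### Expanding horseshoes and dimension -/

/-- a finite conformal horseshoe with `M` branches, expansion at most `R`, `R ^ s < M` -/
def Es (s : ℝ) (c : ℂ) : Prop :=
  ∃ (M : ℕ) (z0 : ℂ) (ρ R : ℝ) (z : Fin M → ℂ) (r : Fin M → ℝ) (n : Fin M → ℕ),
    0 < ρ ∧ 1 < R ∧ R ^ s < M ∧ (∀ i, 0 < r i) ∧
    (∀ i, closedBall (z i) (r i) ⊆ closedBall z0 ρ) ∧
    (∀ i j, i ≠ j → r i + r j < dist (z i) (z j)) ∧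
    ∀ i, (∀ x ∈ sphere (z i) (r i), 3 * ρ < ‖(fq c)^[n i] x - (fq c)^[n i] (z i)‖) ∧
      ‖(fq c)^[n i] (z i) - z0‖ < ρ / 4 ∧
      ∀ x ∈ closedBall (z i) (r i), 2 < ‖dq c (n i) x‖ ∧ ‖dq c (n i) x‖ < R

lemma eventually_lt_of_compact {K : Set ℂ} (hK : IsCompact K) {g h : ℂ × ℂ → ℝ}
    (hg : Continuous g) (hh : Continuous h) {c : ℂ} (H : ∀ x ∈ K, g (c, x) < h (c, x)) :
    ∀ᶠ c' in 𝓝 c, ∀ x ∈ K, g (c', x) < h (c', x) :=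
  hK.eventually_forall_of_forall_eventually (P := fun a b => g (a, b) < h (a, b)) fun x hx =>
    (hg.continuousAt.eventually_lt hh.continuousAt (H x hx))

lemma Es_open {s : ℝ} {c : ℂ} (h : Es s c) : ∀ᶠ c' in 𝓝 c, Es s c' := by
  obtain ⟨M, z0, ρ, R, z, r, n, h1, h2, h3, h4, h5, h6, h7⟩ := h
  have key : ∀ i, ∀ᶠ c' in 𝓝 c,
      (∀ x ∈ sphere (z i) (r i), 3 * ρ < ‖(fq c')^[n i] x - (fq c')^[n i] (z i)‖) ∧
      (‖(fq c')^[n i] (z i) - z0‖ < ρ / 4) ∧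
      (∀ x ∈ closedBall (z i) (r i), 2 < ‖dq c' (n i) x‖) ∧
      (∀ x ∈ closedBall (z i) (r i), ‖dq c' (n i) x‖ < R) := by
    intro i
    have c1 : Continuous fun p : ℂ × ℂ => (fq p.1)^[n i] (z i) :=
      (continuous_iter2 (n i)).comp (by fun_prop : Continuous fun p : ℂ × ℂ => (p.1, z i))
    refine (eventually_lt_of_compact (isCompact_sphere _ _) continuous_const
      ((continuous_iter2 (n i)).sub c1).norm (fun x hx => (h7 i).1 x hx)).and ?_
    refine Eventually.and ?_ ((eventually_lt_of_compact (isCompact_closedBall _ _)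
      continuous_const (continuous_dq2 (n i)).norm (fun x hx => ((h7 i).2.2 x hx).1)).and
      (eventually_lt_of_compact (isCompact_closedBall _ _)
      (continuous_dq2 (n i)).norm continuous_const (fun x hx => ((h7 i).2.2 x hx).2)))
    have c2 : Continuous fun c' : ℂ => (fq c')^[n i] (z i) :=
      (continuous_iter2 (n i)).comp (by fun_prop : Continuous fun p : ℂ => (p, z i))
    exact (c2.sub continuous_const).norm.continuousAt.eventually_lt continuousAt_const (h7 i).2.1
  filter_upwards [eventually_all.2 key] with c' hc'
  exact ⟨M, z0, ρ, R, z, r, n, h1, h2, h3, h4, h5, h6, fun i =>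
    ⟨(hc' i).1, (hc' i).2.1, fun x hx => ⟨(hc' i).2.2.1 x hx, (hc' i).2.2.2 x hx⟩⟩⟩

/-- points following an itinerary for `m` steps -/
def Aset (c z0 : ℂ) (ρ : ℝ) {M : ℕ} (z : Fin M → ℂ) (r : Fin M → ℝ) (n : Fin M → ℕ) :
    ℕ → (ℕ → Fin M) → Set ℂ
  | 0, _ => closedBall z0 ρ
  | m + 1, d => {x | x ∈ closedBall (z (d 0)) (r (d 0)) ∧
      (fq c)^[n (d 0)] x ∈ Aset c z0 ρ z r n m (fun k => d (k + 1))}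

/-- Cauchy estimate at an interior point of K -/
lemma dq_bounded_interior {c x : ℂ} (hc : ‖c‖ ≤ 3) (hx : x ∈ interior (Kset c)) :
    ∃ C : ℝ, ∀ n, ‖dq c n x‖ ≤ C := by
  obtain ⟨ε, hε, hb⟩ := Metric.isOpen_iff.1 isOpen_interior x hx
  refine ⟨(5 / 2) / (ε / 2), fun n => ?_⟩
  rw [← deriv_iter]
  refine Complex.norm_deriv_le_of_forall_mem_sphere_norm_le (by positivity)
    (differentiable_iter c n).diffContOnCl fun w hw => ?_
  have hw' : w ∈ Kset c := interior_subset (hb (by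
    rw [mem_ball]; rw [mem_sphere] at hw; linarith))
  exact ((mem_K_iff hc).1 hw' n).le

lemma Es_dim {s : ℝ} {c : ℂ} (hc : ‖c‖ ≤ 3) (hs : 0 < s) (h : Es s c) :
    ENNReal.ofReal s ≤ dimH (frontier (Kset c)) := by
  obtain ⟨M, z0, ρ, R, z, r, n, h1, h2, h3, h4, h5, h6, h7⟩ := h
  set A := Aset c z0 ρ z r n with hA
  have Asucc : ∀ m d x, x ∈ A (m + 1) d ↔ x ∈ closedBall (z (d 0)) (r (d 0)) ∧
      (fq c)^[n (d 0)] x ∈ A m (fun k => d (k + 1)) := fun m d x => Iff.rfl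
  have Azero : ∀ d, A 0 d = closedBall z0 ρ := fun d => rfl
  have Asub : ∀ m d, A m d ⊆ closedBall z0 ρ := by
    intro m d
    cases m with
    | zero => exact (Azero d).subset
    | succ m => intro x hx; exact h5 _ ((Asucc m d x).1 hx).1
  have Anest : ∀ m d, A (m + 1) d ⊆ A m d := by
    intro m
    induction m with
    | zero => intro d; exact Asub 1 d
    | succ m ih =>
      intro d x hx
      rw [Asucc] at hx ⊢
      exact ⟨hx.1, ih _ hx.2⟩
  have Aclosed : ∀ m d, IsClosed (A m d) := by
    intro m
    induction m with
    | zero => intro d; exact isClosed_closedBall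
    | succ m ih =>
      intro d
      exact isClosed_closedBall.inter ((ih _).preimage (continuous_iter c _))
  have cover : ∀ i, closedBall z0 ρ ⊆ (fun x => (fq c)^[n i] x) '' closedBall (z i) (r i) := by
    intro i
    refine Subset.trans ?_ (DiffContOnCl.ball_subset_image_closedBall (ε := 3 * ρ)
      (differentiable_iter c (n i)).diffContOnCl (h4 i) (fun x hx => ((h7 i).1 x hx).le)
      (frequently_ne_of_deriv ?_))
    · intro x hx
      have := (h7 i).2.1
      rw [← dist_eq_norm] at this
      rw [mem_closedBall] at hx
      rw [mem_ball]
      have := dist_triangle_right x ((fq c)^[n i] (z i)) z0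
      linarith
    · rw [deriv_iter, ← norm_pos_iff]
      have := ((h7 i).2.2 (z i) (mem_closedBall_self (h4 i).le)).1
      linarith
  have Ane : ∀ m d, (A m d).Nonempty := by
    intro m
    induction m with
    | zero => intro d; exact ⟨z0, mem_closedBall_self h1.le⟩
    | succ m ih =>
      intro d
      obtain ⟨y, hy⟩ := ih (fun k => d (k + 1))
      obtain ⟨x, hx, hxy⟩ := cover (d 0) (Asub _ _ hy)
      refine ⟨x, ?_⟩
      rw [Asucc]
      refine ⟨hx, ?_⟩
      simp only at hxy
      rw [hxy]; exact hy
  have Apt : ∀ d, ∃ x, ∀ m, x ∈ A m d := by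
    intro d
    obtain ⟨x, hx⟩ := IsCompact.nonempty_iInter_of_sequence_nonempty_isCompact_isClosed
      (fun m => A m d) (fun m => Anest m d) (fun m => Ane m d) (isCompact_closedBall _ _)
      (fun m => Aclosed m d)
    exact ⟨x, fun m => mem_iInter.1 hx m⟩
  obtain ⟨δ, hδ, hgap⟩ : ∃ δ : ℝ, 0 < δ ∧ ∀ i j, i ≠ j → r i + r j + δ ≤ dist (z i) (z j) := by
    have : ∀ᶠ δ : ℝ in 𝓝[>] 0, ∀ i j, i ≠ j → r i + r j + δ ≤ dist (z i) (z j) := by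
      refine eventually_all.2 fun i => eventually_all.2 fun j => ?_
      by_cases hij : i = j
      · exact Eventually.of_forall fun _ h => absurd hij h
      · have : ∀ᶠ δ : ℝ in 𝓝 0, r i + r j + δ < dist (z i) (z j) := by
          refine (by fun_prop : Continuous fun δ : ℝ => r i + r j + δ).continuousAt.eventually_lt
            continuousAt_const ?_
          simpa using h6 i j hij
        filter_upwards [nhdsWithin_le_nhds this] with δ h _ using h.le
    obtain ⟨δ, h, h'⟩ := (this.and self_mem_nhdsWithin).exists
    exact ⟨δ, h', h⟩
  have sep : ∀ m d d' x x', (∀ k, x ∈ A k d) → (∀ k, x' ∈ A k d') → (∀ i < m, d i = d' i) →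
      d m ≠ d' m → δ ≤ R ^ m * ‖x - x'‖ := by
    intro m
    induction m with
    | zero =>
      intro d d' x x' hx hx' _ hne
      have a1 := ((Asucc 0 d x).1 (hx 1)).1
      have a2 := ((Asucc 0 d' x').1 (hx' 1)).1
      have a3 := hgap _ _ hne
      rw [mem_closedBall] at a1 a2
      rw [pow_zero, one_mul, ← dist_eq_norm]
      have := dist_triangle4 (z (d 0)) x x' (z (d' 0))
      rw [dist_comm (z (d 0)) x] at this
      linarith
    | succ m ih =>
      intro d d' x x' hx hx' heq hne
      have e0 : d 0 = d' 0 := heq 0 (by omega)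
      have := ih (fun k => d (k + 1)) (fun k => d' (k + 1)) ((fq c)^[n (d 0)] x)
        ((fq c)^[n (d' 0)] x') (fun k => ((Asucc k d x).1 (hx (k + 1))).2)
        (fun k => ((Asucc k d' x').1 (hx' (k + 1))).2) (fun i hi => heq (i + 1) (by omega)) hne
      rw [← e0] at this
      have b1 := ((Asucc 0 d x).1 (hx 1)).1
      have b2 := ((Asucc 0 d' x').1 (hx' 1)).1
      rw [← e0] at b2
      have := Convex.norm_image_sub_le_of_norm_deriv_le (𝕜 := ℂ)
        (f := fun x => (fq c)^[n (d 0)] x)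
        (s := closedBall (z (d 0)) (r (d 0))) (C := R) (fun x _ => differentiable_iter c _ x)
        (fun y hy => by rw [deriv_iter]; exact ((h7 _).2.2 y hy).2.le) (convex_closedBall _ _) b2 b1
      calc δ ≤ R ^ m * ‖(fq c)^[n (d 0)] x - (fq c)^[n (d 0)] x'‖ := by assumption
        _ ≤ R ^ m * (R * ‖x - x'‖) := by gcongr
        _ = _ := by ring
  -- large derivatives
  have big : ∀ m d x, x ∈ A m d → ∃ N ≥ m, (fq c)^[N] x ∈ closedBall z0 ρ ∧
      2 ^ m ≤ ‖dq c N x‖ := by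
    intro m
    induction m with
    | zero => intro d x hx; exact ⟨0, le_rfl, hx, by simp [dq]⟩
    | succ m ih =>
      intro d x hx
      rw [Asucc] at hx
      obtain ⟨N, hN, hN1, hN2⟩ := ih _ _ hx.2
      have b := ((h7 _).2.2 x hx.1).1
      refine ⟨N + n (d 0), ?_, by rwa [Function.iterate_add_apply], ?_⟩
      · have : n (d 0) ≠ 0 := by
          intro h0
          rw [h0] at b
          norm_num [dq] at b
        omega
      · rw [add_comm N, dq_add, norm_mul, pow_succ']
        gcongr
  have inFr : ∀ d x, (∀ m, x ∈ A m d) → x ∈ frontier (Kset c) := by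
    intro d x hx
    rw [(isClosed_K hc).frontier_eq]
    constructor
    · refine mem_K_of_freq (R := ‖z0‖ + ρ) hc (frequently_atTop.2 fun m => ?_)
      obtain ⟨N, hN, h, -⟩ := big m d x (hx m)
      refine ⟨N, hN, ?_⟩
      rw [mem_closedBall, dist_eq_norm] at h
      have := norm_le_norm_add_norm_sub z0 ((fq c)^[N] x)
      rw [norm_sub_rev] at this
      linarith
    · intro hInt
      obtain ⟨C, hC⟩ := dq_bounded_interior hc hInt
      obtain ⟨m, hm⟩ := pow_unbounded_of_one_lt C (by norm_num : (1 : ℝ) < 2)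
      obtain ⟨N, -, -, h⟩ := big m d x (hx m)
      linarith [hC N]
  -- coding
  have hM1 : 1 < M := by
    have : (1 : ℝ) < M := lt_trans (Real.one_lt_rpow h2 hs) h3
    exact_mod_cast this
  set t : ℝ := Real.log M / Real.log R with ht
  have hlR : 0 < Real.log R := Real.log_pos h2
  have hMpos : (0 : ℝ) < M := by positivity
  have hst : s < t := by
    rw [ht, lt_div_iff₀ hlR, ← Real.log_rpow (by linarith)]
    exact Real.log_lt_log (Real.rpow_pos_of_pos (by linarith) _) h3
  have ht0 : 0 < t := hs.trans hst
  have hRt : R ^ t = M := by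
    rw [Real.rpow_def_of_pos (by linarith), ht, mul_div_cancel₀ _ hlR.ne', Real.exp_log hMpos]
  set Λ : Set ℂ := {x | ∃ d, ∀ m, x ∈ A m d} with hΛ
  have hch : ∀ x, ∃ d : ℕ → Fin M, x ∈ Λ → ∀ m, x ∈ A m d := by
    intro x
    by_cases hx : x ∈ Λ
    · obtain ⟨d, hd⟩ := hx; exact ⟨d, fun _ => hd⟩
    · exact ⟨fun _ => ⟨0, by omega⟩, fun h => absurd h hx⟩
  choose code hcode using hch
  have first : ∀ d d' : ℕ → Fin M, d ≠ d' → ∃ m, (∀ i < m, d i = d' i) ∧ d m ≠ d' m := by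
    intro d d' hne
    have hex : ∃ m, d m ≠ d' m := Function.ne_iff.1 hne
    classical
    refine ⟨Nat.find hex, fun i hi => ?_, Nat.find_spec hex⟩
    by_contra hh
    exact Nat.find_min hex hi hh
  have himg : Icc (0 : ℝ) 1 ⊆ (fun x => Real.ofDigits (code x)) '' Λ := by
    intro y hy
    obtain ⟨d, -, rfl⟩ := Real.ofDigits_SurjOn hM1 hy
    obtain ⟨x, hx⟩ := Apt d
    refine ⟨x, ⟨d, hx⟩, ?_⟩
    have : code x = d := by
      by_contra hne
      obtain ⟨m, hm, hm'⟩ := first _ _ hne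
      have := sep m _ _ x x (hcode x ⟨d, hx⟩) hx hm hm'
      simp at this
      linarith
    simp only [this]
  have hold : HolderOnWith (Real.toNNReal (δ⁻¹ ^ t)) (Real.toNNReal t)
      (fun x => Real.ofDigits (code x)) Λ := by
    intro x hx y hy
    rw [edist_dist, edist_dist, Real.coe_toNNReal _ ht0.le,
      ENNReal.ofReal_rpow_of_nonneg dist_nonneg ht0.le]
    change _ ≤ ENNReal.ofReal _ * _
    rw [← ENNReal.ofReal_mul (by positivity)]
    apply ENNReal.ofReal_le_ofReal
    rw [← Real.mul_rpow (by positivity) dist_nonneg]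
    by_cases hxy : code x = code y
    · simp only [hxy, dist_self]; positivity
    obtain ⟨m, hm, hm'⟩ := first _ _ hxy
    have b1 := sep m _ _ x y (hcode x hx) (hcode y hy) hm hm'
    have b2 := Real.abs_ofDigits_sub_ofDigits_le hm
    rw [Real.dist_eq]
    refine b2.trans ?_
    rw [← hRt, ← Real.rpow_natCast, ← Real.rpow_mul (by linarith), mul_comm, Real.rpow_mul
      (by linarith), ← Real.inv_rpow (by positivity)]
    apply Real.rpow_le_rpow (by positivity) _ ht0.le
    rw [Real.rpow_natCast, dist_eq_norm, inv_mul_eq_div, le_div_iff₀ hδ, inv_mul_eq_div,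
      div_le_iff₀ (by positivity)]
    linarith
  have hd1 : (1 : ENNReal) ≤ dimH Λ / (Real.toNNReal t : NNReal) := by
    refine le_trans ?_ (hold.dimH_image_le (by simpa using ht0))
    refine le_trans ?_ (dimH_mono himg)
    rw [Real.dimH_of_nonempty_interior (by rw [interior_Icc]; exact ⟨1 / 2, by norm_num⟩)]
    simp
  have hd2 : ENNReal.ofReal t ≤ dimH Λ := by
    have := (ENNReal.le_div_iff_mul_le (Or.inl (by simpa using ht0)) (Or.inl ENNReal.coe_ne_top)).1 hd1
    rwa [one_mul] at this
  refine (ENNReal.ofReal_le_ofReal hst.le).trans (hd2.trans (dimH_mono ?_))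
  rintro x ⟨d, hd⟩
  exact inFr d x hd

end Shi

open Complex Set Filter Topology Metric

namespace Shi

/-! ### Misiurewicz parameters: the filled Julia set has empty interior -/

/-- critical orbit lands on a repelling fixed point -/
def Mis (c : ℂ) : Prop := ∃ (β : ℂ) (l : ℕ), fq c β = β ∧ 1 < ‖2 * β‖ ∧ xi c l = β

lemma xi_of_ge {c β : ℂ} {l : ℕ} (hβ : fq c β = β) (hl : xi c l = β) {n : ℕ} (hn : l ≤ n) :
    xi c n = β := by
  obtain ⟨k, rfl⟩ := Nat.exists_eq_add_of_le hn
  rw [add_comm, ← xi_add, hl, Function.iterate_fixed hβ]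

lemma Mis.exists_min {c : ℂ} (h : Mis c) : ∃ (β : ℂ) (m : ℕ), fq c β = β ∧ 1 < ‖2 * β‖ ∧
    xi c (m + 2) = β ∧ xi c (m + 1) = -β ∧ (∀ j < m + 2, xi c j ≠ β) := by
  obtain ⟨β, l, h1, h2, h3⟩ := h
  classical
  have hex : ∃ l, xi c l = β := ⟨l, h3⟩
  have hmin : ∀ j < Nat.find hex, xi c j ≠ β := fun j hj => Nat.find_min hex hj
  have hsp := Nat.find_spec hex
  have hβ0 : β ≠ 0 := by rintro rfl; norm_num at h2
  generalize Nat.find hex = L at hmin hsp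
  match L, hmin, hsp with
  | 0, _, hs => exact absurd hs.symm hβ0
  | 1, _, hs =>
    exfalso
    rw [xi_succ, xi_zero] at hs
    have hc' : c = β := by rw [← hs]; ring
    rw [hc', fq] at h1
    have : β ^ 2 = 0 := by linear_combination h1
    exact hβ0 (pow_eq_zero_iff (by norm_num) |>.1 this)
  | m + 2, hm, hs =>
    refine ⟨β, m, h1, h2, hs, ?_, hm⟩
    rw [xi_succ] at hs
    rw [fq] at h1
    have : (xi c (m + 1) - β) * (xi c (m + 1) + β) = 0 := by linear_combination hs - h1
    rcases mul_eq_zero.1 this with h | h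
    · exact absurd (sub_eq_zero.1 h) (hm (m + 1) (by omega))
    · exact eq_neg_of_add_eq_zero_left h

/-- postcritical polynomial -/
def Pip (c : ℂ) (l : ℕ) (z : ℂ) : ℂ := ∏ j ∈ Finset.range l, (z - xi c (j + 1))

/-- cofactor -/
noncomputable def qp (c : ℂ) (m : ℕ) (z : ℂ) : ℂ := 1 / 4 * ∏ j ∈ Finset.range m, (z + xi c (j + 1))

/-- cofactor cocycle -/
noncomputable def qn (c : ℂ) (m n : ℕ) (z : ℂ) : ℂ := ∏ i ∈ Finset.range n, qp c m ((fq c)^[i] z)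

lemma differentiable_qp (c : ℂ) (m : ℕ) : Differentiable ℂ (qp c m) := by
  unfold qp; fun_prop

lemma differentiable_Pip (c : ℂ) (m : ℕ) : Differentiable ℂ (Pip c m) := by
  unfold Pip; fun_prop

lemma differentiable_qn (c : ℂ) (m n : ℕ) : Differentiable ℂ (qn c m n) := by
  unfold qn
  have h : ∀ i, Differentiable ℂ fun z => qp c m ((fq c)^[i] z) := fun i =>
    (differentiable_qp c m).comp (differentiable_iter c i)
  fun_prop

lemma qn_add (c : ℂ) (m a b : ℕ) (z : ℂ) :
    qn c m (a + b) z = qn c m a z * qn c m b ((fq c)^[a] z) := by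
  unfold qn
  rw [Finset.prod_range_add]
  congr 1
  refine Finset.prod_congr rfl fun i _ => ?_
  rw [← Function.iterate_add_apply, add_comm]

lemma Pip_step {c β : ℂ} {m : ℕ} (h2 : xi c (m + 2) = β) (h3 : xi c (m + 1) = -β) (z : ℂ) :
    Pip c (m + 2) (fq c z) = (2 * z) ^ 2 * qp c m z * Pip c (m + 2) z := by
  unfold Pip qp
  have e1 : ∏ j ∈ Finset.range (m + 2), (fq c z - xi c (j + 1)) =
      z ^ 2 * ∏ j ∈ Finset.range (m + 1), ((z - xi c (j + 1)) * (z + xi c (j + 1))) := by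
    rw [Finset.prod_range_succ' _ (m + 1), mul_comm]
    congr 1
    · rw [xi_succ, xi_zero, fq]; ring
    · refine Finset.prod_congr rfl fun j _ => ?_
      rw [xi_succ c (j + 1), fq]; ring
  rw [e1, Finset.prod_mul_distrib, Finset.prod_range_succ (fun j => z + xi c (j + 1)) m,
    Finset.prod_range_succ (fun j => z - xi c (j + 1)) (m + 1), h2, h3]
  ring

lemma Pip_iter {c β : ℂ} {m : ℕ} (h2 : xi c (m + 2) = β) (h3 : xi c (m + 1) = -β) (n : ℕ) (z : ℂ) :
    Pip c (m + 2) ((fq c)^[n] z) = dq c n z ^ 2 * qn c m n z * Pip c (m + 2) z := by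
  induction n with
  | zero => simp [dq, qn]
  | succ n ih =>
    rw [Function.iterate_succ_apply', Pip_step h2 h3, ih, dq_succ]
    unfold qn
    rw [Finset.prod_range_succ]
    ring

lemma qp_fixed {c β : ℂ} {m : ℕ} (h1 : fq c β = β) (hβ : 1 < ‖2 * β‖)
    (h2 : xi c (m + 2) = β) (h3 : xi c (m + 1) = -β) (hmin : ∀ j < m + 2, xi c j ≠ β) :
    ‖qp c m β‖ < 1 := by
  set G := Pip c (m + 1) with hG
  have hPG : ∀ z, Pip c (m + 2) z = (z - β) * G z := by
    intro z
    rw [hG, Pip, Finset.prod_range_succ, h2, mul_comm]; rfl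
  have hGβ : G β ≠ 0 := by
    rw [hG, Pip, Finset.prod_ne_zero_iff]
    intro j hj
    rw [Finset.mem_range] at hj
    exact sub_ne_zero.2 (hmin (j + 1) (by omega)).symm
  have hβ0 : β ≠ 0 := by rintro rfl; norm_num at hβ
  have hfc : Continuous fun z => fq c z := by unfold fq; fun_prop
  have hGc : Continuous G := (differentiable_Pip c _).continuous
  have hqc : Continuous (qp c m) := (differentiable_qp c m).continuous
  have key : (fun z => (z + β) * G (fq c z)) = fun z => (2 * z) ^ 2 * qp c m z * G z := by
    refine Continuous.ext_on (s := {β}ᶜ) (dense_compl_singleton β) (by fun_prop) (by fun_prop) ?_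
    intro z hz
    have hz' : z - β ≠ 0 := sub_ne_zero.2 hz
    have := Pip_step h2 h3 z
    rw [hPG, hPG] at this
    apply mul_left_cancel₀ hz'
    have e : fq c z - β = (z - β) * (z + β) := by
      rw [fq] at h1 ⊢; linear_combination h1
    rw [e] at this
    linear_combination this
  have k2 := congrFun key β
  simp only [h1] at k2
  have k3 : 2 * β * qp c m β = 1 := by
    apply mul_right_cancel₀ hGβ
    apply mul_left_cancel₀ (mul_ne_zero two_ne_zero hβ0)
    linear_combination -k2
  have k4 : ‖2 * β‖ * ‖qp c m β‖ = 1 := by rw [← norm_mul, k3, norm_one]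
  nlinarith [norm_nonneg (qp c m β)]

lemma frontier_K_iter {c z : ℂ} (hc : ‖c‖ ≤ 3) (hz : z ∈ frontier (Kset c)) (n : ℕ) :
    (fq c)^[n] z ∈ frontier (Kset c) := by
  rw [(isClosed_K hc).frontier_eq] at hz ⊢
  refine ⟨iter_mem_K n hc hz.1, fun h => hz.2 ?_⟩
  rw [mem_interior]
  exact ⟨(fun z => (fq c)^[n] z) ⁻¹' interior (Kset c), fun x hx =>
    mem_K_of_tail hc (interior_subset hx), isOpen_interior.preimage (continuous_iter c n), h⟩

/-- orbits not hitting β come back away from the postcritical set -/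
lemma exists_away {c β : ℂ} {l : ℕ} (h1 : fq c β = β) (hβ : 1 < ‖2 * β‖) (hl : xi c l = β) :
    ∃ ε > 0, ∀ z, (∀ n, (fq c)^[n] z ≠ β) →
      ∃ᶠ n in atTop, ∀ j ∈ Finset.range l, ε ≤ ‖(fq c)^[n] z - xi c (j + 1)‖ := by
  obtain ⟨δ, hδ, ν, hν, hrep⟩ : ∃ δ > 0, ∃ ν : ℝ, 1 < ν ∧ ∀ x ∈ ball β δ, ν ≤ ‖x + β‖ := by
    refine ⟨(‖2 * β‖ - 1) / 2, by linarith, (‖2 * β‖ + 1) / 2, by linarith, fun x hx => ?_⟩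
    rw [mem_ball, dist_eq_norm] at hx
    have : ‖2 * β‖ ≤ ‖x + β‖ + ‖x - β‖ := by
      calc ‖2 * β‖ = ‖(x + β) - (x - β)‖ := by congr 1; ring
        _ ≤ _ := norm_sub_le _ _
    linarith
  have hcont : ∀ j, ∀ᶠ ε : ℝ in 𝓝[>] 0, ∀ x, ‖x - xi c (j + 1)‖ < ε →
      (fq c)^[l] x ∈ ball β δ := by
    intro j
    have hlim : (fq c)^[l] (xi c (j + 1)) = β := by
      rw [xi_add]; exact xi_of_ge h1 hl (by omega)
    obtain ⟨ε, hε, hb⟩ := Metric.continuousAt_iff.1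
      ((continuous_iter c l).continuousAt (x := xi c (j + 1))) δ hδ
    filter_upwards [Ioo_mem_nhdsGT hε] with e he x hx
    have := hb (x := x) (by rw [dist_eq_norm]; exact hx.trans he.2)
    rw [hlim] at this
    exact this
  obtain ⟨ε, hε, hε0⟩ := (((Finset.eventually_all (Finset.range l)).2
    fun j _ => hcont j).and self_mem_nhdsWithin).exists
  refine ⟨ε, hε0, fun z hz => ?_⟩
  by_contra hcon
  rw [not_frequently] at hcon
  obtain ⟨n0, hn0⟩ := eventually_atTop.1 hcon
  have hstay : ∀ k, (fq c)^[k + (l + n0)] z ∈ ball β δ := by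
    intro k
    have := hn0 (k + n0) (by omega)
    push Not at this
    obtain ⟨j, hj, hlt⟩ := this
    have := hε j hj _ hlt
    rwa [← Function.iterate_add_apply, show l + (k + n0) = k + (l + n0) by ring] at this
  have hgrow : ∀ k, ν ^ k * ‖(fq c)^[l + n0] z - β‖ ≤ ‖(fq c)^[k + (l + n0)] z - β‖ := by
    intro k
    induction k with
    | zero => simp
    | succ k ih =>
      rw [show k + 1 + (l + n0) = (k + (l + n0)) + 1 by ring, fq_succ]
      set x := (fq c)^[k + (l + n0)] z
      have e : x ^ 2 + c - β = (x - β) * (x + β) := by rw [fq] at h1; linear_combination h1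
      rw [e, norm_mul, pow_succ]
      have := hrep x (hstay k)
      calc ν ^ k * ν * ‖(fq c)^[l + n0] z - β‖ = (ν ^ k * ‖(fq c)^[l + n0] z - β‖) * ν := by ring
        _ ≤ _ := by gcongr
  have hpos : 0 < ‖(fq c)^[l + n0] z - β‖ := norm_pos_iff.2 (sub_ne_zero.2 (hz _))
  obtain ⟨k, hk⟩ := pow_unbounded_of_one_lt (δ / ‖(fq c)^[l + n0] z - β‖) hν
  rw [div_lt_iff₀ hpos] at hk
  have := hstay k
  rw [mem_ball, dist_eq_norm] at this
  linarith [hgrow k]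

lemma countable_hits (c β : ℂ) : {z | ∃ n, (fq c)^[n] z = β}.Countable := by
  have : ∀ n, {z | (fq c)^[n] z = β}.Countable := by
    intro n
    induction n with
    | zero => simp
    | succ n ih =>
      have : {z | (fq c)^[n + 1] z = β} ⊆ ⋃ s ∈ {z | (fq c)^[n] z = β}, {z | fq c z = s} := by
        intro z hz
        simp only [mem_ofPred_eq, Function.iterate_succ_apply] at hz
        simp only [mem_iUnion]
        exact ⟨fq c z, hz, rfl⟩
      refine Countable.mono this (ih.biUnion fun s _ => ?_)
      by_cases hne : {z | fq c z = s}.Nonempty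
      · obtain ⟨w, hw⟩ := hne
        refine Set.Countable.mono (s₂ := {w, -w}) ?_ (by simp)
        intro z hz
        simp only [fq, mem_ofPred_eq] at hz hw
        have : (z - w) * (z + w) = 0 := by linear_combination hz - hw
        rcases mul_eq_zero.1 this with h | h
        · left; exact sub_eq_zero.1 h
        · right; exact eq_neg_of_add_eq_zero_left h
      · rw [not_nonempty_iff_eq_empty.1 hne]; exact countable_empty
  have h2 : {z | ∃ n, (fq c)^[n] z = β} = ⋃ n, {z | (fq c)^[n] z = β} := by
    ext; simp
  rw [h2]
  exact countable_iUnion this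

/-- Koebe consequence: along good times at a Julia point, derivatives are unbounded -/
lemma dq_large_of_away {c z : ℂ} {ε : ℝ} (hc : ‖c‖ ≤ 3) (hε : 0 < ε) (hz : z ∈ frontier (Kset c))
    (hfr : ∃ᶠ n in atTop, ∀ j, 1 ≤ j → ε ≤ ‖(fq c)^[n] z - xi c j‖) (C : ℝ) :
    ∃ n, C < ‖dq c n z‖ ∧ ∀ j, 1 ≤ j → ε ≤ ‖(fq c)^[n] z - xi c j‖ := by
  obtain ⟨K, hK1, hK⟩ := koebe
  by_contra hcon
  push Not at hcon
  rw [(isClosed_K hc).frontier_eq] at hz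
  set C' := max C 1
  have hC' : 0 < C' := lt_of_lt_of_le one_pos (le_max_right _ _)
  refine hz.2 (mem_interior.2 ⟨ball z (ε / (K * C')), ?_, isOpen_ball,
    mem_ball_self (by positivity)⟩)
  intro x hx
  refine mem_K_of_freq (R := 5 / 2 + ε) hc (hfr.mono ?_)
  intro n hn
  have hd : ‖dq c n z‖ ≤ C' := by
    by_contra h
    push Not at h
    obtain ⟨j, hj, hj'⟩ := hcon n (lt_of_le_of_lt (le_max_left _ _) h)
    exact absurd (hn j hj) (not_le.2 hj')
  obtain ⟨g, hg1, hg2, hg3, hg4, hg5⟩ := inv_branch (c := c) (w := (fq c)^[n] z) (z := z) (r := ε) n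
    (fun s hs j hj _ h => by
      rw [mem_ball, dist_eq_norm, h, norm_sub_rev] at hs
      exact absurd (hn j hj) (not_le.2 hs)) rfl
  have hw : (fq c)^[n] z ∈ ball ((fq c)^[n] z) ε := mem_ball_self hε
  have h1 := (hK _ _ g hε hg1 hg4 (fun x hx h0 => by
    have := hg5 x hx; rw [h0, mul_zero] at this; exact zero_ne_one this)).1
  have h5 := hg5 _ hw
  rw [hg2] at h5 h1
  have h6 : ‖dq c n z‖ * ‖deriv g ((fq c)^[n] z)‖ = 1 := by rw [← norm_mul, h5, norm_one]
  have h7 : 1 / C' ≤ ‖deriv g ((fq c)^[n] z)‖ := by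
    rw [div_le_iff₀ hC', ← h6, mul_comm]
    gcongr
  obtain ⟨y, hy, rfl⟩ := h1 (show x ∈ _ by
    refine ball_subset_ball ?_ hx
    calc ε / (K * C') = ε * (1 / C') / K := by field_simp
      _ ≤ _ := by gcongr)
  rw [hg3 y hy]
  rw [mem_ball, dist_eq_norm] at hy
  have h8 := (mem_K_iff hc).1 hz.1 n
  have := norm_le_norm_add_norm_sub ((fq c)^[n] z) y
  rw [norm_sub_rev] at this
  linarith

lemma away_all {c β x : ℂ} {l : ℕ} {ε : ℝ} (h1 : fq c β = β) (hl : xi c l = β) (hl0 : 1 ≤ l)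
    (h : ∀ j ∈ Finset.range l, ε ≤ ‖x - xi c (j + 1)‖) : ∀ j, 1 ≤ j → ε ≤ ‖x - xi c j‖ := by
  intro j hj
  by_cases hjl : j ≤ l
  · have := h (j - 1) (by rw [Finset.mem_range]; omega)
    rwa [Nat.sub_add_cancel hj] at this
  · have := h (l - 1) (by rw [Finset.mem_range]; omega)
    rw [Nat.sub_add_cancel hl0, hl] at this
    rwa [xi_of_ge h1 hl (by omega)]

lemma interior_K_empty {c : ℂ} (hc : ‖c‖ ≤ 3) (hM : Mis c) : interior (Kset c) = ∅ := by
  obtain ⟨β, m, h1, hβ, h2, h3, hmin⟩ := hM.exists_min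
  obtain ⟨ε, hε, haway⟩ := exists_away h1 hβ h2
  have hqβ := qp_fixed h1 hβ h2 h3 hmin
  have hPc : Continuous (Pip c (m + 2)) := (differentiable_Pip c _).continuous
  have hqnc : ∀ n, Continuous (qn c m n) := fun n => (differentiable_qn c m n).continuous
  have hqc : Continuous (qp c m) := (differentiable_qp c m).continuous
  obtain ⟨B, hB⟩ := (isCompact_K hc).exists_bound_of_continuousOn hPc.continuousOn
  obtain ⟨S0, hS0⟩ := (isCompact_K hc).exists_bound_of_continuousOn hqc.continuousOn
  set S := max S0 1 with hS
  have hS1 : 1 ≤ S := le_max_right _ _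
  have hJK : frontier (Kset c) ⊆ Kset c := (isClosed_K hc).frontier_subset
  have hPne : ∀ z, (∀ n, (fq c)^[n] z ≠ β) → Pip c (m + 2) z ≠ 0 := by
    intro z hz
    rw [Pip, Finset.prod_ne_zero_iff]
    intro j _ h
    rw [sub_eq_zero] at h
    apply hz (m + 2)
    rw [h, xi_add]
    exact xi_of_ge h1 h2 (by omega)
  have hsmall : ∀ z ∈ frontier (Kset c), ∃ n, ‖qn c m n z‖ < 1 / 2 := by
    intro z hz
    by_cases hh : ∃ n, (fq c)^[n] z = β
    · obtain ⟨n, hn⟩ := hh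
      have e : ∀ k, qn c m (n + k) z = qn c m n z * qp c m β ^ k := by
        intro k
        rw [qn_add, hn]
        congr 1
        unfold qn
        simp [Function.iterate_fixed h1]
      have ht : Tendsto (fun k => ‖qn c m n z‖ * ‖qp c m β‖ ^ k) atTop (𝓝 (‖qn c m n z‖ * 0)) :=
        (tendsto_pow_atTop_nhds_zero_of_lt_one (norm_nonneg _) hqβ).const_mul _
      rw [mul_zero] at ht
      obtain ⟨k, hk⟩ := (ht.eventually_lt_const (by norm_num : (0 : ℝ) < 1 / 2)).exists
      refine ⟨n + k, ?_⟩
      rw [e, norm_mul, norm_pow]; exact hk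
    · push Not at hh
      have hP0 : 0 < ‖Pip c (m + 2) z‖ := norm_pos_iff.2 (hPne z hh)
      obtain ⟨n, hn, -⟩ := dq_large_of_away hc hε hz ((haway z hh).mono fun n hn =>
        away_all h1 h2 (by omega) hn) (max (2 * B / ‖Pip c (m + 2) z‖) 1)
      refine ⟨n, ?_⟩
      have e := Pip_iter h2 h3 n z
      have hb := hB _ (iter_mem_K n hc (hJK hz))
      rw [e, norm_mul, norm_mul, norm_pow] at hb
      have hn1 := lt_of_le_of_lt (le_max_left _ _) hn
      have hn2 := lt_of_le_of_lt (le_max_right _ _) hn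
      rw [div_lt_iff₀ hP0] at hn1
      by_contra hcon
      push Not at hcon
      have : ‖dq c n z‖ * 1 ≤ ‖dq c n z‖ ^ 2 := by nlinarith
      have h9 : ‖dq c n z‖ ^ 2 * (1 / 2) * ‖Pip c (m + 2) z‖ ≤
        ‖dq c n z‖ ^ 2 * ‖qn c m n z‖ * ‖Pip c (m + 2) z‖ := by gcongr
      nlinarith
  -- uniform time
  obtain ⟨T, hT⟩ : ∃ T, ∀ z ∈ frontier (Kset c), ∃ n ≤ T, ‖qn c m n z‖ < 1 / 2 := by
    have hJc : IsCompact (frontier (Kset c)) := (isCompact_K hc).of_isClosed_subset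
      isClosed_frontier hJK
    obtain ⟨t, ht⟩ := hJc.elim_finite_subcover (fun n => {z | ‖qn c m n z‖ < 1 / 2})
      (fun n => isOpen_lt (hqnc n).norm continuous_const) (fun z hz => by
        obtain ⟨n, hn⟩ := hsmall z hz
        exact mem_iUnion.2 ⟨n, hn⟩)
    refine ⟨t.sup id, fun z hz => ?_⟩
    have := ht hz
    simp only [mem_iUnion] at this
    obtain ⟨n, hn, hn'⟩ := this
    exact ⟨n, Finset.le_sup (f := id) hn, hn'⟩
  have hSn : ∀ n, ∀ z ∈ frontier (Kset c), ‖qn c m n z‖ ≤ S ^ n := by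
    intro n z hz
    unfold qn
    rw [norm_prod]
    calc _ ≤ ∏ i ∈ Finset.range n, S := Finset.prod_le_prod (fun _ _ => norm_nonneg _)
          (fun i _ => (hS0 _ (iter_mem_K i hc (hJK hz))).trans (le_max_left _ _))
      _ = S ^ n := by simp
  have hdec : ∀ k, ∀ n, k * T ≤ n → ∀ z ∈ frontier (Kset c), ‖qn c m n z‖ ≤ (1 / 2) ^ k * S ^ T := by
    intro k
    induction k with
    | zero =>
      intro n
      induction n using Nat.strong_induction_on with
      | _ n ih =>
        intro _ z hz
        rw [pow_zero, one_mul]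
        by_cases hn : n ≤ T
        · exact (hSn n z hz).trans (pow_le_pow_right₀ hS1 hn)
        · obtain ⟨a, haT, ha⟩ := hT z hz
          have ha0 : a ≠ 0 := by rintro rfl; norm_num [qn] at ha
          have := ih (n - a) (by omega) (by omega) _ (frontier_K_iter hc hz a)
          have e := qn_add c m a (n - a) z
          rw [Nat.add_sub_cancel' (by omega)] at e
          rw [e, norm_mul]
          rw [pow_zero, one_mul] at this
          have hp : (0 : ℝ) < S ^ T := by positivity
          nlinarith [norm_nonneg (qn c m a z), norm_nonneg (qn c m (n - a) ((fq c)^[a] z))]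
    | succ k ih =>
      intro n hn z hz
      obtain ⟨a, haT, ha⟩ := hT z hz
      have hn' : k * T + T ≤ n := by rw [← Nat.succ_mul]; exact hn
      have := ih (n - a) (by omega) _ (frontier_K_iter hc hz a)
      have e := qn_add c m a (n - a) z
      rw [Nat.add_sub_cancel' (by omega)] at e
      rw [e, norm_mul, pow_succ]
      calc _ ≤ (1 / 2) * ((1 / 2) ^ k * S ^ T) := by gcongr
        _ = _ := by ring
  have hmax : ∀ k, ∀ n, k * T ≤ n → ∀ z ∈ interior (Kset c), ‖qn c m n z‖ ≤ (1 / 2) ^ k * S ^ T := by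
    intro k n hn z hz
    exact Complex.norm_le_of_forall_mem_frontier_norm_le
      ((isCompact_K hc).isBounded.subset interior_subset) (differentiable_qn c m n).diffContOnCl
      (fun w hw => hdec k n hn w (frontier_interior_subset hw)) (subset_closure hz)
  by_contra hne
  obtain ⟨z, hz, hzh⟩ := ((countable_hits c β).dense_compl ℂ).inter_open_nonempty _ isOpen_interior
    (nonempty_iff_ne_empty.2 hne)
  have hzh' : ∀ n, (fq c)^[n] z ≠ β := fun n h => hzh ⟨n, h⟩
  obtain ⟨C, hC⟩ := dq_bounded_interior hc hz
  have hC0 : 0 ≤ C := (norm_nonneg _).trans (hC 0)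
  have htz : Tendsto (fun k : ℕ => C ^ 2 * ((1 / 2 : ℝ) ^ k * S ^ T) * ‖Pip c (m + 2) z‖) atTop
      (𝓝 (C ^ 2 * (0 * S ^ T) * ‖Pip c (m + 2) z‖)) :=
    (((tendsto_pow_atTop_nhds_zero_of_lt_one (by norm_num) (by norm_num)).mul_const _).const_mul
      _).mul_const _
  rw [zero_mul, mul_zero, zero_mul] at htz
  obtain ⟨k, hk⟩ := (htz.eventually_lt_const (by positivity : 0 < ε ^ (m + 2))).exists
  obtain ⟨n, hn, hn'⟩ := (frequently_atTop.1 (haway z hzh')) (k * T)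
  have e := Pip_iter h2 h3 n z
  have lo : ε ^ (m + 2) ≤ ‖Pip c (m + 2) ((fq c)^[n] z)‖ := by
    rw [Pip, norm_prod]
    calc ε ^ (m + 2) = ∏ j ∈ Finset.range (m + 2), ε := by simp
      _ ≤ _ := Finset.prod_le_prod (fun _ _ => hε.le) hn'
  rw [e, norm_mul, norm_mul, norm_pow] at lo
  have := hmax k n hn z hz
  have up : ‖dq c n z‖ ^ 2 * ‖qn c m n z‖ * ‖Pip c (m + 2) z‖ ≤
      C ^ 2 * ((1 / 2 : ℝ) ^ k * S ^ T) * ‖Pip c (m + 2) z‖ := by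
    have := hC n
    gcongr
  linarith

lemma dim_two_of_volume_pos {c : ℂ} (hc : ‖c‖ ≤ 3) (hM : Mis c)
    (hv : MeasureTheory.volume (Kset c) ≠ 0) : 2 ≤ dimH (frontier (Kset c)) := by
  have e : frontier (Kset c) = Kset c := by
    rw [(isClosed_K hc).frontier_eq, interior_K_empty hc hM, sdiff_empty]
  rw [e]
  by_contra hlt
  push Not at hlt
  apply hv
  have hr : Module.finrank ℝ ℂ = 2 := Complex.finrank_real_complex
  have hac : MeasureTheory.Measure.AbsolutelyContinuous
      (MeasureTheory.volume : MeasureTheory.Measure ℂ)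
      (MeasureTheory.Measure.hausdorffMeasure ((2 : NNReal) : ℝ)) := by
    have := MeasureTheory.Measure.absolutelyContinuous_isAddHaarMeasure
      (MeasureTheory.volume : MeasureTheory.Measure ℂ)
      (MeasureTheory.Measure.hausdorffMeasure (Module.finrank ℝ ℂ : ℝ))
    rw [hr] at this
    exact_mod_cast this
  exact measure_zero_of_dimH_lt hac (by exact_mod_cast hlt)

end Shi

open Complex Set Filter Topology Metric
open scoped ContDiff

namespace Shi

/-! ### Parameter space: parabolic parameters near Misiurewicz parameters -/

lemma contDiff_iter2 (n : ℕ) : ContDiff ℂ ω (fun p : ℂ × ℂ => (fq p.1)^[n] p.2) := by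
  induction n with
  | zero => simp only [Function.iterate_zero, id_eq]; fun_prop
  | succ n ih =>
    simp only [fq_succ]
    exact (ih.pow 2).add contDiff_fst

lemma contDiff_dq2 (n : ℕ) : ContDiff ℂ ω (fun p : ℂ × ℂ => dq p.1 n p.2) := by
  unfold dq
  exact contDiff_prod fun i _ => contDiff_const.mul (contDiff_iter2 i)

/-- implicit function theorem in one variable -/
lemma ift {G : ℂ × ℂ → ℂ} {u : ℂ × ℂ} (hG : ContDiffAt ℂ ω G u) (h0 : G u = 0) {d : ℂ}
    (hd : HasDerivAt (fun z => G (u.1, z)) d u.2) (hd0 : d ≠ 0) :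
    ∃ φ : ℂ → ℂ, AnalyticAt ℂ φ u.1 ∧ φ u.1 = u.2 ∧ (∀ᶠ c in 𝓝 u.1, G (c, φ c) = 0) ∧
      ∀ᶠ v in 𝓝 u, G v = 0 → φ v.1 = v.2 := by
  have hω : (ω : WithTop ℕ∞) ≠ 0 := by simp
  have hinv : (fderiv ℂ G u ∘L .inr ℂ ℂ ℂ).IsInvertible := by
    have h1 : HasFDerivAt (fun z => G (u.1, z)) (fderiv ℂ G u ∘L .inr ℂ ℂ ℂ) u.2 := by
      have hu : HasFDerivAt G (fderiv ℂ G u) (u.1, u.2) :=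
        (hG.differentiableAt hω).hasFDerivAt
      exact hu.comp u.2 (hasFDerivAt_prodMk_right u.1 u.2)
    have h2 := h1.unique hd.hasFDerivAt
    refine ⟨ContinuousLinearEquiv.smulLeft (Units.mk0 d hd0), ?_⟩
    rw [h2]
    ext
    simp [ContinuousLinearEquiv.smulLeft]
  refine ⟨hG.implicitFunction hω hinv, (hG.contDiffAt_implicitFunction hω hinv).analyticAt,
    hG.implicitFunction_apply_self hω hinv, ?_, ?_⟩
  · filter_upwards [hG.eventually_apply_implicitFunction hω hinv] with c hc
    rw [hc, h0]
  · filter_upwards [hG.eventually_apply_eq_iff_implicitFunction hω hinv] with v hv h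
    exact hv.1 (by rw [h, h0])

lemma ift_fix {c0 z0 : ℂ} {n : ℕ} (hz : (fq c0)^[n] z0 = z0) (hd : dq c0 n z0 ≠ 1) :
    ∃ φ : ℂ → ℂ, AnalyticAt ℂ φ c0 ∧ φ c0 = z0 ∧ (∀ᶠ c in 𝓝 c0, (fq c)^[n] (φ c) = φ c) ∧
      ∀ᶠ v : ℂ × ℂ in 𝓝 (c0, z0), (fq v.1)^[n] v.2 = v.2 → φ v.1 = v.2 := by
  obtain ⟨φ, h1, h2, h3, h4⟩ := ift (G := fun p : ℂ × ℂ => (fq p.1)^[n] p.2 - p.2) (u := (c0, z0))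
    ((contDiff_iter2 n).sub contDiff_snd).contDiffAt (by simp [hz])
    ((hasDerivAt_iter c0 n z0).sub (hasDerivAt_id z0)) (sub_ne_zero.2 hd)
  refine ⟨φ, h1, h2, ?_, ?_⟩
  · filter_upwards [h3] with c hc using sub_eq_zero.1 hc
  · filter_upwards [h4] with v hv h using hv (sub_eq_zero.2 h)

lemma analyticAt_dq_comp {φ : ℂ → ℂ} {c0 : ℂ} (hφ : AnalyticAt ℂ φ c0) (n : ℕ) :
    AnalyticAt ℂ (fun c => dq c n (φ c)) c0 := by
  have : ContDiffAt ℂ ω (fun c => dq c n (φ c)) c0 :=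
    (contDiff_dq2 n).contDiffAt.comp c0 (contDiffAt_id.prodMk hφ.contDiffAt)
  exact this.analyticAt

/-- parameters with a multiplier-one cycle are algebraic -/
lemma algebraic_of_mult_one {c z : ℂ} {n : ℕ} (hz : (fq c)^[n] z = z) (hn : n ≠ 0)
    (hd : dq c n z = 1) : IsAlgebraic ℤ c := by
  open Polynomial in
  set f : ℤ[X] →+* ℂ := (aeval c : ℤ[X] →ₐ[ℤ] ℂ).toRingHom with hf
  have hfX : f X = c := by simp [hf]
  obtain ⟨G, hG⟩ : ∃ G : ℕ → Polynomial (Polynomial ℤ), ∀ k, (G k).Monic ∧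
      (G k).natDegree = 2 ^ k ∧ (G k).eval₂ f z = (fq c)^[k] z := by
    have : ∀ k : ℕ, ∃ G : Polynomial (Polynomial ℤ), G.Monic ∧ G.natDegree = 2 ^ k ∧
        G.eval₂ f z = (fq c)^[k] z := by
      intro k
      induction k with
      | zero => exact ⟨Polynomial.X, Polynomial.monic_X, by simp, by simp⟩
      | succ k ih =>
        obtain ⟨G, h1, h2, h3⟩ := ih
        have hdeg : (Polynomial.C (Polynomial.X : Polynomial ℤ)).degree < (G ^ 2).degree := by
          rw [Polynomial.degree_eq_natDegree (h1.pow 2).ne_zero, h1.natDegree_pow, h2]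
          refine lt_of_le_of_lt Polynomial.degree_C_le ?_
          have : 0 < 2 * 2 ^ k := by positivity
          exact_mod_cast this
        refine ⟨G ^ 2 + Polynomial.C Polynomial.X, (h1.pow 2).add_of_left hdeg, ?_, ?_⟩
        · rw [Polynomial.natDegree_add_eq_left_of_degree_lt hdeg, h1.natDegree_pow, h2]; ring
        · rw [Polynomial.eval₂_add, Polynomial.eval₂_pow, h3, Polynomial.eval₂_C, hfX, fq_succ]
    choose G hG using this
    exact ⟨G, hG⟩
  have hzi : f.IsIntegralElem z := by
    refine ⟨G n - Polynomial.X, (hG n).1.sub_of_left ?_, ?_⟩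
    · rw [Polynomial.degree_eq_natDegree (hG n).1.ne_zero, (hG n).2.1, Polynomial.degree_X]
      have : 1 < 2 ^ n := Nat.one_lt_two_pow hn
      exact_mod_cast this
    · rw [Polynomial.eval₂_sub, (hG n).2.2, hz, Polynomial.eval₂_X, sub_self]
  have hzk : ∀ k, f.IsIntegralElem ((fq c)^[k] z) := by
    intro k
    induction k with
    | zero => exact hzi
    | succ k ih =>
      rw [fq_succ, pow_two]
      refine RingHom.IsIntegralElem.add _ (RingHom.IsIntegralElem.mul _ ih ih) ?_
      rw [← hfX]
      exact f.isIntegralElem_map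
  have hInt : ∀ k, f.IsIntegralElem (dq c k z) := by
    intro k
    induction k with
    | zero =>
      have := f.isIntegralElem_map (x := 1)
      rw [map_one] at this
      simpa [dq] using this
    | succ k ih =>
      rw [dq_succ]
      refine RingHom.IsIntegralElem.mul _ ih (RingHom.IsIntegralElem.mul _ ?_ (hzk k))
      have := f.isIntegralElem_map (x := 2)
      rwa [map_ofNat] at this
  have hhalf : f.IsIntegralElem (1 / 2 : ℂ) := by
    obtain ⟨k, rfl⟩ := Nat.exists_eq_succ_of_ne_zero hn
    have := RingHom.IsIntegralElem.mul _ (hInt k) (hzk k)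
    rw [Nat.succ_eq_add_one, dq_succ] at hd
    have e : (1 / 2 : ℂ) = dq c k z * (fq c)^[k] z := by linear_combination (-1 / 2) * hd
    rw [e]; exact this
  obtain ⟨p, hp, hp0⟩ := hhalf
  set m := p.natDegree with hm
  refine ⟨1 + 2 * ∑ i ∈ Finset.range m, p.coeff i * 2 ^ (m - i - 1), ?_, ?_⟩
  · intro h
    have := congrArg (fun r : Polynomial ℤ => (r.coeff 0) % 2) h
    simp only [Polynomial.coeff_add, Polynomial.coeff_one_zero, Polynomial.coeff_zero,
      Polynomial.coeff_ofNat_mul] at this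
    omega
  · have e : f (1 + 2 * ∑ i ∈ Finset.range m, p.coeff i * 2 ^ (m - i - 1)) = 0 := by
      rw [Polynomial.eval₂_eq_sum_range, ← hm, Finset.sum_range_succ, hp.coeff_natDegree, map_one,
        one_mul] at hp0
      have h2 : (2 : ℂ) ^ m * (1 / 2) ^ m = 1 := by rw [← mul_pow]; norm_num
      have h3 : (2 : ℂ) ^ m * ∑ i ∈ Finset.range m, f (p.coeff i) * (1 / 2) ^ i =
          2 * ∑ i ∈ Finset.range m, f (p.coeff i) * 2 ^ (m - i - 1) := by
        rw [Finset.mul_sum, Finset.mul_sum]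
        refine Finset.sum_congr rfl fun i hi => ?_
        rw [Finset.mem_range] at hi
        obtain ⟨k, hk⟩ : ∃ k, m = i + (k + 1) := ⟨m - i - 1, by omega⟩
        rw [hk, show i + (k + 1) - i - 1 = k by omega, pow_add]
        have h4 : (2 : ℂ) ^ i * (1 / 2) ^ i = 1 := by rw [← mul_pow]; norm_num
        linear_combination (2 ^ (k + 1) * f (p.coeff i)) * h4
      rw [map_add, map_one, map_mul, map_sum]
      simp only [map_mul, map_pow, map_ofNat]
      linear_combination (2 : ℂ) ^ m * hp0 - h3 - h2
    exact e

end Shi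

open Complex Set Filter Topology Metric
open scoped ContDiff

namespace Shi

lemma xi_one_increasing (n : ℕ) : ∃ a : ℝ, 0 ≤ a ∧ xi 1 n = a ∧ xi 1 (n + 1) ≠ xi 1 n := by
  have : ∀ n, ∃ a : ℝ, 0 ≤ a ∧ xi 1 n = a := by
    intro n
    induction n with
    | zero => exact ⟨0, le_rfl, by simp [xi_zero]⟩
    | succ n ih =>
      obtain ⟨a, h0, h1⟩ := ih
      exact ⟨a ^ 2 + 1, by positivity, by rw [xi_succ, h1]; push_cast; ring⟩
  obtain ⟨a, h0, h1⟩ := this n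
  refine ⟨a, h0, h1, ?_⟩
  rw [xi_succ, h1]
  intro h
  have h' : a ^ 2 + 1 = a := by exact_mod_cast h
  nlinarith [sq_nonneg (a - 1)]

/-- the critical orbit maps are not equicontinuous at a Misiurewicz parameter -/
lemma not_bounded_at_Mis {c β : ℂ} {l : ℕ} (h1 : fq c β = β) (hβ : 1 < ‖2 * β‖) (hl : xi c l = β)
    {r B : ℝ} (hr : 0 < r) (hB : ∀ n ≥ l, ∀ x ∈ ball c r, ‖xi x n‖ ≤ B) : False := by
  have hB0 : 0 ≤ B := (norm_nonneg _).trans (hB l le_rfl c (mem_ball_self hr))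
  -- Lipschitz
  have hL : ∀ n ≥ l, ∀ x ∈ ball c (r / 2), ‖xi x n - xi c n‖ ≤ (B / (r / 2)) * ‖x - c‖ := by
    intro n hn x hx
    refine Convex.norm_image_sub_le_of_norm_deriv_le (𝕜 := ℂ) (f := fun x => xi x n)
      (s := ball c (r / 2)) (fun y _ => differentiable_xi n y) (fun y hy => ?_)
      (convex_ball _ _) (mem_ball_self (by positivity)) hx
    refine Complex.norm_deriv_le_of_forall_mem_sphere_norm_le (by positivity)
      (differentiable_xi n).diffContOnCl fun w hw => hB n hn w ?_
    rw [mem_ball] at hy ⊢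
    rw [mem_sphere] at hw
    linarith [dist_triangle w y c]
  set C := B / (r / 2) with hC
  have hC0 : 0 ≤ C := by positivity
  set δ := (‖2 * β‖ - 1) / 4 with hδ
  have hδ0 : 0 < δ := by rw [hδ]; linarith
  set ν := (‖2 * β‖ + 1) / 2 with hν
  set r' := min (r / 2) (δ / (C + 1)) with hr'
  have hr'0 : 0 < r' := by rw [hr']; positivity
  have hclose : ∀ n ≥ l, ∀ x ∈ ball c r', ‖xi x n - β‖ ≤ δ := by
    intro n hn x hx
    have a := hL n hn x (ball_subset_ball (min_le_left _ _) hx)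
    rw [xi_of_ge h1 hl hn] at a
    refine a.trans ?_
    rw [mem_ball, dist_eq_norm] at hx
    have b : ‖x - c‖ ≤ δ / (C + 1) := hx.le.trans (min_le_right _ _)
    rw [le_div_iff₀ (by positivity)] at b
    nlinarith [norm_nonneg (x - c)]
  have hgrow : ∀ x ∈ ball c r', ∀ k, ν ^ k * ‖xi x (l + 1) - xi x l‖ ≤
      ‖xi x (k + l + 1) - xi x (k + l)‖ := by
    intro x hx k
    induction k with
    | zero => simp
    | succ k ih =>
      have e : xi x (k + 1 + l + 1) - xi x (k + 1 + l) =
          (xi x (k + l + 1) - xi x (k + l)) * (xi x (k + l + 1) + xi x (k + l)) := by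
        rw [xi_succ x (k + 1 + l), show k + 1 + l = (k + l) + 1 by ring]
        nth_rewrite 2 [xi_succ x (k + l)]
        ring
      rw [e, norm_mul, pow_succ]
      have a1 := hclose (k + l + 1) (by omega) x hx
      have a2 := hclose (k + l) (by omega) x hx
      have a3 : ‖2 * β‖ ≤ ‖xi x (k + l + 1) + xi x (k + l)‖ + (‖xi x (k + l + 1) - β‖ +
          ‖xi x (k + l) - β‖) := by
        calc ‖2 * β‖ = ‖(xi x (k + l + 1) + xi x (k + l)) - ((xi x (k + l + 1) - β) +
              (xi x (k + l) - β))‖ := by congr 1; ring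
          _ ≤ _ := (norm_sub_le _ _).trans (by gcongr; exact norm_add_le _ _)
      have a4 : ν ≤ ‖xi x (k + l + 1) + xi x (k + l)‖ := by rw [hν]; linarith
      have hν0 : 0 ≤ ν := by rw [hν]; positivity
      calc ν ^ k * ν * ‖xi x (l + 1) - xi x l‖ = (ν ^ k * ‖xi x (l + 1) - xi x l‖) * ν := by ring
        _ ≤ _ := by gcongr
  have hzero : ∀ x ∈ ball c r', xi x (l + 1) - xi x l = 0 := by
    intro x hx
    by_contra hne
    have hpos : 0 < ‖xi x (l + 1) - xi x l‖ := norm_pos_iff.2 hne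
    obtain ⟨k, hk⟩ := pow_unbounded_of_one_lt (2 * δ / ‖xi x (l + 1) - xi x l‖)
      (by rw [hν]; linarith : 1 < ν)
    rw [div_lt_iff₀ hpos] at hk
    have a1 := hclose (k + l + 1) (by omega) x hx
    have a2 := hclose (k + l) (by omega) x hx
    have a3 : ‖xi x (k + l + 1) - xi x (k + l)‖ ≤ ‖xi x (k + l + 1) - β‖ + ‖xi x (k + l) - β‖ := by
      rw [← norm_sub_rev β (xi x (k + l))]; exact norm_sub_le_norm_sub_add_norm_sub _ _ _
    linarith [hgrow x hx k]
  have hd : Differentiable ℂ (fun x => xi x (l + 1) - xi x l) :=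
    (differentiable_xi _).sub (differentiable_xi _)
  have han : AnalyticOnNhd ℂ (fun x => xi x (l + 1) - xi x l) univ :=
    fun x _ => hd.analyticAt x
  have := han.eq_of_eventuallyEq (g := fun _ => 0) (fun x _ => analyticAt_const)
    (z₀ := c) (by filter_upwards [ball_mem_nhds c hr'0] with x hx using hzero x hx)
  obtain ⟨_, _, _, h⟩ := xi_one_increasing l
  exact h (sub_eq_zero.1 (congrFun this 1))

/-- escaping parameters near a Misiurewicz parameter -/
lemma exists_escaping_near {c : ℂ} (hM : Mis c) {r : ℝ} (hr : 0 < r) (hb : ball c r ⊆ ball 0 3) :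
    ∃ x ∈ ball c r, (0 : ℂ) ∉ Kset x := by
  obtain ⟨β, l, h1, hβ, hl⟩ := hM
  by_contra hcon
  push Not at hcon
  refine not_bounded_at_Mis h1 hβ hl hr (B := 5 / 2) fun n _ x hx => ?_
  have hx3 : ‖x‖ ≤ 3 := by have := hb hx; rw [mem_ball_zero_iff] at this; exact this.le
  exact ((mem_K_iff hx3).1 (hcon x hx) n).le

/-- superattracting parameters near a Misiurewicz parameter -/
lemma exists_center_near {c : ℂ} (hM : Mis c) {r : ℝ} (hr : 0 < r) :
    ∃ x ∈ ball c r, ∃ n, n ≠ 0 ∧ xi x n = 0 := by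
  obtain ⟨β, l, h1, hβ, hl⟩ := hM
  by_contra hcon
  push Not at hcon
  have hne : ∀ x ∈ ball c r, x ≠ 0 := fun x hx h => hcon x hx 1 one_ne_zero (by
    rw [xi_succ, xi_zero, h]; ring)
  obtain ⟨w, hw⟩ := IsAlgClosed.exists_pow_nat_eq (-c) (n := 2) (by norm_num)
  obtain ⟨s, hs, hsc, hs2⟩ := exists_sqrt_ball (f := fun x => -x) (c := c) (r := r) (w := w)
    differentiableOn_id.neg (fun x hx => neg_ne_zero.2 (hne x hx)) hw
  have hs0 : ∀ x ∈ ball c r, s x ≠ 0 := fun x hx h => hne x hx (by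
    have := hs2 x hx; rw [h] at this; simpa using this.symm)
  obtain ⟨C, hC0, hC⟩ := schottky (β / w)
  have hbd : ∀ n ≥ l + 1, ∀ x ∈ ball c (r / 2), ‖xi x n / s x‖ ≤ C := by
    intro n hn x hx
    refine hC r c (fun x => xi x n / s x) hr
      ((differentiable_xi n).differentiableOn.div hs hs0) (fun x hx => ⟨?_, ?_⟩) ?_ x hx
    · exact div_ne_zero (hcon x hx n (by omega)) (hs0 x hx)
    · intro h
      rw [div_eq_one_iff_eq (hs0 x hx)] at h
      refine hcon x hx (n + 1) (by omega) ?_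
      rw [xi_succ, h, hs2 x hx]; ring
    · simp only [hsc, xi_of_ge h1 hl (show l ≤ n by omega)]
  obtain ⟨D, hD⟩ := (isCompact_closedBall c (r / 2)).exists_bound_of_continuousOn (f := s)
    (hs.continuousOn.mono (closedBall_subset_ball (by linarith)))
  refine not_bounded_at_Mis (l := l + 1) (r := r / 2) (B := C * D) h1 hβ
    (xi_of_ge h1 hl (by omega)) (by positivity) fun n hn x hx => ?_
  have hx' : x ∈ ball c r := ball_subset_ball (by linarith) hx
  have e : xi x n = xi x n / s x * s x := by field_simp [hs0 x hx']
  rw [e, norm_mul]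
  exact mul_le_mul (hbd n hn x hx) (hD x (ball_subset_closedBall hx)) (norm_nonneg _) hC0.le

/-- a parameter with attracting cycle is not escaping -/
lemma not_escaping_of_attracting {c z : ℂ} {n : ℕ} (hc : ‖c‖ ≤ 3) (hn : n ≠ 0)
    (hz : (fq c)^[n] z = z) (hd : ‖dq c n z‖ < 1) : (0 : ℂ) ∈ Kset c := by
  by_contra hesc
  have hzk : ∀ k, (fq c)^[n * k] z = z := by
    intro k
    rw [Function.iterate_mul]
    exact Function.iterate_fixed hz k
  -- neighbourhood of z in K
  obtain ⟨r, hr, hrK⟩ : ∃ r > 0, ball z r ⊆ Kset c := by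
    obtain ⟨ν, hν1, hν2⟩ := exists_between hd
    have h0 : ∀ᶠ x in 𝓝 z, ‖dq c n x‖ < ν :=
      (continuous_dq c n).norm.continuousAt.eventually_lt continuousAt_const hν1
    obtain ⟨r, hr, hb⟩ := Metric.eventually_nhds_iff_ball.1 h0
    refine ⟨r, hr, fun x hx => ?_⟩
    have hstay : ∀ k, (fq c)^[n * k] x ∈ ball z r := by
      intro k
      induction k with
      | zero => simpa using hx
      | succ k ih =>
        rw [Nat.mul_succ, add_comm, Function.iterate_add_apply]
        set y := (fq c)^[n * k] x
        have := Convex.norm_image_sub_le_of_norm_deriv_le (𝕜 := ℂ) (f := fun x => (fq c)^[n] x)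
          (s := ball z r) (C := 1) (fun x _ => differentiable_iter c _ x)
          (fun y hy => by rw [deriv_iter]; linarith [hb y hy]) (convex_ball _ _)
          (mem_ball_self hr) ih
        rw [mem_ball, dist_eq_norm] at ih ⊢
        simp only [hz] at this
        linarith
    refine mem_K_of_freq (R := ‖z‖ + r) hc (frequently_atTop.2 fun a => ⟨n * a, ?_, ?_⟩)
    · exact Nat.le_mul_of_pos_left a (Nat.pos_of_ne_zero hn)
    · have := hstay a
      rw [mem_ball, dist_eq_norm] at this
      have := norm_le_norm_add_norm_sub z ((fq c)^[n * a] x)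
      rw [norm_sub_rev] at this
      linarith
  have hzK : z ∈ Kset c := hrK (mem_ball_self hr)
  have hdk : ∀ k, dq c (n * k) z = dq c n z ^ k := by
    intro k
    induction k with
    | zero => simp [dq]
    | succ k ih => rw [Nat.mul_succ, dq_add, ih, hzk, pow_succ]
  have key : ∀ k, 1 ≤ ‖dq c n z‖ ^ k * (5 / 2 / (r / 2)) := by
    intro k
    obtain ⟨g, hg1, hg2, hg3, hg4, hg5⟩ := inv_branch (c := c) (w := z) (z := z) (r := r) (n * k)
      (fun s hs j _ _ h => hesc (by
        have := hrK hs
        rw [h, xi] at this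
        exact mem_K_of_tail hc this)) (hzk k)
    have a := hg5 z (mem_ball_self hr)
    rw [hg2, hdk] at a
    have b : ‖deriv g z‖ ≤ 5 / 2 / (r / 2) := by
      refine Complex.norm_deriv_le_of_forall_mem_sphere_norm_le (by positivity) ?_ fun s hs => ?_
      · apply DifferentiableOn.diffContOnCl
        rw [closure_ball _ (by positivity)]
        exact hg1.mono (closedBall_subset_ball (by linarith))
      · have hs' : s ∈ ball z r := by rw [mem_sphere] at hs; rw [mem_ball]; linarith
        have : g s ∈ Kset c := mem_K_of_tail (n := n * k) hc (by rw [hg3 s hs']; exact hrK hs')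
        simpa using ((mem_K_iff hc).1 this 0).le
    have := congrArg norm a
    rw [norm_mul, norm_pow, norm_one] at this
    rw [← this]
    gcongr
  have ht : Tendsto (fun k : ℕ => ‖dq c n z‖ ^ k * (5 / 2 / (r / 2))) atTop
      (𝓝 (0 * (5 / 2 / (r / 2)))) :=
    (tendsto_pow_atTop_nhds_zero_of_lt_one (norm_nonneg _) hd).mul_const _
  rw [zero_mul] at ht
  obtain ⟨k, hk⟩ := (ht.eventually_lt_const one_pos).exists
  linarith [key k]

end Shi

open Complex Set Filter Topology Metric
open scoped ContDiff

namespace Shi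

lemma isOpen_attr (n : ℕ) : IsOpen {c : ℂ | ∃ z, (fq c)^[n] z = z ∧ ‖dq c n z‖ < 1} := by
  rw [isOpen_iff_mem_nhds]
  rintro c ⟨z, hz, hd⟩
  have h1 : dq c n z ≠ 1 := by
    intro h; rw [h] at hd; simp at hd
  obtain ⟨φ, ha, h0, hf, -⟩ := ift_fix hz h1
  have hc : ∀ᶠ x in 𝓝 c, ‖dq x n (φ x)‖ < 1 := by
    have := ((analyticAt_dq_comp ha n).continuousAt.norm)
    refine this.eventually_lt continuousAt_const ?_
    simpa [h0] using hd
  filter_upwards [hf, hc] with x h1 h2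
  exact ⟨φ x, h1, h2⟩

lemma preconnected_ball_diff {c : ℂ} {r : ℝ} (hr : 0 < r) {X : Set ℂ} (hX : X.Countable) :
    IsPreconnected (ball c r \ X) := by
  let e := OpenPartialHomeomorph.univBall c r
  have hinj : InjOn e univ := by
    have := e.injOn
    rwa [OpenPartialHomeomorph.univBall_source] at this
  have h1 : (e ⁻¹' X).Countable := hX.preimage_of_injOn (hinj.mono (subset_univ _))
  have h2 : IsConnected (e ⁻¹' X)ᶜ :=
    Set.Countable.isConnected_compl_of_one_lt_rank (by rw [rank_real_complex]; norm_num) h1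
  have h3 := h2.isPreconnected.image e (OpenPartialHomeomorph.continuous_univBall c r).continuousOn
  convert h3 using 1
  have ht : e '' univ = ball c r := by
    rw [← OpenPartialHomeomorph.univBall_target c hr, ← OpenPartialHomeomorph.univBall_source c r]
    exact e.image_source_eq_target.symm ▸ rfl
  ext x
  constructor
  · rintro ⟨hx, hxX⟩
    rw [← ht] at hx
    obtain ⟨y, -, rfl⟩ := hx
    exact ⟨y, hxX, rfl⟩
  · rintro ⟨y, hy, rfl⟩
    exact ⟨ht ▸ mem_image_of_mem _ (mem_univ _), hy⟩

lemma fix_mem_K {c z : ℂ} {n : ℕ} (hc : ‖c‖ ≤ 3) (hn : n ≠ 0) (hz : (fq c)^[n] z = z) :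
    z ∈ Kset c := by
  refine mem_K_of_freq (R := ‖z‖) hc ?_
  rw [frequently_atTop]
  intro a
  refine ⟨n * a, Nat.le_mul_of_pos_left a (Nat.pos_of_ne_zero hn), ?_⟩
  have : (fq c)^[n * a] z = z := by
    rw [Function.iterate_mul]
    exact Function.iterate_fixed hz a
  rw [this]

lemma exists_boundary_point {c : ℂ} (hM : Mis c) {r : ℝ} (hr : 0 < r) (hb : ball c r ⊆ ball 0 3) :
    ∃ c3 ∈ ball c r, ∃ n ≠ 0, ∃ φ : ℂ → ℂ, AnalyticAt ℂ φ c3 ∧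
      (∀ᶠ x in 𝓝 c3, (fq x)^[n] (φ x) = φ x) ∧ ‖dq c3 n (φ c3)‖ = 1 ∧
      ¬ ∀ᶠ x in 𝓝 c3, dq x n (φ x) = dq c3 n (φ c3) := by
  obtain ⟨x1, hx1, n, hn, hxn⟩ := exists_center_near hM hr
  obtain ⟨x2, hx2, hK2⟩ := exists_escaping_near hM hr hb
  set A := {c : ℂ | ∃ z, (fq c)^[n] z = z ∧ ‖dq c n z‖ < 1} with hA
  set X := {c : ℂ | IsAlgebraic ℤ c} with hX
  have hXc : X.Countable := Algebraic.countable ℤ ℂ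
  have hd := hXc.dense_compl ℂ
  have hnorm : ∀ x ∈ ball c r, ‖x‖ < 3 := fun x hx => by simpa using hb hx
  have hAo : IsOpen A := isOpen_attr n
  have hx1A : x1 ∈ A := by
    refine ⟨0, hxn, ?_⟩
    have : dq x1 n 0 = 0 := by
      unfold dq
      refine Finset.prod_eq_zero (i := 0) (by simpa using Nat.pos_of_ne_zero hn) (by simp)
    rw [this]; simp
  obtain ⟨y1, ⟨hy1b, hy1A⟩, hy1X⟩ := hd.inter_open_nonempty (ball c r ∩ A) (isOpen_ball.inter hAo)
    ⟨x1, hx1, hx1A⟩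
  obtain ⟨m, hm⟩ := exists_escape_gt (hnorm x2 hx2).le hK2
  have hEo : IsOpen {x : ℂ | 3 < ‖xi x m‖} :=
    isOpen_lt continuous_const (differentiable_xi m).continuous.norm
  obtain ⟨y2, ⟨hy2b, hy2E⟩, hy2X⟩ := hd.inter_open_nonempty (ball c r ∩ {x : ℂ | 3 < ‖xi x m‖})
    (isOpen_ball.inter hEo) ⟨x2, hx2, hm⟩
  have hy2A : y2 ∉ A := by
    rintro ⟨z, hz, hdz⟩
    have h0 := not_escaping_of_attracting (hnorm y2 hy2b).le hn hz hdz
    rw [mem_K_iff (hnorm y2 hy2b).le] at h0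
    have := h0 m
    have h3 : 3 < ‖xi y2 m‖ := hy2E
    unfold xi at h3
    linarith
  have hpre := preconnected_ball_diff (c := c) hr hXc
  have hfr : ((ball c r \ X) ∩ frontier A).Nonempty := by
    by_contra hne
    rw [not_nonempty_iff_eq_empty] at hne
    have hsub : ball c r \ X ⊆ A ∪ (closure A)ᶜ := by
      intro x hx
      by_cases h : x ∈ closure A
      · left
        by_contra h'
        have : x ∈ (ball c r \ X) ∩ frontier A := by
          refine ⟨hx, ?_⟩
          rw [hAo.frontier_eq]
          exact ⟨h, h'⟩
        rw [hne] at this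
        exact this
      · right; exact h
    obtain ⟨x, hx, hxA, hxc⟩ := hpre A (closure A)ᶜ hAo isClosed_closure.isOpen_compl hsub
      ⟨y1, ⟨hy1b, hy1X⟩, hy1A⟩ ⟨y2, ⟨hy2b, hy2X⟩, by
        rcases hsub ⟨hy2b, hy2X⟩ with h | h
        · exact absurd h hy2A
        · exact h⟩
    exact hxc (subset_closure hxA)
  obtain ⟨c3, ⟨hc3b, hc3X⟩, hc3f⟩ := hfr
  rw [hAo.frontier_eq] at hc3f
  obtain ⟨hc3c, hc3A⟩ := hc3f
  rw [mem_closure_iff_seq_limit] at hc3c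
  obtain ⟨u, huA, hu⟩ := hc3c
  have hev : ∀ᶠ k in atTop, u k ∈ ball c r := hu (isOpen_ball.mem_nhds hc3b)
  obtain ⟨k0, hk0⟩ := eventually_atTop.1 hev
  choose z hz hdz using huA
  have hzb : ∀ k, z (k + k0) ∈ ball (0:ℂ) (5/2) := by
    intro k
    have hu3 := (hnorm _ (hk0 (k + k0) (by omega))).le
    exact K_subset_ball hu3 (fix_mem_K hu3 hn (hz _))
  obtain ⟨a, -, ψ, hψ, hψt⟩ := tendsto_subseq_of_bounded isBounded_ball hzb
  have hut : Tendsto (fun k => u (ψ k + k0)) atTop (𝓝 c3) :=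
    hu.comp ((tendsto_add_atTop_nat k0).comp hψ.tendsto_atTop)
  have hpt : Tendsto (fun k => (u (ψ k + k0), z (ψ k + k0))) atTop (𝓝 (c3, a)) :=
    hut.prodMk_nhds hψt
  have hfix : (fq c3)^[n] a = a := by
    have h1 := ((continuous_iter2 n).tendsto (c3, a)).comp hpt
    refine tendsto_nhds_unique h1 ?_
    refine hψt.congr fun k => ?_
    simp [hz]
  have hdl : Tendsto (fun k => ‖dq (u (ψ k + k0)) n (z (ψ k + k0))‖) atTop (𝓝 ‖dq c3 n a‖) :=
    (((continuous_dq2 n).tendsto (c3, a)).comp hpt).norm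
  have hle : ‖dq c3 n a‖ ≤ 1 := le_of_tendsto hdl (Eventually.of_forall fun k => (hdz _).le)
  have hge : 1 ≤ ‖dq c3 n a‖ := by
    by_contra h
    exact hc3A ⟨a, hfix, not_le.1 h⟩
  have hne : dq c3 n a ≠ 1 := fun h => hc3X (algebraic_of_mult_one hfix hn h)
  obtain ⟨φ, hφ, hφ0, hφf, hφu⟩ := ift_fix hfix hne
  refine ⟨c3, hc3b, n, hn, φ, hφ, hφf, by rw [hφ0]; linarith, fun hcon => ?_⟩
  have e1 := hpt.eventually hφu
  have e2 := hut.eventually hcon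
  obtain ⟨k, h1, h2⟩ := (e1.and e2).exists
  have h3 := h1 (hz _)
  simp only at h3
  rw [h3, hφ0] at h2
  have := hdz (ψ k + k0)
  rw [h2] at this
  linarith

lemma exists_root_near {μ : ℂ} (hμ : ‖μ‖ = 1) {U : Set ℂ} (hU : U ∈ 𝓝 μ) (Q : ℕ) :
    ∃ q ≥ Q, q.Prime ∧ ∃ ζ ∈ U, ζ ≠ μ ∧ IsPrimitiveRoot ζ q := by
  set θ := Int.fract (arg μ / (2 * Real.pi)) with hθ
  have hθ0 : 0 ≤ θ := Int.fract_nonneg _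
  have hθ1 : θ < 1 := Int.fract_lt_one _
  have hμθ : cexp (2 * Real.pi * I * θ) = μ := by
    have h1 : (θ : ℂ) = arg μ / (2 * Real.pi) - (⌊arg μ / (2 * Real.pi)⌋ : ℂ) := by
      rw [hθ, Int.fract]; push_cast; ring
    have hpi : (Real.pi : ℂ) ≠ 0 := by exact_mod_cast Real.pi_ne_zero
    have h2 : 2 * Real.pi * I * θ = arg μ * I - (⌊arg μ / (2 * Real.pi)⌋ : ℂ) * (2 * Real.pi * I) := by
      rw [h1]; field_simp
    rw [h2, Complex.exp_periodic.sub_int_mul_eq]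
    have := norm_mul_exp_arg_mul_I μ
    rw [hμ] at this
    simpa using this
  have hcont : Tendsto (fun x : ℝ => cexp (2 * Real.pi * I * x)) (𝓝 θ) (𝓝 μ) := by
    rw [← hμθ]
    have : Continuous (fun x : ℝ => cexp (2 * Real.pi * I * x)) := by fun_prop
    exact this.tendsto θ
  obtain ⟨ε, hε, hεU⟩ := Metric.mem_nhds_iff.1 (hcont hU)
  obtain ⟨q, hq, hqp⟩ := Nat.exists_infinite_primes
    (max Q (max (orderOf μ + 1) (max (⌈1 / ε⌉₊ + 1) (⌈1 / (1 - θ)⌉₊ + 1))))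
  simp only [max_le_iff] at hq
  obtain ⟨q1, q2, q3, q4⟩ := hq
  have hq0 : (0:ℝ) < q := by exact_mod_cast hqp.pos
  have q3' : 1 / ε < q := by
    refine lt_of_le_of_lt (Nat.le_ceil _) ?_
    exact_mod_cast q3
  have q4' : 1 / (1 - θ) < q := by
    refine lt_of_le_of_lt (Nat.le_ceil _) ?_
    exact_mod_cast q4
  rw [div_lt_iff₀ hε] at q3'
  rw [div_lt_iff₀ (by linarith)] at q4'
  set k := ⌊θ * q⌋₊ + 1 with hk
  have hk1 : θ * q < k := by rw [hk]; push_cast; exact Nat.lt_floor_add_one _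
  have hk2 : (k : ℝ) ≤ θ * q + 1 := by
    rw [hk]; push_cast
    linarith [Nat.floor_le (mul_nonneg hθ0 hq0.le)]
  have hkq : k < q := by
    have : (k : ℝ) < q := by nlinarith
    exact_mod_cast this
  have hcop : k.Coprime q := by
    rw [Nat.coprime_comm, Nat.Prime.coprime_iff_not_dvd hqp]
    intro h
    exact absurd (Nat.le_of_dvd (by omega) h) (by omega)
  have hprim := isPrimitiveRoot_exp_of_coprime k q hqp.ne_zero hcop
  refine ⟨q, q1, hqp, _, ?_, ?_, hprim⟩
  · have : ((k / q : ℝ)) ∈ ball θ ε := by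
      rw [mem_ball, Real.dist_eq, abs_lt]
      constructor
      · have : θ < k / q := by rwa [lt_div_iff₀ hq0]
        linarith
      · have : (k:ℝ) / q < θ + ε := by rw [div_lt_iff₀ hq0]; nlinarith
        linarith
    have h := hεU this
    simp only [mem_preimage] at h
    convert h using 3
    push_cast; rfl
  · intro h
    rw [h] at hprim
    have := hprim.eq_orderOf
    omega

/-- Step A: a parabolic parameter near a Misiurewicz parameter. -/
lemma stepA {c : ℂ} (hM : Mis c) {r : ℝ} (hr : 0 < r) (hb : ball c r ⊆ ball 0 3) (Q : ℕ) :
    ∃ c0 ∈ ball c r, ∃ p ≠ 0, ∃ q ≥ Q, ∃ φ : ℂ → ℂ, q ≠ 0 ∧ AnalyticAt ℂ φ c0 ∧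
      (∀ᶠ x in 𝓝 c0, (fq x)^[p] (φ x) = φ x) ∧ IsPrimitiveRoot (dq c0 p (φ c0)) q ∧
      deriv (fun x => dq x p (φ x)) c0 ≠ 0 := by
  obtain ⟨c3, hc3, n, hn, φ, hφ, hφf, hφ1, hnc⟩ := exists_boundary_point hM hr hb
  set lam := fun x => dq x n (φ x) with hlam
  have hla : AnalyticAt ℂ lam c3 := analyticAt_dq_comp hφ n
  have hopen : 𝓝 (lam c3) ≤ map lam (𝓝 c3) := by
    rcases hla.eventually_constant_or_nhds_le_map_nhds with h | h
    · exact absurd h hnc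
    · exact h
  have hder : ∀ᶠ x in 𝓝[≠] c3, deriv lam x ≠ 0 := by
    rcases hla.deriv.eventually_eq_zero_or_eventually_ne_zero with h | h
    · exfalso
      obtain ⟨ε, hε, hε1⟩ := Metric.eventually_nhds_iff_ball.1 (h.and hla.eventually_analyticAt)
      refine hnc (Metric.eventually_nhds_iff_ball.2 ⟨ε, hε, fun y hy => ?_⟩)
      exact (convex_ball c3 ε).is_const_of_fderivWithin_eq_zero (𝕜 := ℂ) (f := lam)
        (fun z hz => (hε1 z hz).2.differentiableAt.differentiableWithinAt)
        (fun z hz => by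
          rw [fderivWithin_of_isOpen isOpen_ball hz]
          ext
          simpa using (hε1 z hz).1) hy (mem_ball_self hε)
    · exact h
  rw [eventually_nhdsWithin_iff] at hder
  have hgood : ∀ᶠ x in 𝓝 c3, x ∈ ball c r ∧ (x ≠ c3 → deriv lam x ≠ 0) ∧ AnalyticAt ℂ φ x ∧
      (∀ᶠ y in 𝓝 x, (fq y)^[n] (φ y) = φ y) := by
    filter_upwards [isOpen_ball.mem_nhds hc3, hder, hφ.eventually_analyticAt,
      hφf.eventually_nhds] with x a b c d
    exact ⟨a, b, c, d⟩
  have hU : lam '' {x | x ∈ ball c r ∧ (x ≠ c3 → deriv lam x ≠ 0) ∧ AnalyticAt ℂ φ x ∧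
      (∀ᶠ y in 𝓝 x, (fq y)^[n] (φ y) = φ y)} ∈ 𝓝 (lam c3) := hopen (image_mem_map hgood)
  obtain ⟨q, hq, hqp, ζ, ⟨x, ⟨h1, h2, h3, h4⟩, hxζ⟩, hζ, hprim⟩ := exists_root_near hφ1 hU Q
  refine ⟨x, h1, n, hn, q, hq, φ, hqp.ne_zero, h3, h4, ?_, h2 ?_⟩
  · have : dq x n (φ x) = ζ := hxζ
    rw [this]; exact hprim
  · rintro rfl
    exact hζ hxζ.symm

end Shi

open Complex Set Filter Topology Metric
open scoped ContDiff

namespace Shi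

structure Par (c0 : ℂ) (p q : ℕ) (φ : ℂ → ℂ) : Prop where
  hc : ‖c0‖ < 3
  hp : p ≠ 0
  hq : q ≠ 0
  an : AnalyticAt ℂ φ c0
  fix : ∀ᶠ x in 𝓝 c0, (fq x)^[p] (φ x) = φ x
  prim : IsPrimitiveRoot (dq c0 p (φ c0)) q
  der : deriv (fun x => dq x p (φ x)) c0 ≠ 0

lemma dq_mul_fix {c z : ℂ} {p : ℕ} (h : (fq c)^[p] z = z) (q : ℕ) :
    dq c (p * q) z = dq c p z ^ q := by
  induction q with
  | zero => simp [dq]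
  | succ q ih =>
    have : p * (q + 1) = p * q + p := by ring
    rw [this, dq_add, ih, pow_succ]
    have h2 : (fq c)^[p * q] z = z := by
      rw [Function.iterate_mul]; exact Function.iterate_fixed h q
    rw [h2]

lemma fix_mul {c z : ℂ} {p : ℕ} (h : (fq c)^[p] z = z) (q : ℕ) : (fq c)^[p * q] z = z := by
  rw [Function.iterate_mul]; exact Function.iterate_fixed h q

lemma Par.fix0 {c0 : ℂ} {p q : ℕ} {φ : ℂ → ℂ} (h : Par c0 p q φ) : (fq c0)^[p] (φ c0) = φ c0 :=
  h.fix.self_of_nhds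

lemma Par.dq0 {c0 : ℂ} {p q : ℕ} {φ : ℂ → ℂ} (h : Par c0 p q φ) : dq c0 (p * q) (φ c0) = 1 := by
  rw [dq_mul_fix h.fix0, h.prim.pow_eq_one]

/-- the local map -/
noncomputable def loc (φ : ℂ → ℂ) (L : ℕ) (c x : ℂ) : ℂ := (fq c)^[L] (φ c + x) - φ c

lemma Par.normal {c0 : ℂ} {p q : ℕ} {φ : ℂ → ℂ} (h : Par c0 p q φ) :
    ∃ N ≥ q, ∃ A : ℂ, A ≠ 0 ∧ ∃ C > 0, ∃ r > 0, ∀ x ∈ ball (0:ℂ) r,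
      ‖loc φ (p * q) c0 x - x - A * x ^ (N + 1)‖ ≤ C * ‖x‖ ^ (N + 2) := by
  set z0 := φ c0 with hz0
  set F : ℂ → ℂ := loc φ (p * q) c0 with hF
  set G : ℂ → ℂ := loc φ p c0 with hG
  have hlocd : ∀ n, Differentiable ℂ (loc φ n c0) := fun n => by
    unfold loc
    exact ((differentiable_iter c0 n).comp (by fun_prop : Differentiable ℂ fun x => φ c0 + x)).sub_const _
  have hlocder : ∀ n, HasDerivAt (loc φ n c0) (dq c0 n z0) 0 := fun n => by
    unfold loc
    have h1 := hasDerivAt_iter c0 n (φ c0 + 0)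
    have h2 := (HasDerivAt.comp_const_add (φ c0) 0 h1).sub_const (φ c0)
    simpa using h2
  have hF0 : F 0 = 0 := by simp [hF, loc, fix_mul h.fix0]
  have hG0 : G 0 = 0 := by simp [hG, loc, h.fix0]
  have hFd : HasDerivAt F 1 0 := by
    have := hlocder (p * q); rwa [h.dq0] at this
  set lam := dq c0 p z0 with hlam
  have hGd : HasDerivAt G lam 0 := hlocder p
  have hlam0 : lam ≠ 0 := h.prim.ne_zero h.hq
  have hcomm : ∀ x, F (G x) = G (F x) := by
    intro x
    simp only [hF, hG, loc, add_sub_cancel]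
    rw [← Function.iterate_add_apply, ← Function.iterate_add_apply, add_comm]
  set hh : ℂ → ℂ := fun x => F x - x with hhh
  have hhd : Differentiable ℂ hh := (hlocd _).sub differentiable_id
  have hhnz : ¬ ∀ᶠ x in 𝓝 (0:ℂ), hh x = 0 := by
    intro hev
    have heq : hh = fun _ => 0 := AnalyticOnNhd.eq_of_eventuallyEq (z₀ := (0:ℂ))
      (fun x _ => hhd.analyticAt x) (fun x _ => analyticAt_const) hev
    have h1 := congrFun heq (3 - z0)
    simp only [hhh, hF, loc, sub_eq_zero] at h1
    have h2 : (fq c0)^[p * q] 3 = 3 := by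
      rw [← hz0] at h1
      have : z0 + (3 - z0) = 3 := by ring
      rw [this] at h1
      linear_combination h1
    have h3 := escape_iter (z := 3) h.hc.le (by norm_num) (p * q)
    rw [h2] at h3
    have h4 : (1:ℝ) < (13/10) ^ (p * q) :=
      one_lt_pow₀ (by norm_num) (mul_ne_zero h.hp h.hq)
    norm_num at h3
    norm_num at h4
    linarith
  obtain ⟨n, g, hg, hg0, hhg⟩ := (hhd.analyticAt 0).exists_eventuallyEq_pow_smul_nonzero_iff.2 hhnz
  simp only [sub_zero, smul_eq_mul] at hhg
  set A := g 0 with hA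
  -- n ≥ 2
  have hn2 : 2 ≤ n := by
    by_contra hlt
    have hn : n = 0 ∨ n = 1 := by omega
    have hd0 : HasDerivAt hh 0 0 := by
      have := hFd.sub (hasDerivAt_id 0); rw [sub_self] at this; exact this
    rcases hn with rfl | rfl
    · have := hhg.self_of_nhds
      simp [hhh, hF0] at this
      exact hg0 this.symm
    · have h1 : HasDerivAt (fun z => z ^ 1 * g z) A 0 := by
        have := ((hasDerivAt_id (0:ℂ)).pow 1).mul hg.differentiableAt.hasDerivAt
        refine this.congr_deriv ?_
        simp [hA]
      have h2 := h1.congr_of_eventuallyEq hhg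
      exact hg0 (h2.unique hd0)
  obtain ⟨N, rfl⟩ : ∃ N, n = N + 1 := ⟨n - 1, by omega⟩
  -- quotient limit
  have hlimG : Tendsto (fun x => G x / x) (𝓝[≠] 0) (𝓝 lam) := by
    have := hGd.tendsto_slope
    refine this.congr fun x => ?_
    simp [slope_def_field, hG0]
  have hGt : Tendsto G (𝓝 0) (𝓝 0) := by
    have := hGd.continuousAt.tendsto; rwa [hG0] at this
  have hlimLHS : Tendsto (fun x => hh (G x) / x ^ (N + 1)) (𝓝[≠] 0) (𝓝 (lam ^ (N + 1) * A)) := by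
    have h1 : Tendsto (fun x => (G x / x) ^ (N + 1) * g (G x)) (𝓝[≠] 0) (𝓝 (lam ^ (N + 1) * A)) :=
      (hlimG.pow _).mul ((hg.continuousAt.tendsto.comp hGt).mono_left nhdsWithin_le_nhds)
    refine h1.congr' ?_
    have h2 := (hGt.eventually hhg).filter_mono (nhdsWithin_le_nhds (s := {0}ᶜ))
    filter_upwards [h2] with x hx
    rw [hx]; rw [div_pow]; ring
  have hlimRHS : Tendsto (fun x => hh (G x) / x ^ (N + 1)) (𝓝[≠] 0) (𝓝 (lam * A)) := by
    have hs : HasStrictDerivAt G lam 0 := by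
      have := ((hlocd p).analyticAt 0).hasStrictDerivAt
      rwa [show deriv (loc φ p c0) 0 = lam from hGd.deriv] at this
    have hFt : Tendsto (fun x => (F x, x)) (𝓝 0) (𝓝 ((0:ℂ), (0:ℂ))) := by
      have h1 := hFd.continuousAt.tendsto
      rw [hF0] at h1
      exact h1.prodMk_nhds tendsto_id
    have hlo := hs.hasStrictFDerivAt.isLittleO.comp_tendsto hFt
    have hO : (fun x => hh x) =O[𝓝 0] fun x => x ^ (N + 1) := by
      have h1 : (fun x => x ^ (N + 1) * g x) =O[𝓝 0] fun x => x ^ (N + 1) * 1 :=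
        (Asymptotics.isBigO_refl _ _).mul (hg.continuousAt.isBigO_one ℂ)
      simp only [mul_one] at h1
      exact h1.congr' (hhg.mono fun x hx => hx.symm) (EventuallyEq.refl _ _)
    have hlo2 : (fun x => G (F x) - G x - (F x - x) * lam) =o[𝓝[≠] 0] fun x => x ^ (N + 1) := by
      have := hlo.trans_isBigO hO
      refine (this.mono nhdsWithin_le_nhds).congr_left fun x => ?_
      simp [Function.comp]
    have ht := hlo2.tendsto_div_nhds_zero
    have h3 : Tendsto (fun x => (G (F x) - G x - (F x - x) * lam) / x ^ (N + 1) + lam * g x)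
        (𝓝[≠] 0) (𝓝 (0 + lam * A)) :=
      ht.add ((tendsto_const_nhds.mul hg.continuousAt.tendsto).mono_left nhdsWithin_le_nhds)
    rw [zero_add] at h3
    refine h3.congr' ?_
    filter_upwards [hhg.filter_mono (nhdsWithin_le_nhds (s := {0}ᶜ)), self_mem_nhdsWithin] with x hx hx0
    have hx0' : x ≠ 0 := hx0
    have e1 : F x - x = x ^ (N + 1) * g x := hx
    rw [e1]
    have e2 : hh (G x) = G (F x) - G x := by simp only [hhh]; rw [hcomm]
    rw [e2]
    field_simp
    ring
  have heq := tendsto_nhds_unique hlimLHS hlimRHS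
  have hN1 : lam ^ N = 1 := by
    have : lam ^ N * (lam * A) = 1 * (lam * A) := by linear_combination heq
    exact mul_right_cancel₀ (mul_ne_zero hlam0 hg0) this
  have hqN : q ≤ N := Nat.le_of_dvd (by omega) (h.prim.dvd_of_pow_eq_one N hN1)
  -- estimate
  have hgO : (fun x => g x - A) =O[𝓝 0] fun x => x := by
    have := hg.differentiableAt.isBigO_sub
    simpa using this
  obtain ⟨C, hC, hCb⟩ := hgO.exists_pos
  have hCb' := hCb.bound
  obtain ⟨r, hr, hrb⟩ := Metric.eventually_nhds_iff_ball.1 (hCb'.and hhg)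
  refine ⟨N, hqN, A, hg0, C, hC, r, hr, fun x hx => ?_⟩
  obtain ⟨h1, h2⟩ := hrb x hx
  have e : F x - x - A * x ^ (N + 1) = x ^ (N + 1) * (g x - A) := by
    have : F x - x = x ^ (N + 1) * g x := h2
    rw [this]; ring
  rw [e, norm_mul, norm_pow]
  calc ‖x‖ ^ (N + 1) * ‖g x - A‖ ≤ ‖x‖ ^ (N + 1) * (C * ‖x‖) := by gcongr
    _ = C * ‖x‖ ^ (N + 2) := by ring

/-- normal form estimate -/
def NF (Φ : ℂ → ℂ → ℂ) (Lam : ℂ → ℂ) (c0 A : ℂ) (N : ℕ) : Prop :=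
  ∃ C > 0, ∃ r > 0, ∀ c ∈ ball c0 r, ∀ x ∈ ball (0:ℂ) r,
    ‖Φ c x - Lam c * x - A * x ^ (N + 1)‖ ≤ C * (‖x‖ ^ (N + 2) + ‖c - c0‖ * ‖x‖ ^ 2)

lemma contDiffAt_loc {φ : ℂ → ℂ} {c : ℂ} (h : AnalyticAt ℂ φ c) (L : ℕ) (x : ℂ) :
    ContDiffAt ℂ ω (fun u : ℂ × ℂ => loc φ L u.1 u.2) (c, x) := by
  unfold loc
  have h1 : ContDiffAt ℂ ω (fun u : ℂ × ℂ => φ u.1) (c, x) :=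
    (h.contDiffAt (n := ω)).comp (c, x) contDiffAt_fst
  exact ((contDiff_iter2 L).contDiffAt.comp (c, x)
    (contDiffAt_fst.prodMk (h1.add contDiffAt_snd))).sub h1

lemma differentiable_loc (φ : ℂ → ℂ) (n : ℕ) (c : ℂ) : Differentiable ℂ (loc φ n c) := by
  unfold loc
  exact ((differentiable_iter c n).comp (by fun_prop : Differentiable ℂ fun x => φ c + x)).sub_const _

lemma hasDerivAt_loc (φ : ℂ → ℂ) (n : ℕ) (c : ℂ) : HasDerivAt (loc φ n c) (dq c n (φ c)) 0 := by
  unfold loc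
  have h1 := hasDerivAt_iter c n (φ c + 0)
  have h2 := (HasDerivAt.comp_const_add (φ c) 0 h1).sub_const (φ c)
  simpa using h2

lemma Par.nf {c0 : ℂ} {p q : ℕ} {φ : ℂ → ℂ} (h : Par c0 p q φ) :
    ∃ N ≥ q, ∃ A : ℂ, A ≠ 0 ∧ NF (loc φ (p * q)) (fun c => dq c (p * q) (φ c)) c0 A N := by
  obtain ⟨N, hN, A, hA, C, hC, r, hr, hest⟩ := h.normal
  refine ⟨N, hN, A, hA, ?_⟩
  set L := p * q
  have hcd := contDiffAt_loc h.an L 0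
  obtain ⟨K, t, ht, hlip⟩ := (hcd.of_le (m := 1) (by simp)).exists_lipschitzOnWith
  obtain ⟨ε, hε, hεt⟩ := Metric.mem_nhds_iff.1 ht
  have hlam : (fun c => dq c L (φ c) - dq c0 L (φ c0)) =O[𝓝 c0] fun c => c - c0 :=
    (analyticAt_dq_comp h.an L).differentiableAt.isBigO_sub
  obtain ⟨K2, hK2, hlam⟩ := hlam.exists_pos
  obtain ⟨ε2, hε2, hlam2⟩ := Metric.eventually_nhds_iff_ball.1 (hlam.bound.and h.fix)
  set s := min ε 1 with hs
  have hs0 : 0 < s := by positivity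
  set M := (K + K2 : ℝ) with hM
  have hM0 : 0 < M := by positivity
  refine ⟨C + 2 * M / s ^ 2, by positivity, min r (min s ε2), by positivity, fun c hc x hx => ?_⟩
  have hc1 : c ∈ ball c0 s := ball_subset_ball ((min_le_right _ _).trans (min_le_left _ _)) hc
  have hc2 : c ∈ ball c0 ε2 := ball_subset_ball ((min_le_right _ _).trans (min_le_right _ _)) hc
  have hx1 : x ∈ ball (0:ℂ) s := ball_subset_ball ((min_le_right _ _).trans (min_le_left _ _)) hx
  have hx2 : x ∈ ball (0:ℂ) r := ball_subset_ball (min_le_left _ _) hx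
  set Lc := dq c L (φ c) with hLc
  set H : ℂ → ℂ := fun y => loc φ L c y - loc φ L c0 y - (Lc - 1) * y with hH
  have hH0 : H 0 = 0 := by
    have e1 : (fq c)^[L] (φ c) = φ c := fix_mul (hlam2 c hc2).2 q
    have e2 : (fq c0)^[L] (φ c0) = φ c0 := fix_mul h.fix0 q
    simp [hH, loc, e1, e2]
  have hHd : Differentiable ℂ H :=
    ((differentiable_loc φ L c).sub (differentiable_loc φ L c0)).sub (by fun_prop)
  have hHder : deriv H 0 = 0 := by
    have h1 := ((hasDerivAt_loc φ L c).sub (hasDerivAt_loc φ L c0)).sub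
      ((hasDerivAt_id (0:ℂ)).const_mul (Lc - 1))
    have h2 := h1.deriv
    rw [h.dq0] at h2
    rw [show H = (loc φ L c - loc φ L c0) - (fun y => (Lc - 1) * id y) from rfl, h2]
    ring
  have hHb : ∀ y ∈ ball (0:ℂ) s, ‖H y - H 0‖ ≤ M * ‖c - c0‖ := by
    intro y hy
    rw [hH0, sub_zero]
    have hys : ‖y‖ < s := by simpa using hy
    have hcs : dist c c0 < s := hc1
    have hm1 : (c, y) ∈ t := hεt (by
      rw [mem_ball, Prod.dist_eq, max_lt_iff]
      exact ⟨hcs.trans_le (min_le_left _ _), by simpa using hys.trans_le (min_le_left _ _)⟩)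
    have hm2 : (c0, y) ∈ t := hεt (by
      rw [mem_ball, Prod.dist_eq, max_lt_iff]
      exact ⟨by simpa using hε, by simpa using hys.trans_le (min_le_left _ _)⟩)
    have h1 := hlip.dist_le_mul _ hm1 _ hm2
    rw [Prod.dist_eq] at h1
    simp only [dist_self, dist_eq_norm] at h1
    rw [max_eq_left (norm_nonneg _)] at h1
    have h2 := (hlam2 c hc2).1
    rw [h.dq0] at h2
    have h3 : ‖y‖ ≤ 1 := hys.le.trans (min_le_right _ _)
    calc ‖H y‖ ≤ ‖loc φ L c y - loc φ L c0 y‖ + ‖(Lc - 1) * y‖ := norm_sub_le _ _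
      _ ≤ K * ‖c - c0‖ + K2 * ‖c - c0‖ * 1 := by
        rw [norm_mul]; gcongr
      _ = M * ‖c - c0‖ := by rw [hM]; ring
  have hT := taylor_one hHd.differentiableOn hHb hx1
  rw [hH0, hHder] at hT
  simp only [sub_zero, zero_mul] at hT
  have hE := hest x hx2
  have e : loc φ L c x - Lc * x - A * x ^ (N + 1) =
      H x + (loc φ L c0 x - x - A * x ^ (N + 1)) := by simp only [hH]; ring
  rw [e]
  refine (norm_add_le _ _).trans ((add_le_add hT hE).trans ?_)
  have p1 : 0 ≤ 2 * M / s ^ 2 * ‖x‖ ^ (N + 2) := by positivity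
  have p2 : 0 ≤ C * (‖c - c0‖ * ‖x‖ ^ 2) := by positivity
  have e3 : 2 * (M * ‖c - c0‖) * ‖x‖ ^ 2 / s ^ 2 = 2 * M / s ^ 2 * (‖c - c0‖ * ‖x‖ ^ 2) := by ring
  rw [e3]
  linarith

end Shi

open Complex Set Filter Topology Metric
open scoped ContDiff

namespace Shi

lemma norm_pow_sub_pow_le' (a b : ℂ) {m : ℝ} (ha : ‖a‖ ≤ m) (hb : ‖b‖ ≤ m) (n : ℕ) :
    ‖a ^ (n + 1) - b ^ (n + 1)‖ ≤ (n + 1) * m ^ n * ‖a - b‖ := by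
  have hm : 0 ≤ m := (norm_nonneg a).trans ha
  induction n with
  | zero => simp
  | succ n ih =>
    have e : a ^ (n + 1 + 1) - b ^ (n + 1 + 1) =
      a * (a ^ (n + 1) - b ^ (n + 1)) + (a - b) * b ^ (n + 1) := by ring
    rw [e]
    refine (norm_add_le _ _).trans ?_
    rw [norm_mul, norm_mul, norm_pow]
    calc ‖a‖ * ‖a ^ (n + 1) - b ^ (n + 1)‖ + ‖a - b‖ * ‖b‖ ^ (n + 1)
        ≤ m * ((n + 1) * m ^ n * ‖a - b‖) + ‖a - b‖ * m ^ (n + 1) := by gcongr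
      _ = _ := by push_cast; ring

/-- local inverse with parameter -/
lemma local_inv {Φ : ℂ → ℂ → ℂ} {c0 : ℂ} (hΦ : ContDiffAt ℂ ω (fun u : ℂ × ℂ => Φ u.1 u.2) (c0, 0))
    (h0 : Φ c0 0 = 0) (hd : HasDerivAt (Φ c0) 1 0) :
    ∃ Ψ : ℂ → ℂ → ℂ, ContDiffAt ℂ ω (fun u : ℂ × ℂ => Ψ u.1 u.2) (c0, 0) ∧ Ψ c0 0 = 0 ∧
      ∀ᶠ u : ℂ × ℂ in 𝓝 (c0, 0), Φ u.1 (Ψ u.1 u.2) = u.2 := by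
  have hω : (ω : WithTop ℕ∞) ≠ 0 := by simp
  set G : (ℂ × ℂ) × ℂ → ℂ := fun w => Φ w.1.1 w.2 - w.1.2 with hG
  have hGc : ContDiffAt ℂ ω G ((c0, 0), 0) := by
    have h1 : ContDiffAt ℂ ω (fun w : (ℂ × ℂ) × ℂ => (w.1.1, w.2)) ((c0, 0), 0) :=
      (contDiff_fst.comp contDiff_fst |>.prodMk contDiff_snd).contDiffAt
    exact (ContDiffAt.comp ((c0, 0), 0) hΦ h1).sub (contDiff_snd.comp contDiff_fst).contDiffAt
  have hinv : (fderiv ℂ G ((c0, 0), 0) ∘L .inr ℂ (ℂ × ℂ) ℂ).IsInvertible := by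
    have h1 : HasFDerivAt (fun z => G ((c0, 0), z)) (fderiv ℂ G ((c0, 0), 0) ∘L .inr ℂ (ℂ × ℂ) ℂ) 0 :=
      ((hGc.differentiableAt hω).hasFDerivAt).comp (0:ℂ) (hasFDerivAt_prodMk_right (c0, (0:ℂ)) (0:ℂ))
    have h2 : HasDerivAt (fun z => G ((c0, 0), z)) 1 0 := by
      simpa [hG] using hd
    have h3 := h1.unique h2.hasFDerivAt
    refine ⟨ContinuousLinearEquiv.refl ℂ ℂ, ?_⟩
    rw [h3]
    ext
    simp
  refine ⟨fun c y => hGc.implicitFunction hω hinv (c, y),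
    hGc.contDiffAt_implicitFunction hω hinv, hGc.implicitFunction_apply_self hω hinv, ?_⟩
  filter_upwards [hGc.eventually_apply_implicitFunction hω hinv] with u hu
  simp only [hG, h0] at hu
  simpa [sub_eq_zero] using hu

set_option maxHeartbeats 1000000 in
lemma NF.inv {Φ Ψ : ℂ → ℂ → ℂ} {Lam : ℂ → ℂ} {c0 A : ℂ} {N : ℕ} (h : NF Φ Lam c0 A N) (hN : N ≠ 0)
    (hL : DifferentiableAt ℂ Lam c0) (hL1 : Lam c0 = 1)
    (hΨ : ContinuousAt (fun u : ℂ × ℂ => Ψ u.1 u.2) (c0, 0)) (hΨ0 : Ψ c0 0 = 0)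
    (hinv : ∀ᶠ u : ℂ × ℂ in 𝓝 (c0, 0), Φ u.1 (Ψ u.1 u.2) = u.2) :
    NF Ψ (fun c => (Lam c)⁻¹) c0 (-A) N := by
  obtain ⟨C, hC, r, hr, hest⟩ := h
  obtain ⟨K, hK, hLK⟩ := hL.isBigO_sub.exists_pos
  have hLc : ∀ᶠ c in 𝓝 c0, ‖Lam c - 1‖ < 1 / 4 := by
    have := hL.continuousAt.tendsto
    rw [hL1] at this
    have h2 := this.eventually (ball_mem_nhds (1:ℂ) (by norm_num : (0:ℝ) < 1/4))
    simpa [mem_ball, dist_eq_norm] using h2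
  -- small x
  set s := min r (min (1/2) (1 / (8 * (‖A‖ + 2 * C)))) with hs
  have hs0 : 0 < s := by positivity
  have hsm : ∀ᶠ u : ℂ × ℂ in 𝓝 (c0, 0), ‖Ψ u.1 u.2‖ < s := by
    have h1 := hΨ.tendsto
    simp only [hΨ0] at h1
    have h2 := h1.eventually (ball_mem_nhds (0:ℂ) hs0)
    simpa [mem_ball] using h2
  have hcc : ∀ᶠ u : ℂ × ℂ in 𝓝 (c0, 0), ‖Lam u.1 - 1‖ < 1 / 4 ∧ ‖Lam u.1 - Lam c0‖ ≤ K * ‖u.1 - c0‖ := by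
    have : Tendsto (fun u : ℂ × ℂ => u.1) (𝓝 (c0, 0)) (𝓝 c0) := continuous_fst.tendsto _
    exact this.eventually (hLc.and hLK.bound)
  obtain ⟨ε, hε, hεb⟩ := Metric.eventually_nhds_iff_ball.1 (hinv.and (hsm.and hcc))
  set t := min ε (min r (1/2)) with ht
  have ht0 : 0 < t := by positivity
  set D := 2 * (C * 2 ^ (N + 2) + C * 4) +
    ‖A‖ * (2 * K * 2 ^ (N + 1) + (N + 1) * 2 ^ N * (2 * K + 4 * (‖A‖ + 2 * C))) with hD
  refine ⟨D + 1, by positivity, t, ht0, fun c hc y hy => ?_⟩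
  have hcε : dist c c0 < ε := (mem_ball.1 hc).trans_le (min_le_left _ _)
  have hyt : ‖y‖ < t := by simpa using hy
  have hmem : (c, y) ∈ ball (c0, (0:ℂ)) ε := by
    rw [mem_ball, Prod.dist_eq, max_lt_iff]
    exact ⟨hcε, by simpa using hyt.trans_le (min_le_left _ _)⟩
  obtain ⟨e1, e2, e3, e4⟩ := hεb _ hmem
  simp only at e1 e2 e3 e4
  rw [hL1] at e4
  set x := Ψ c y with hx
  set d := ‖c - c0‖ with hd
  have hd1 : d ≤ 1 / 2 := by
    have : d < t := by simpa [dist_eq_norm] using hc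
    exact this.le.trans ((min_le_right _ _).trans (min_le_right _ _))
  have hd0 : 0 ≤ d := norm_nonneg _
  have hcr : c ∈ ball c0 r := ball_subset_ball ((min_le_right _ _).trans (min_le_left _ _)) hc
  have hxr : x ∈ ball (0:ℂ) r := by simpa using e2.trans_le (min_le_left _ _)
  have hE := hest c hcr x hxr
  rw [e1] at hE
  have hx2 : ‖x‖ ≤ 1 / 2 := e2.le.trans ((min_le_right _ _).trans (min_le_left _ _))
  have hx3 : ‖x‖ * (‖A‖ + 2 * C) ≤ 1 / 8 := by
    have : ‖x‖ ≤ 1 / (8 * (‖A‖ + 2 * C)) := e2.le.trans ((min_le_right _ _).trans (min_le_right _ _))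
    rw [le_div_iff₀ (by positivity)] at this
    linarith
  obtain ⟨n, rfl⟩ : ∃ n, N = n + 1 := ⟨N - 1, by omega⟩
  set ee := y - Lam c * x - A * x ^ (n + 1 + 1) with hee
  have hxx : 0 ≤ ‖x‖ := norm_nonneg x
  have hpw : ‖x‖ ^ (n + 1 + 1) ≤ ‖x‖ ^ 2 := by
    rw [show n + 1 + 1 = 2 + n by ring]
    exact pow_le_pow_of_le_one hxx (by linarith) (by omega)
  have hpw2 : ‖x‖ ^ (n + 1 + 2) ≤ ‖x‖ ^ 2 :=
    pow_le_pow_of_le_one hxx (by linarith) (by omega)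
  have hyx0 : ‖y - Lam c * x‖ ≤ (‖A‖ + 2 * C) * ‖x‖ ^ 2 := by
    have : y - Lam c * x = ee + A * x ^ (n + 1 + 1) := by rw [hee]; ring
    rw [this]
    refine (norm_add_le _ _).trans ?_
    rw [norm_mul, norm_pow]
    have q1 : d * ‖x‖ ^ 2 ≤ ‖x‖ ^ 2 := by nlinarith [sq_nonneg ‖x‖]
    nlinarith [mul_le_mul_of_nonneg_left hpw (norm_nonneg A), mul_le_mul_of_nonneg_left hpw2 hC.le,
      mul_le_mul_of_nonneg_left q1 hC.le]
  have hyx0' : ‖y - Lam c * x‖ ≤ 1 / 8 * ‖x‖ := by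
    refine hyx0.trans ?_
    nlinarith
  have hLx : ‖Lam c * x - x‖ ≤ 1 / 4 * ‖x‖ := by
    have : Lam c * x - x = (Lam c - 1) * x := by ring
    rw [this, norm_mul]; gcongr
  have hxy : ‖x‖ ≤ 2 * ‖y‖ := by
    have h1 : x = y - (y - Lam c * x) - (Lam c * x - x) := by ring
    have h2 : ‖x‖ ≤ ‖y‖ + ‖y - Lam c * x‖ + ‖Lam c * x - x‖ := by
      conv_lhs => rw [h1]
      exact (norm_sub_le _ _).trans (add_le_add_left (norm_sub_le _ _) _)
    linarith
  have hyy : 0 ≤ ‖y‖ := norm_nonneg y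
  have hy1 : ‖y‖ ≤ 1 / 2 := hyt.le.trans ((min_le_right _ _).trans (min_le_right _ _))
  have hyx : ‖y - x‖ ≤ (2 * K + 4 * (‖A‖ + 2 * C)) * (d * ‖y‖ + ‖y‖ ^ 2) := by
    have h1 : y - x = (y - Lam c * x) + (Lam c - 1) * x := by ring
    rw [h1]
    refine (norm_add_le _ _).trans ?_
    rw [norm_mul]
    have h3 : ‖x‖ ^ 2 ≤ 4 * ‖y‖ ^ 2 := by nlinarith
    have h4 : ‖Lam c - 1‖ * ‖x‖ ≤ (K * d) * (2 * ‖y‖) := by gcongr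
    have h5 : 0 ≤ ‖A‖ + 2 * C := by positivity
    have h6 := mul_le_mul_of_nonneg_left h3 h5
    have h7 : 0 ≤ 2 * K * ‖y‖ ^ 2 := by positivity
    have h8 : 0 ≤ 4 * (‖A‖ + 2 * C) * (d * ‖y‖) := by positivity
    nlinarith
  -- main
  have hLn : 1 / 2 ≤ ‖Lam c‖ := by
    have : ‖(1:ℂ)‖ ≤ ‖Lam c‖ + ‖Lam c - 1‖ := by
      have := norm_sub_le (Lam c) (Lam c - 1); simpa using this
    rw [norm_one] at this; linarith
  have hL0 : Lam c ≠ 0 := by intro h; rw [h] at hLn; norm_num at hLn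
  have hLi : ‖(Lam c)⁻¹‖ ≤ 2 := by
    rw [norm_inv, inv_le_comm₀ (by linarith) (by norm_num)]; linarith
  have key : x - (Lam c)⁻¹ * y - -A * y ^ (n + 1 + 1) =
      -((Lam c)⁻¹ * ee) + A * ((Lam c)⁻¹ * (Lam c - 1) * x ^ (n + 1 + 1) +
        (y ^ (n + 1 + 1) - x ^ (n + 1 + 1))) := by
    rw [hee]; field_simp; ring
  have hpd := norm_pow_sub_pow_le' y x (m := 2 * ‖y‖) (by linarith) hxy (n + 1)
  have b1 : ‖-((Lam c)⁻¹ * ee)‖ ≤ 2 * (C * ((2 * ‖y‖) ^ (n + 1 + 2) + d * (2 * ‖y‖) ^ 2)) := by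
    rw [norm_neg, norm_mul]
    have : ‖ee‖ ≤ C * ((2 * ‖y‖) ^ (n + 1 + 2) + d * (2 * ‖y‖) ^ 2) := by
      refine hE.trans ?_
      gcongr
    gcongr
  have b2 : ‖(Lam c)⁻¹ * (Lam c - 1) * x ^ (n + 1 + 1)‖ ≤ 2 * (K * d) * (2 * ‖y‖) ^ (n + 1 + 1) := by
    rw [norm_mul, norm_mul, norm_pow]
    gcongr
  have b3 : ‖y ^ (n + 1 + 1) - x ^ (n + 1 + 1)‖ ≤ ((n + 1 : ℕ) + 1) * (2 * ‖y‖) ^ (n + 1) *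
      ((2 * K + 4 * (‖A‖ + 2 * C)) * (d * ‖y‖ + ‖y‖ ^ 2)) := by
    refine hpd.trans ?_
    gcongr
  rw [key]
  have hsum : ‖-((Lam c)⁻¹ * ee) + A * ((Lam c)⁻¹ * (Lam c - 1) * x ^ (n + 1 + 1) +
        (y ^ (n + 1 + 1) - x ^ (n + 1 + 1)))‖ ≤
      2 * (C * ((2 * ‖y‖) ^ (n + 1 + 2) + d * (2 * ‖y‖) ^ 2)) +
      ‖A‖ * (2 * (K * d) * (2 * ‖y‖) ^ (n + 1 + 1) + ((n + 1 : ℕ) + 1) * (2 * ‖y‖) ^ (n + 1) *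
      ((2 * K + 4 * (‖A‖ + 2 * C)) * (d * ‖y‖ + ‖y‖ ^ 2))) := by
    refine (norm_add_le _ _).trans (add_le_add b1 ?_)
    rw [norm_mul]
    exact mul_le_mul_of_nonneg_left ((norm_add_le _ _).trans (add_le_add b2 b3)) (norm_nonneg _)
  refine hsum.trans ?_
  set Y := ‖y‖ ^ (n + 1 + 2) + d * ‖y‖ ^ 2 with hY
  have hyp : ‖y‖ ^ (n + 1 + 1) ≤ ‖y‖ ^ 2 := by
    exact pow_le_pow_of_le_one hyy (by linarith) (by omega)
  have c1 : ‖y‖ ^ (n + 1 + 2) ≤ Y := by rw [hY]; linarith [mul_nonneg hd0 (sq_nonneg ‖y‖)]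
  have c2 : d * ‖y‖ ^ 2 ≤ Y := by rw [hY]; linarith [pow_nonneg hyy (n + 1 + 2)]
  have c3 : d * ‖y‖ ^ (n + 1 + 1) ≤ Y := (mul_le_mul_of_nonneg_left hyp hd0).trans c2
  have c4 : ‖y‖ ^ (n + 1) * (d * ‖y‖ + ‖y‖ ^ 2) ≤ Y := by
    have h1 := mul_le_mul_of_nonneg_left hyp hd0
    have : ‖y‖ ^ (n + 1) * (d * ‖y‖ + ‖y‖ ^ 2) = d * ‖y‖ ^ (n + 1 + 1) + ‖y‖ ^ (n + 1 + 2) := by ring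
    rw [this, hY]; linarith
  have hY0 : 0 ≤ Y := by positivity
  calc _ = 2 * (C * 2 ^ (n + 1 + 2) * ‖y‖ ^ (n + 1 + 2) + C * 4 * (d * ‖y‖ ^ 2)) +
      ‖A‖ * (2 * K * 2 ^ (n + 1 + 1) * (d * ‖y‖ ^ (n + 1 + 1)) + ((n + 1 : ℕ) + 1) * 2 ^ (n + 1) *
      (2 * K + 4 * (‖A‖ + 2 * C)) * (‖y‖ ^ (n + 1) * (d * ‖y‖ + ‖y‖ ^ 2))) := by
        rw [mul_pow, mul_pow, mul_pow, mul_pow]; ring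
    _ ≤ 2 * (C * 2 ^ (n + 1 + 2) * Y + C * 4 * Y) +
      ‖A‖ * (2 * K * 2 ^ (n + 1 + 1) * Y + ((n + 1 : ℕ) + 1) * 2 ^ (n + 1) *
      (2 * K + 4 * (‖A‖ + 2 * C)) * Y) := by gcongr
    _ = D * Y := by rw [hD]; ring
    _ ≤ (D + 1) * Y := by linarith

end Shi

open Complex Set Filter Topology Metric
open scoped ContDiff

namespace Shi

/-- chart at infinity -/
noncomputable def ch (N : ℕ) (X w : ℂ) : ℂ := X * exp (-(1 / (N:ℂ)) * log (I * w))

/-- map in the chart -/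
noncomputable def tm (Φ : ℂ → ℂ → ℂ) (N : ℕ) (X c w : ℂ) : ℂ :=
  w * exp (-(N:ℂ) * log (Φ c (ch N X w) / ch N X w))

lemma ch_pow {N : ℕ} (hN : N ≠ 0) (X : ℂ) {w : ℂ} (hw : w ≠ 0) : ch N X w ^ N = X ^ N / (I * w) := by
  have hN' : (N:ℂ) ≠ 0 := by exact_mod_cast hN
  have hw' : I * w ≠ 0 := mul_ne_zero I_ne_zero hw
  unfold ch
  rw [mul_pow, ← exp_nat_mul]
  have : (N:ℂ) * (-(1 / (N:ℂ)) * log (I * w)) = -log (I * w) := by field_simp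
  rw [this, exp_neg, exp_log hw']
  rfl

lemma ch_ne {N : ℕ} {X w : ℂ} (hX : X ≠ 0) : ch N X w ≠ 0 := mul_ne_zero hX (exp_ne_zero _)

lemma ch_inj {N : ℕ} (hN : N ≠ 0) {X w w' : ℂ} (hX : X ≠ 0) (hw : w ≠ 0) (hw' : w' ≠ 0)
    (h : ch N X w = ch N X w') : w = w' := by
  have h1 := congrArg (· ^ N) h
  simp only [ch_pow hN X hw, ch_pow hN X hw'] at h1
  have hX' : X ^ N ≠ 0 := pow_ne_zero _ hX
  have := I_ne_zero
  field_simp at h1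
  exact h1.symm

lemma norm_ch_pow {N : ℕ} (hN : N ≠ 0) (X : ℂ) {w : ℂ} (hw : w ≠ 0) :
    ‖ch N X w‖ ^ N * ‖w‖ = ‖X‖ ^ N := by
  rw [← norm_pow, ch_pow hN X hw, norm_div, norm_mul, norm_I, one_mul, norm_pow]
  have : ‖w‖ ≠ 0 := norm_ne_zero_iff.2 hw
  field_simp

lemma ch_small {N : ℕ} (hN : N ≠ 0) (X : ℂ) {ε : ℝ} (hε : 0 < ε) :
    ∃ E > 0, ∀ w : ℂ, E ≤ ‖w‖ → ‖ch N X w‖ < ε := by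
  refine ⟨(‖X‖ ^ N + 1) / ε ^ N, by positivity, fun w hw => ?_⟩
  have hw0 : 0 < ‖w‖ := lt_of_lt_of_le (by positivity) hw
  have h1 := norm_ch_pow hN X (norm_pos_iff.1 hw0)
  by_contra h
  push Not at h
  have h2 : ε ^ N ≤ ‖ch N X w‖ ^ N := by gcongr
  rw [div_le_iff₀ (by positivity)] at hw
  nlinarith

lemma arg_bound {w : ℂ} (hw : w ≠ 0) (hr : w.im ≤ ‖w‖ / 2) : |arg (I * w)| ≤ Real.pi - 1 := by
  have hw' : I * w ≠ 0 := mul_ne_zero I_ne_zero hw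
  have hwn : 0 < ‖w‖ := norm_pos_iff.2 hw
  have h1 := cos_arg hw'
  have h2 : (I * w).re = - w.im := by simp
  rw [h2, norm_mul, norm_I, one_mul] at h1
  have h3 : -(1/2) ≤ Real.cos (arg (I * w)) := by
    rw [h1, le_div_iff₀ hwn]; linarith
  by_contra h
  push Not at h
  have h4 : Real.cos |arg (I * w)| < Real.cos (Real.pi - 1) := by
    refine Real.cos_lt_cos_of_nonneg_of_le_pi ?_ (abs_arg_le_pi _) h
    linarith [Real.pi_gt_three]
  rw [Real.cos_abs, Real.cos_pi_sub] at h4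
  have h5 : Real.cos (Real.pi / 3) ≤ Real.cos 1 := by
    refine Real.cos_le_cos_of_nonneg_of_le_pi (by norm_num) ?_ ?_
    · linarith [Real.pi_pos]
    · linarith [Real.pi_gt_three]
  rw [Real.cos_pi_div_three] at h5
  linarith

lemma slit_of_reg {w : ℂ} (hw : w ≠ 0) (hr : w.im ≤ ‖w‖ / 2) : I * w ∈ slitPlane := by
  rw [mem_slitPlane_iff_arg]
  refine ⟨fun h => ?_, mul_ne_zero I_ne_zero hw⟩
  have := arg_bound hw hr
  rw [h, abs_of_pos Real.pi_pos] at this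
  linarith

lemma differentiableAt_ch {N : ℕ} {X w : ℂ} (hw : w ≠ 0) (hr : w.im ≤ ‖w‖ / 2) :
    DifferentiableAt ℂ (ch N X) w := by
  unfold ch
  have : DifferentiableAt ℂ (fun w => log (I * w)) w :=
    (differentiableAt_id.const_mul I).clog (slit_of_reg hw hr)
  exact (this.const_mul _).cexp.const_mul _

/-- chart map semiconjugacy -/
lemma ch_tm {Φ : ℂ → ℂ → ℂ} {N : ℕ} (hN : N ≠ 0) {X c w : ℂ} (hX : X ≠ 0) (hw : w ≠ 0)
    (hr : w.im ≤ ‖w‖ / 2) (hu : N * (3 / 2 * ‖Φ c (ch N X w) / ch N X w - 1‖) < 1)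
    (hu2 : ‖Φ c (ch N X w) / ch N X w - 1‖ ≤ 1 / 2) :
    ch N X (tm Φ N X c w) = Φ c (ch N X w) := by
  set x := ch N X w with hx
  have hx0 : x ≠ 0 := ch_ne hX
  set u := Φ c x / x - 1 with hu'
  have hq : Φ c x / x = 1 + u := by rw [hu']; ring
  have hN' : (N:ℂ) ≠ 0 := by exact_mod_cast hN
  have hlog := norm_log_one_add_half_le_self hu2
  have hw' : I * w ≠ 0 := mul_ne_zero I_ne_zero hw
  have h1u : 1 + u ≠ 0 := by
    intro h
    have : u = -1 := by linear_combination h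
    rw [this] at hu2; norm_num at hu2
  have e1 : I * tm Φ N X c w = exp (log (I * w) + -(N:ℂ) * log (1 + u)) := by
    unfold tm
    rw [← hx, hq, exp_add, exp_log hw']; ring
  have him : |(-(N:ℂ) * log (1 + u)).im| < 1 := by
    refine (abs_im_le_norm _).trans_lt ?_
    rw [norm_mul, norm_neg, Complex.norm_natCast]
    refine lt_of_le_of_lt ?_ hu
    gcongr
  have ha := arg_bound hw hr
  have e2 : log (I * tm Φ N X c w) = log (I * w) + -(N:ℂ) * log (1 + u) := by
    rw [e1]
    rw [abs_lt] at him
    rw [abs_le] at ha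
    apply log_exp
    · rw [add_im, log_im]; linarith
    · rw [add_im, log_im]; linarith
  unfold ch
  rw [e2]
  have : -(1 / (N:ℂ)) * (log (I * w) + -(N:ℂ) * log (1 + u)) =
      -(1 / (N:ℂ)) * log (I * w) + log (1 + u) := by field_simp; ring
  rw [this, exp_add, exp_log h1u, ← hq, ← mul_assoc]
  rw [show X * exp (-(1 / (N:ℂ)) * log (I * w)) = x from rfl]
  field_simp

lemma differentiableAt_tm {Φ : ℂ → ℂ → ℂ} {N : ℕ} {X c w : ℂ} (hX : X ≠ 0) (hw : w ≠ 0)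
    (hr : w.im ≤ ‖w‖ / 2) (hu2 : ‖Φ c (ch N X w) / ch N X w - 1‖ ≤ 1 / 2)
    (hΦ : DifferentiableAt ℂ (Φ c) (ch N X w)) :
    DifferentiableAt ℂ (tm Φ N X c) w := by
  have h1 := differentiableAt_ch (N := N) (X := X) hw hr
  have h2 : DifferentiableAt ℂ (fun w => Φ c (ch N X w) / ch N X w) w :=
    (DifferentiableAt.comp w hΦ h1).div h1 (ch_ne hX)
  have h3 : Φ c (ch N X w) / ch N X w ∈ slitPlane := by
    left
    have := (abs_re_le_norm (Φ c (ch N X w) / ch N X w - 1)).trans hu2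
    rw [abs_le] at this
    simp only [sub_re, one_re] at this
    linarith
  unfold tm
  exact differentiableAt_id.mul (((h2.clog h3).const_mul _).cexp)

lemma inv_pow_taylor (N : ℕ) : ∃ K > 0, ∀ v : ℂ, ‖v‖ < 1 / 2 →
    ‖((1 + v) ^ N)⁻¹ - 1 + N * v‖ ≤ K * ‖v‖ ^ 2 := by
  have hne : ∀ v ∈ ball (0:ℂ) (1/2), 1 / 2 ≤ ‖1 + v‖ := by
    intro v hv
    have hv' : ‖v‖ < 1 / 2 := by simpa using hv
    have : ‖(1:ℂ)‖ ≤ ‖1 + v‖ + ‖v‖ := by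
      have := norm_sub_le (1 + v) v; simpa using this
    rw [norm_one] at this; linarith
  have hne' : ∀ v ∈ ball (0:ℂ) (1/2), (1 + v) ^ N ≠ 0 := fun v hv => by
    refine pow_ne_zero _ (norm_pos_iff.1 (by linarith [hne v hv]))
  have hd : DifferentiableOn ℂ (fun v : ℂ => ((1 + v) ^ N)⁻¹) (ball 0 (1/2)) := by
    intro v hv
    exact ((((differentiableAt_id.const_add 1).pow N)).inv (hne' v hv)).differentiableWithinAt
  have hb : ∀ v ∈ ball (0:ℂ) (1/2), ‖((1 + v) ^ N)⁻¹ - ((1 + (0:ℂ)) ^ N)⁻¹‖ ≤ 2 ^ N + 1 := by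
    intro v hv
    refine (norm_sub_le _ _).trans ?_
    have : ‖((1 + v) ^ N)⁻¹‖ ≤ 2 ^ N := by
      rw [norm_inv, norm_pow, ← inv_pow]
      have h1 := hne v hv
      have : ‖1 + v‖⁻¹ ≤ 2 := by
        rw [inv_le_comm₀ (by linarith) (by norm_num)]; linarith
      gcongr
    simpa using this
  have hder : deriv (fun v : ℂ => ((1 + v) ^ N)⁻¹) 0 = -N := by
    have h1 : HasDerivAt (fun v : ℂ => (1 + v) ^ N) (N * (1 + 0) ^ (N - 1) * 1) 0 :=
      ((hasDerivAt_id (0:ℂ)).const_add 1).pow N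
    have h2 := h1.fun_inv (by simp)
    rw [h2.deriv]; simp
  refine ⟨8 * (2 ^ N + 1), by positivity, fun v hv => ?_⟩
  have := taylor_one hd hb (x := v) (by simpa using hv)
  rw [hder] at this
  simp only [add_zero, one_pow, inv_one, sub_zero] at this
  have e : ((1 + v) ^ N)⁻¹ - 1 + N * v = ((1 + v) ^ N)⁻¹ - 1 - -(N:ℂ) * v := by ring
  rw [e]
  refine this.trans (le_of_eq ?_)
  ring

set_option maxHeartbeats 1000000 in
lemma NF.step {Φ : ℂ → ℂ → ℂ} {Lam : ℂ → ℂ} {c0 A : ℂ} {N : ℕ} (h : NF Φ Lam c0 A N) (hN : N ≠ 0)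
    (hL : ContinuousAt Lam c0) (hL1 : Lam c0 = 1) {X B : ℂ} (hX : X ^ N = I * B) (hB : B ≠ 0)
    {M : ℝ} (hM : 0 ≤ M) {δ : ℝ} (hδ : 0 < δ) :
    ∃ E > 0, ∃ r > 0, ∀ c ∈ ball c0 r, ∀ w : ℂ, E ≤ ‖w‖ → w.im ≤ ‖w‖ / 2 → ‖c - c0‖ * ‖w‖ ≤ M →
      ch N X (tm Φ N X c w) = Φ c (ch N X w) ∧
      ‖tm Φ N X c w - (w / Lam c ^ N - N * A * B)‖ ≤ δ ∧
      ‖Φ c (ch N X w) / ch N X w - 1‖ ≤ 1 / 2 := by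
  obtain ⟨C, hC, r, hr, hest⟩ := h
  obtain ⟨K, hK, hKb⟩ := inv_pow_taylor N
  have hX0 : X ≠ 0 := by
    rintro rfl
    rw [zero_pow hN] at hX
    exact mul_ne_zero I_ne_zero hB hX.symm
  have hN' : 0 < N := Nat.pos_of_ne_zero hN
  have hNr : (1:ℝ) ≤ N := by exact_mod_cast hN'
  set b := ‖B‖ with hb
  set V := 2 * (‖A‖ + 2 * C) with hV
  set V2 := 2 * (‖A‖ * b + C * (b + M)) with hV2
  have hb0 : 0 < b := norm_pos_iff.2 hB
  have hV0 : 0 < V := by positivity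
  have hV20 : 0 < V2 := by positivity
  set D := 2 * K * V2 * V + 4 * N * C * (b + M) + 1 with hD
  have hD0 : 0 < D := by positivity
  set τ0 := min (min r 1) (min (1 / (8 * N * V)) (δ / (2 * D))) with hτ0
  have hτ00 : 0 < τ0 := by positivity
  obtain ⟨E, hE, hEb⟩ := ch_small hN X hτ00
  have hev : ∀ᶠ c in 𝓝 c0, ‖Lam c - 1‖ < 1 / (8 * N) ∧ 1 / 2 ≤ ‖Lam c‖ ∧ ‖(Lam c ^ N)⁻¹‖ ≤ 2 ∧
      ‖((Lam c) ^ (N + 1))⁻¹‖ ≤ 2 ∧ N * ‖A‖ * b * ‖((Lam c) ^ (N + 1))⁻¹ - 1‖ < δ / 2 := by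
    have t1 : Tendsto Lam (𝓝 c0) (𝓝 1) := by simpa [hL1] using hL.tendsto
    have t2 : Tendsto (fun c => ‖Lam c - 1‖) (𝓝 c0) (𝓝 0) := by
      simpa using (t1.sub_const 1).norm
    have t3 : Tendsto (fun c => ‖Lam c‖) (𝓝 c0) (𝓝 1) := by simpa using t1.norm
    have t4 : ∀ k : ℕ, Tendsto (fun c => (Lam c ^ k)⁻¹) (𝓝 c0) (𝓝 1) := fun k => by
      simpa using (t1.pow k).inv₀ (by simp)
    have t5 : ∀ k : ℕ, Tendsto (fun c => ‖(Lam c ^ k)⁻¹‖) (𝓝 c0) (𝓝 1) := fun k => by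
      simpa using (t4 k).norm
    have t6 : Tendsto (fun c => N * ‖A‖ * b * ‖((Lam c) ^ (N + 1))⁻¹ - 1‖) (𝓝 c0) (𝓝 0) := by
      simpa using ((t4 (N + 1)).sub_const 1).norm.const_mul (N * ‖A‖ * b)
    filter_upwards [t2.eventually_lt_const (show (0:ℝ) < 1 / (8 * N) by positivity),
      t3.eventually_const_le (show (1:ℝ)/2 < 1 by norm_num),
      (t5 N).eventually_le_const (show (1:ℝ) < 2 by norm_num),
      (t5 (N+1)).eventually_le_const (show (1:ℝ) < 2 by norm_num),
      t6.eventually_lt_const (show (0:ℝ) < δ / 2 by positivity)] with c a1 a2 a3 a4 a5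
    exact ⟨a1, a2, a3, a4, a5⟩
  obtain ⟨r1, hr1, hr1b⟩ := Metric.eventually_nhds_iff_ball.1 hev
  refine ⟨E, hE, min (min r 1) r1, by positivity, fun c hc w hw hreg hcw => ?_⟩
  obtain ⟨l1, l2, l3, l4, l5⟩ := hr1b c (ball_subset_ball (min_le_right _ _) hc)
  have hcr : c ∈ ball c0 r := ball_subset_ball ((min_le_left _ _).trans (min_le_left _ _)) hc
  have hw0 : 0 < ‖w‖ := hE.trans_le hw
  have hwne : w ≠ 0 := norm_pos_iff.1 hw0
  set x := ch N X w with hx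
  have hx0 : x ≠ 0 := ch_ne hX0
  have hxτ : ‖x‖ < τ0 := hEb w hw
  set t := ‖x‖ with ht
  set d := ‖c - c0‖ with hd
  have ht0 : 0 < t := norm_pos_iff.2 hx0
  have hd0 : 0 ≤ d := norm_nonneg _
  have hd1 : d ≤ 1 := by
    have : d < min (min r 1) r1 := by simpa [dist_eq_norm] using hc
    exact this.le.trans ((min_le_left _ _).trans (min_le_right _ _))
  have ht1 : t ≤ 1 := hxτ.le.trans ((min_le_left _ _).trans (min_le_right _ _))
  have htV : V * t ≤ 1 / (8 * N) := by
    have : t ≤ 1 / (8 * N * V) := hxτ.le.trans ((min_le_right _ _).trans (min_le_left _ _))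
    rw [le_div_iff₀ (by positivity)] at this ⊢
    linarith
  have htD : D * t ≤ δ / 2 := by
    have : t ≤ δ / (2 * D) := hxτ.le.trans ((min_le_right _ _).trans (min_le_right _ _))
    rw [le_div_iff₀ (by positivity)] at this
    linarith
  have hxr : x ∈ ball (0:ℂ) r := by
    simpa using hxτ.trans_le ((min_le_left _ _).trans (min_le_left _ _))
  have hEs := hest c hcr x hxr
  have hxN : x ^ N * w = B := by
    rw [hx, ch_pow hN X hwne, hX]
    have := I_ne_zero
    field_simp
  have htN : t ^ N * ‖w‖ = b := by rw [ht, ← norm_pow, ← norm_mul, hxN]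
  have hL0 : Lam c ≠ 0 := norm_pos_iff.1 (by linarith)
  set e := Φ c x - Lam c * x - A * x ^ (N + 1) with he
  set v := (A * x ^ N + e / x) / Lam c with hv
  have hPhi : Φ c x / x = Lam c * (1 + v) := by
    rw [hv, he]; field_simp; ring
  have hex : ‖e / x‖ ≤ C * (t ^ (N + 1) + d * t) := by
    rw [norm_div, div_le_iff₀ ht0]
    refine hEs.trans (le_of_eq ?_)
    ring
  have hLi : ‖(Lam c)⁻¹‖ ≤ 2 := by
    rw [norm_inv, inv_le_comm₀ (by linarith) (by norm_num)]; linarith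
  have hvn : ‖v‖ ≤ 2 * (‖A‖ * t ^ N + C * (t ^ (N + 1) + d * t)) := by
    rw [hv, div_eq_mul_inv, norm_mul, mul_comm]
    have : ‖A * x ^ N + e / x‖ ≤ ‖A‖ * t ^ N + C * (t ^ (N + 1) + d * t) := by
      refine (norm_add_le _ _).trans (add_le_add ?_ hex)
      rw [norm_mul, norm_pow]
    gcongr
  have htN1 : t ^ N ≤ t := by
    calc t ^ N ≤ t ^ 1 := pow_le_pow_of_le_one ht0.le ht1 hN'
      _ = t := pow_one t
  have htN2 : t ^ (N + 1) ≤ t := by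
    calc t ^ (N + 1) ≤ t ^ 1 := pow_le_pow_of_le_one ht0.le ht1 (by omega)
      _ = t := pow_one t
  have hvV : ‖v‖ ≤ V * t := by
    refine hvn.trans ?_
    have a1 : d * t ≤ t := by nlinarith
    rw [hV]
    nlinarith [mul_le_mul_of_nonneg_left htN1 (norm_nonneg A), mul_le_mul_of_nonneg_left htN2 hC.le,
      mul_le_mul_of_nonneg_left a1 hC.le]
  have h8N : 1 / (8 * (N:ℝ)) ≤ 1 / 8 := by
    apply one_div_le_one_div_of_le (by norm_num); linarith
  have hv8 : ‖v‖ ≤ 1 / (8 * N) := hvV.trans htV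
  have hwe : ‖w‖ * (t ^ (N + 1) + d * t) ≤ (b + M) * t := by
    have : ‖w‖ * (t ^ (N + 1) + d * t) = (t ^ N * ‖w‖) * t + (d * ‖w‖) * t := by ring
    rw [this, htN]
    nlinarith
  have hwv : ‖w‖ * ‖v‖ ≤ V2 := by
    calc ‖w‖ * ‖v‖ ≤ ‖w‖ * (2 * (‖A‖ * t ^ N + C * (t ^ (N + 1) + d * t))) := by gcongr
      _ = 2 * (‖A‖ * (t ^ N * ‖w‖) + C * (‖w‖ * (t ^ (N + 1) + d * t))) := by ring
      _ ≤ 2 * (‖A‖ * b + C * ((b + M) * t)) := by rw [htN]; gcongr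
      _ ≤ V2 := by
        rw [hV2]
        have : (b + M) * t ≤ (b + M) := by nlinarith
        gcongr
  -- u
  have hu : ‖Φ c x / x - 1‖ ≤ 1 / (3 * N) := by
    have : Φ c x / x - 1 = (Lam c - 1) * (1 + v) + v := by rw [hPhi]; ring
    rw [this]
    have h1v : ‖1 + v‖ ≤ 9 / 8 := by
      refine (norm_add_le _ _).trans ?_
      rw [norm_one]; linarith
    have e5 : 1 / (3 * (N:ℝ)) = (1 / (8 * N)) * (8 / 3) := by field_simp
    calc ‖(Lam c - 1) * (1 + v) + v‖ ≤ ‖Lam c - 1‖ * ‖1 + v‖ + ‖v‖ := by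
          rw [← norm_mul]; exact norm_add_le _ _
      _ ≤ 1 / (8 * N) * (9 / 8) + 1 / (8 * N) := by gcongr
      _ ≤ 1 / (3 * N) := by
        rw [e5]
        have : 0 ≤ 1 / (8 * (N:ℝ)) := by positivity
        linarith
  have hu2 : ‖Φ c x / x - 1‖ ≤ 1 / 2 := by
    refine hu.trans ?_
    apply one_div_le_one_div_of_le (by norm_num); linarith
  refine ⟨ch_tm hN hX0 hwne hreg ?_ hu2, ?_, hu2⟩
  · calc (N:ℝ) * (3 / 2 * ‖Φ c x / x - 1‖) ≤ N * (3 / 2 * (1 / (3 * N))) := by gcongr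
      _ = 1 / 2 := by field_simp
      _ < 1 := by norm_num
  have h1v0 : 1 + v ≠ 0 := by
    intro h
    have : v = -1 := by linear_combination h
    rw [this, norm_neg, norm_one] at hv8; linarith
  have hT : tm Φ N X c w = w / Lam c ^ N * ((1 + v) ^ N)⁻¹ := by
    unfold tm
    rw [← hx, hPhi, neg_mul, exp_neg, exp_nat_mul, exp_log (mul_ne_zero hL0 h1v0), mul_pow]
    field_simp
  have hKv := hKb v (by linarith)
  have hsplit : tm Φ N X c w - (w / Lam c ^ N - N * A * B) =
      w / Lam c ^ N * (((1 + v) ^ N)⁻¹ - 1 + N * v) - N * (Lam c ^ (N + 1))⁻¹ * (w * (e / x)) -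
      N * A * B * ((Lam c ^ (N + 1))⁻¹ - 1) := by
    rw [hT, ← hxN, hv]
    field_simp
    ring
  rw [hsplit]
  have q1 : ‖w / Lam c ^ N * (((1 + v) ^ N)⁻¹ - 1 + N * v)‖ ≤ 2 * K * V2 * V * t := by
    rw [div_eq_mul_inv, norm_mul, norm_mul]
    calc ‖w‖ * ‖(Lam c ^ N)⁻¹‖ * ‖((1 + v) ^ N)⁻¹ - 1 + N * v‖ ≤ ‖w‖ * 2 * (K * ‖v‖ ^ 2) := by gcongr
      _ = 2 * K * (‖w‖ * ‖v‖) * ‖v‖ := by ring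
      _ ≤ 2 * K * V2 * (V * t) := by gcongr
      _ = _ := by ring
  have q2 : ‖(N:ℂ) * (Lam c ^ (N + 1))⁻¹ * (w * (e / x))‖ ≤ 4 * N * C * (b + M) * t := by
    rw [norm_mul, norm_mul, norm_mul, Complex.norm_natCast]
    calc (N:ℝ) * ‖(Lam c ^ (N + 1))⁻¹‖ * (‖w‖ * ‖e / x‖) ≤
        N * 2 * (‖w‖ * (C * (t ^ (N + 1) + d * t))) := by gcongr
      _ = N * 2 * C * (‖w‖ * (t ^ (N + 1) + d * t)) := by ring
      _ ≤ N * 2 * C * ((b + M) * t) := by gcongr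
      _ ≤ _ := by
        have : 0 ≤ N * C * ((b + M) * t) := by positivity
        linarith
  have q3 : ‖(N:ℂ) * A * B * ((Lam c ^ (N + 1))⁻¹ - 1)‖ ≤ δ / 2 := by
    rw [norm_mul, norm_mul, norm_mul, Complex.norm_natCast]
    exact l5.le
  refine (norm_sub_le _ _).trans ?_
  refine (add_le_add_left (norm_sub_le _ _) _).trans ?_
  rw [hD, add_mul, add_mul] at htD
  linarith

end Shi

open Complex Set Filter Topology Metric
open scoped ContDiff

namespace Shi

/-- chart dynamics package -/
structure ST (Φ : ℂ → ℂ → ℂ) (Lam : ℂ → ℂ) (c0 : ℂ) (N : ℕ) (X : ℂ) (ε : ℝ) : Prop where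
  hN : N ≠ 0
  hX : X ≠ 0
  hL1 : Lam c0 = 1
  hε : ε = 1 ∨ ε = -1
  step : ∀ M : ℝ, 0 ≤ M → ∀ δ : ℝ, 0 < δ → ∃ E > 0, ∃ r > 0, ∀ c ∈ ball c0 r, ∀ w : ℂ,
    E ≤ ‖w‖ → w.im ≤ ‖w‖ / 2 → ‖c - c0‖ * ‖w‖ ≤ M →
      ch N X (tm Φ N X c w) = Φ c (ch N X w) ∧
      ‖tm Φ N X c w - (w / Lam c ^ N + ε)‖ ≤ δ ∧
      ‖Φ c (ch N X w) / ch N X w - 1‖ ≤ 1 / 2 ∧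
      DifferentiableAt ℂ (fun u : ℂ × ℂ => Φ u.1 u.2) (c, ch N X w)

lemma ST.mk' {Φ : ℂ → ℂ → ℂ} {Lam : ℂ → ℂ} {c0 A : ℂ} {N : ℕ} {ε : ℝ} (h : NF Φ Lam c0 A N) (hN : N ≠ 0)
    (hL : ContinuousAt Lam c0) (hL1 : Lam c0 = 1) {X B : ℂ} (hX : X ^ N = I * B) (hB : B ≠ 0)
    (hε : ε = 1 ∨ ε = -1) (hAB : -(N * A * B) = ε)
    (hd : ∀ᶠ u in 𝓝 (c0, (0:ℂ)), DifferentiableAt ℂ (fun u : ℂ × ℂ => Φ u.1 u.2) u) :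
    ST Φ Lam c0 N X ε := by
  have hX0 : X ≠ 0 := by
    rintro rfl
    rw [zero_pow hN] at hX
    exact mul_ne_zero I_ne_zero hB hX.symm
  refine ⟨hN, hX0, hL1, hε, fun M hM δ hδ => ?_⟩
  obtain ⟨E, hE, r, hr, hst⟩ := h.step hN hL hL1 hX hB hM hδ
  obtain ⟨r1, hr1, hd1⟩ := Metric.eventually_nhds_iff_ball.1 hd
  obtain ⟨E1, hE1, hc1⟩ := ch_small hN X hr1
  refine ⟨max E E1, by positivity, min r r1, by positivity, fun c hc w hw hw2 hw3 => ?_⟩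
  obtain ⟨a1, a2, a3⟩ := hst c (ball_subset_ball (min_le_left _ _) hc) w ((le_max_left _ _).trans hw) hw2 hw3
  refine ⟨a1, ?_, a3, ?_⟩
  · rw [← hAB]
    simpa [sub_eq_add_neg] using a2
  · apply hd1
    rw [← ball_prod_same]
    refine ⟨ball_subset_ball (min_le_right _ _) hc, ?_⟩
    simpa using hc1 w ((le_max_right _ _).trans hw)

lemma Par.setup {c0 : ℂ} {p q : ℕ} {φ : ℂ → ℂ} (h : Par c0 p q φ) :
    ∃ N ≥ q, N ≠ 0 ∧ ∃ X Ψ, ST (loc φ (p * q)) (fun c => dq c (p * q) (φ c)) c0 N X 1 ∧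
      ST Ψ (fun c => (dq c (p * q) (φ c))⁻¹) c0 N X (-1) ∧
      ∃ r > 0, ∀ c ∈ ball c0 r, ∀ x ∈ ball (0:ℂ) r, loc φ (p * q) c (Ψ c x) = x := by
  obtain ⟨N, hNq, A, hA, hNF⟩ := h.nf
  have hN : N ≠ 0 := by have := h.hq; omega
  have hN' : (N:ℂ) ≠ 0 := by exact_mod_cast hN
  set B : ℂ := -1 / (N * A) with hB
  have hB0 : B ≠ 0 := by
    rw [hB]; exact div_ne_zero (by norm_num) (mul_ne_zero hN' hA)
  obtain ⟨X, hX⟩ : ∃ X : ℂ, X ^ N = I * B := IsAlgClosed.exists_pow_nat_eq _ (Nat.pos_of_ne_zero hN)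
  have hAn := analyticAt_dq_comp h.an (p * q)
  have hdloc : ∀ x, ContDiffAt ℂ ω (fun u : ℂ × ℂ => loc φ (p * q) u.1 u.2) (c0, x) :=
    fun x => contDiffAt_loc h.an (p * q) x
  have hloc0 : loc φ (p * q) c0 0 = 0 := by
    simp only [loc, add_zero]
    rw [fix_mul h.fix0 q, sub_self]
  have hder := hasDerivAt_loc φ (p * q) c0
  rw [h.dq0] at hder
  obtain ⟨Ψ, hΨ, hΨ0, hinv⟩ := local_inv (hdloc 0) hloc0 hder
  have hNF2 := hNF.inv hN hAn.differentiableAt h.dq0 hΨ.continuousAt hΨ0 hinv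
  refine ⟨N, hNq, hN, X, Ψ, ?_, ?_, ?_⟩
  · refine ST.mk' hNF hN hAn.continuousAt h.dq0 hX hB0 (Or.inl rfl) ?_ ?_
    · rw [hB]; push_cast; field_simp
    · filter_upwards [(hdloc 0).eventually (by simp)] with u hu
      exact hu.differentiableAt (by simp)
  · refine ST.mk' hNF2 hN (hAn.continuousAt.inv₀ (by rw [h.dq0]; simp)) (by simp [h.dq0]) hX hB0 (Or.inr rfl) ?_ ?_
    · rw [hB]; push_cast; field_simp
    · filter_upwards [hΨ.eventually (by simp)] with u hu
      exact hu.differentiableAt (by simp)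
  · obtain ⟨r, hr, hb⟩ := Metric.eventually_nhds_iff_ball.1 hinv
    refine ⟨r, hr, fun c hc x hx => hb (c, x) ?_⟩
    rw [← ball_prod_same]
    exact ⟨hc, hx⟩

/-- composite differentiability -/
lemma differentiableAt_tm_comp {Φ : ℂ → ℂ → ℂ} {N : ℕ} {X s : ℂ} {c w : ℂ → ℂ} (hX : X ≠ 0) (hw : w s ≠ 0)
    (hr : (w s).im ≤ ‖w s‖ / 2) (hu2 : ‖Φ (c s) (ch N X (w s)) / ch N X (w s) - 1‖ ≤ 1 / 2)
    (hΦ : DifferentiableAt ℂ (fun u : ℂ × ℂ => Φ u.1 u.2) (c s, ch N X (w s)))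
    (hc : DifferentiableAt ℂ c s) (hwd : DifferentiableAt ℂ w s) :
    DifferentiableAt ℂ (fun s => tm Φ N X (c s) (w s)) s := by
  have h1 : DifferentiableAt ℂ (fun s => ch N X (w s)) s :=
    (differentiableAt_ch (N := N) (X := X) hw hr).comp s hwd
  have h0 : DifferentiableAt ℂ (fun s => Φ (c s) (ch N X (w s))) s :=
    DifferentiableAt.comp (g := fun u : ℂ × ℂ => Φ u.1 u.2) (f := fun s => (c s, ch N X (w s))) s hΦ (hc.prodMk h1)
  have h2 : DifferentiableAt ℂ (fun s => Φ (c s) (ch N X (w s)) / ch N X (w s)) s :=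
    h0.div h1 (ch_ne hX)
  have h3 : Φ (c s) (ch N X (w s)) / ch N X (w s) ∈ slitPlane := by
    left
    have := (abs_re_le_norm (Φ (c s) (ch N X (w s)) / ch N X (w s) - 1)).trans hu2
    rw [abs_le] at this
    simp only [sub_re, one_re] at this
    linarith
  unfold tm
  exact hwd.mul (((h2.clog h3).const_mul _).cexp)

/-- sectors -/
def Sec (ε E : ℝ) (w : ℂ) : Prop := E + 4 * |w.im| < ε * w.re

lemma Sec.mono {ε E E' : ℝ} {w : ℂ} (h : Sec ε E w) (hE : E' ≤ E) : Sec ε E' w := by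
  unfold Sec at *; linarith

lemma Sec.norm {ε E : ℝ} {w : ℂ} (hε : ε = 1 ∨ ε = -1) (h : Sec ε E w) :
    E + 4 * |w.im| < ‖w‖ := by
  unfold Sec at h
  have := abs_re_le_norm w
  have h2 := le_abs_self w.re
  have h3 := neg_abs_le w.re
  rcases hε with rfl | rfl <;> linarith

lemma Sec.reg {ε E : ℝ} {w : ℂ} (hε : ε = 1 ∨ ε = -1) (h : Sec ε E w) (hE : 0 ≤ E) :
    w.im ≤ ‖w‖ / 2 := by
  have := h.norm hε
  have h2 := le_abs_self w.im
  linarith [abs_nonneg w.im]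

lemma Sec.move {ε E a b k : ℝ} {w w' : ℂ} (hε : ε = 1 ∨ ε = -1) (h : Sec ε E w)
    (hk : ‖w' - (w + ε * k)‖ ≤ a) (hb : b ≤ k - 5 * a) : Sec ε (E + b) w' := by
  unfold Sec at *
  have h1 := (abs_re_le_norm (w' - (w + ε * k))).trans hk
  have h2 := (abs_im_le_norm (w' - (w + ε * k))).trans hk
  simp only [sub_re, add_re, mul_re, ofReal_re, ofReal_im, sub_im, add_im, mul_im] at h1 h2
  have h3 : |w'.im| ≤ |w.im| + a := by
    have := abs_sub_abs_le_abs_sub w'.im w.im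
    have h2' : |w'.im - w.im| ≤ a := by simpa using h2
    linarith
  rw [abs_le] at h1
  rcases hε with rfl | rfl <;> linarith

/-- the dynamics in the sector at the parabolic parameter -/
lemma ST.sector {Φ : ℂ → ℂ → ℂ} {Lam : ℂ → ℂ} {c0 X : ℂ} {N : ℕ} {ε : ℝ} (h : ST Φ Lam c0 N X ε) {δ : ℝ}
    (hδ : 0 < δ) : ∃ E0 > 0, ∀ w, Sec ε E0 w →
      ch N X (tm Φ N X c0 w) = Φ c0 (ch N X w) ∧
      ‖tm Φ N X c0 w - (w + ε)‖ ≤ δ ∧ DifferentiableAt ℂ (tm Φ N X c0) w := by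
  obtain ⟨E, hE, r, hr, hst⟩ := h.step 0 le_rfl δ hδ
  refine ⟨E, hE, fun w hw => ?_⟩
  have hn := hw.norm h.hε
  have hn' : E ≤ ‖w‖ := by linarith [abs_nonneg w.im]
  obtain ⟨a1, a2, a3, a4⟩ := hst c0 (mem_ball_self hr) w hn' (hw.reg h.hε hE.le) (by simp)
  refine ⟨a1, by simpa [h.hL1] using a2, ?_⟩
  exact differentiableAt_tm_comp (c := fun _ => c0) (w := fun w => w) h.hX
    (norm_pos_iff.1 (hE.trans_le hn')) (hw.reg h.hε hE.le) a3 a4 (differentiableAt_const _) differentiableAt_id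

lemma sec_iter {T : ℂ → ℂ} {ε E0 : ℝ} (hε : ε = 1 ∨ ε = -1)
    (hT : ∀ w, Sec ε E0 w → ‖T w - (w + ε)‖ ≤ 1 / 100) {E : ℝ} (hE : E0 ≤ E) {w : ℂ} (hw : Sec ε E w) (k : ℕ) :
    Sec ε (E + 9 / 10 * k) (T^[k] w) ∧ ‖T^[k] w - (w + ε * (k:ℝ))‖ ≤ k / 100 := by
  induction k with
  | zero => simpa using hw
  | succ k ih =>
    obtain ⟨i1, i2⟩ := ih
    have h1 := hT _ (i1.mono (by have : (0:ℝ) ≤ k := k.cast_nonneg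
                                 linarith))
    rw [← Function.iterate_succ_apply' T k w] at h1
    constructor
    · have := i1.move (w' := T^[k+1] w) (k := 1) (b := 9/10) hε (by simpa using h1) (by norm_num)
      refine this.mono ?_
      push_cast; linarith
    · have e : T^[k+1] w - (w + ε * ((k+1:ℕ):ℝ)) = (T^[k+1] w - (T^[k] w + ε)) + (T^[k] w - (w + ε * (k:ℝ))) := by
        push_cast; ring
      rw [e]
      refine (norm_add_le _ _).trans ((add_le_add h1 i2).trans (le_of_eq ?_))
      push_cast; ring

lemma differentiableOn_iter_sec {T : ℂ → ℂ} {ε E0 : ℝ} (hε : ε = 1 ∨ ε = -1)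
    (hT : ∀ w, Sec ε E0 w → ‖T w - (w + ε)‖ ≤ 1 / 100) (hd : ∀ w, Sec ε E0 w → DifferentiableAt ℂ T w)
    {w : ℂ} (hw : Sec ε E0 w) (k : ℕ) : DifferentiableAt ℂ (T^[k]) w := by
  induction k with
  | zero => exact differentiableAt_id
  | succ k ih =>
    rw [Function.iterate_succ']
    refine DifferentiableAt.comp w (hd _ ?_) ih
    exact (sec_iter hε hT le_rfl hw k).1.mono (by have : (0:ℝ) ≤ k := k.cast_nonneg
                                                  linarith)

/-- linear spreading contradiction -/
lemma eq_of_big_balls {g : ℕ → ℂ → ℂ} {a b : ℂ} {K ρ : ℝ} (hρ : 0 < ρ) {w w' : ℕ → ℂ}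
    (hg : ∀ n, DifferentiableOn ℂ (g n) (ball (w n) (ρ * (n + 24)))) (hK : ∀ n, ∀ z ∈ ball (w n) (ρ * (n + 24)), ‖g n z‖ ≤ K)
    (ha : ∀ n, g n (w n) = a) (hb : ∀ n, g n (w' n) = b) (hd : ∀ n, ‖w' n - w n‖ < ρ * 24) : a = b := by
  have key : ∀ n : ℕ, dist b a ≤ 48 * K * (1 / ((n:ℝ) + 24)) := by
    intro n
    have hmem : w' n ∈ ball (w n) (ρ * (n + 24)) := by
      rw [mem_ball, dist_eq_norm]
      have := hd n
      have : 0 ≤ ρ * n := by positivity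
      linarith
    have hmaps : MapsTo (g n) (ball (w n) (ρ * (n + 24))) (closedBall (g n (w n)) (2 * K)) := by
      intro z hz
      rw [mem_closedBall, dist_eq_norm]
      have h1 := hK n z hz
      have h2 := hK n (w n) (mem_ball_self (by positivity))
      linarith [norm_sub_le (g n z) (g n (w n))]
    have := Complex.dist_le_div_mul_dist_of_mapsTo_ball (hg n) hmaps hmem
    rw [ha, hb, dist_eq_norm (w' n)] at this
    refine this.trans ?_
    have hK0 : 0 ≤ K := (norm_nonneg _).trans (hK n _ hmem)
    calc 2 * K / (ρ * (n + 24)) * ‖w' n - w n‖ ≤ 2 * K / (ρ * (n + 24)) * (ρ * 24) := by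
          gcongr; exact (hd n).le
      _ = _ := by field_simp; ring
  have hlim : Tendsto (fun n : ℕ => 48 * K * (1 / ((n:ℝ) + 24))) atTop (𝓝 (48 * K * 0)) := by
    refine Tendsto.const_mul _ ?_
    refine Tendsto.div_atTop tendsto_const_nhds ?_
    exact tendsto_atTop_add_const_right _ _ tendsto_natCast_atTop_atTop
  rw [mul_zero] at hlim
  have := ge_of_tendsto' hlim key
  exact (dist_le_zero.1 this).symm

end Shi

open Complex Set Filter Topology Metric
open scoped ContDiff

namespace Shi

lemma iter_semi {F T ψ : ℂ → ℂ} {ε E0 : ℝ} (hε : ε = 1 ∨ ε = -1)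
    (hT : ∀ w, Sec ε E0 w → ‖T w - (w + ε)‖ ≤ 1 / 100)
    (hs : ∀ w, Sec ε E0 w → F (ψ w) = ψ (T w)) {w : ℂ} (hw : Sec ε E0 w) (k : ℕ) :
    F^[k] (ψ w) = ψ (T^[k] w) := by
  induction k with
  | zero => rfl
  | succ k ih =>
    rw [Function.iterate_succ_apply', ih, Function.iterate_succ_apply', hs]
    exact (sec_iter hε hT le_rfl hw k).1.mono (by have : (0:ℝ) ≤ k := k.cast_nonneg
                                                  linarith)

lemma ball_sec {ε E : ℝ} (hε : ε = 1 ∨ ε = -1) {n : ℕ} {w u : ℂ} (hw : Sec ε (E + 15 + 9 / 10 * n) w)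
    (hu : u ∈ ball w (1 / 8 * ((n:ℝ) + 24))) : Sec ε E u := by
  have hn : (0:ℝ) ≤ n := n.cast_nonneg
  rw [mem_ball, dist_eq_norm] at hu
  have := hw.move (w' := u) (k := 0) (b := -(5 * (1 / 8 * ((n:ℝ) + 24)))) hε (by simpa using hu.le) (by linarith)
  refine this.mono ?_
  linarith

set_option maxHeartbeats 1000000 in
lemma crit_enter {c0 : ℂ} {p q : ℕ} {φ : ℂ → ℂ} (h : Par c0 p q φ) {N : ℕ} {X : ℂ} {Lam : ℂ → ℂ}
    (hS : ST (loc φ (p * q)) Lam c0 N X 1) (E : ℝ) :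
    ∃ j0, ∃ w, Sec 1 E w ∧ xi c0 j0 = φ c0 + ch N X w := by
  obtain ⟨E0, hE0, hsec⟩ := hS.sector (show (0:ℝ) < 1 / 100 by norm_num)
  obtain ⟨E1, hE1, hch⟩ := ch_small hS.hN X (show (0:ℝ) < 1 by norm_num)
  set E' := max E (max E0 E1) with hE'
  have hEE : E ≤ E' := le_max_left _ _
  have hE0E : E0 ≤ E' := (le_max_left _ _).trans (le_max_right _ _)
  have hE1E : E1 ≤ E' := (le_max_right _ _).trans (le_max_right _ _)
  set L := p * q with hL
  set T := tm (loc φ L) N X c0 with hT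
  set ψ : ℂ → ℂ := fun w => φ c0 + ch N X w with hψ
  have hε : (1:ℝ) = 1 ∨ (1:ℝ) = -1 := Or.inl rfl
  by_contra hcon
  push Not at hcon
  have hno : ∀ j w, Sec 1 E' w → ψ w ≠ xi c0 j := fun j w hw => (hcon j w (hw.mono hEE)).symm
  have hTs : ∀ w, Sec 1 E' w → ‖T w - (w + (1:ℝ))‖ ≤ 1 / 100 := fun w hw => (hsec w (hw.mono hE0E)).2.1
  have hTd : ∀ w, Sec 1 E' w → DifferentiableAt ℂ T w := fun w hw => (hsec w (hw.mono hE0E)).2.2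
  have hsemi : ∀ w, Sec 1 E' w → (fq c0)^[L] (ψ w) = ψ (T w) := by
    intro w hw
    have := (hsec w (hw.mono hE0E)).1
    simp only [hψ, hT]
    rw [this, loc]; ring
  have hψd : ∀ w, Sec 1 E' w → DifferentiableAt ℂ ψ w := by
    intro w hw
    have h1 := hw.norm hε
    have h2 := abs_nonneg w.im
    refine (differentiableAt_ch ?_ (hw.reg hε (by linarith))).const_add _
    exact norm_pos_iff.1 (by linarith)
  set w0 : ℂ := ((E' + 20 : ℝ) : ℂ) with hw0
  have hw0s : Sec 1 (E' + 15) w0 := by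
    unfold Sec; rw [hw0, ofReal_im, ofReal_re]; simp; norm_num
  have hw0' : Sec 1 E' w0 := hw0s.mono (by linarith)
  have hball : ∀ n : ℕ, ∀ u ∈ ball (T^[n] w0) (1 / 8 * ((n:ℝ) + 24)), Sec 1 E' u := by
    intro n u hu
    exact ball_sec hε (sec_iter hε hTs (by linarith : E' ≤ E' + 15) hw0s n).1 hu
  have hiter : ∀ n : ℕ, ∀ w, Sec 1 E' w → (fq c0)^[L * n] (ψ w) = ψ (T^[n] w) := by
    intro n w hw
    rw [Function.iterate_mul]
    exact iter_semi hε hTs hsemi hw n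
  have hlift : ∀ n : ℕ, ∃ g : ℂ → ℂ, DifferentiableOn ℂ g (ball (T^[n] w0) (1 / 8 * ((n:ℝ) + 24))) ∧
      g (T^[n] w0) = ψ w0 ∧ ∀ s ∈ ball (T^[n] w0) (1 / 8 * ((n:ℝ) + 24)), (fq c0)^[L * n] (g s) = ψ s := by
    intro n
    refine lift_ball (L * n) ψ (ψ w0) (fun u hu => (hψd u (hball n u hu)).differentiableWithinAt) ?_ (hiter n w0 hw0')
    intro s hs j _ _
    exact hno j s (hball n s hs)
  choose g hgd hg0 hgi using hlift
  have hmem1 : T w0 ∈ ball w0 2 := by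
    have := hTs w0 hw0'
    rw [mem_ball, dist_eq_norm]
    have e : T w0 - w0 = (T w0 - (w0 + (1:ℝ))) + 1 := by push_cast; ring
    rw [e]
    refine (norm_add_le _ _).trans_lt ?_
    rw [norm_one]; linarith
  have hB2 : ∀ u ∈ ball w0 2, Sec 1 E' u := fun u hu => hball 0 u (by
    simp only [Function.iterate_zero, id_eq]; exact ball_subset_ball (by norm_num) hu)
  have hTn : ∀ n : ℕ, ∀ u ∈ ball w0 2, T^[n] u ∈ ball (T^[n] w0) (1 / 8 * ((n:ℝ) + 24)) := by
    intro n u hu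
    have a1 := (sec_iter hε hTs le_rfl hw0' n).2
    have a2 := (sec_iter hε hTs le_rfl (hB2 u hu) n).2
    rw [mem_ball, dist_eq_norm] at hu ⊢
    have e : T^[n] u - T^[n] w0 = (T^[n] u - (u + (1:ℝ) * (n:ℝ))) - (T^[n] w0 - (w0 + (1:ℝ) * (n:ℝ))) + (u - w0) := by
      ring
    rw [e]
    have hn : (0:ℝ) ≤ n := n.cast_nonneg
    calc _ ≤ ‖T^[n] u - (u + ((1:ℝ):ℂ) * ((n:ℝ):ℂ))‖ + ‖T^[n] w0 - (w0 + ((1:ℝ):ℂ) * ((n:ℝ):ℂ))‖ + ‖u - w0‖ :=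
          (norm_add_le _ _).trans (add_le_add_left (norm_sub_le _ _) _)
      _ < _ := by linarith
  have hkey : ∀ n, g n (T^[n + 1] w0) = ψ (T w0) := by
    intro n
    rw [Function.iterate_succ_apply]
    have hdiff1 : DifferentiableOn ℂ (fun u => g n (T^[n] u)) (ball w0 2) := by
      refine (hgd n).comp (t := ball (T^[n] w0) (1 / 8 * ((n:ℝ) + 24))) ?_ (hTn n)
      intro u hu
      exact (differentiableOn_iter_sec hε hTs hTd (hB2 u hu) n).differentiableWithinAt
    have hdiff2 : DifferentiableOn ℂ ψ (ball w0 2) := fun u hu => (hψd u (hB2 u hu)).differentiableWithinAt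
    have hdq : dq c0 (L * n) (ψ w0) ≠ 0 := by
      intro h0
      obtain ⟨i, hi, hi0⟩ := dq_eq_zero h0
      have e1 : (fq c0)^[L * n] (ψ w0) = xi c0 (L * n - i) := by
        have : L * n = (L * n - i) + i := by omega
        conv_lhs => rw [this]
        rw [Function.iterate_add_apply, hi0]; rfl
      rw [hiter n w0 hw0'] at e1
      exact hno _ _ (hball n _ (mem_ball_self (by positivity))) e1
    have hstrict : HasStrictDerivAt ((fq c0)^[L * n]) (dq c0 (L * n) (ψ w0)) (ψ w0) := by
      have h1 : ContDiff ℂ 1 ((fq c0)^[L * n]) := (differentiable_iter c0 (L * n)).contDiff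
      have := h1.contDiffAt.hasStrictDerivAt (x := ψ w0) (by norm_num)
      rwa [deriv_iter] at this
    have hli := hstrict.eventually_left_inverse hdq
    have hev : (fun u => g n (T^[n] u)) =ᶠ[𝓝 w0] ψ := by
      have hb2 : ball w0 2 ∈ 𝓝 w0 := ball_mem_nhds _ (by norm_num)
      have c1 : Tendsto (fun u => g n (T^[n] u)) (𝓝 w0) (𝓝 (ψ w0)) := by
        have := (hdiff1.differentiableAt hb2).continuousAt.tendsto
        rwa [hg0] at this
      have c2 : Tendsto ψ (𝓝 w0) (𝓝 (ψ w0)) := (hdiff2.differentiableAt hb2).continuousAt.tendsto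
      filter_upwards [c1.eventually hli, c2.eventually hli, hb2] with u h1 h2 h3
      rw [← h1, ← h2, hgi n _ (hTn n u h3), hiter n u (hB2 u h3)]
    have := (hdiff1.analyticOnNhd isOpen_ball).eqOn_of_preconnected_of_eventuallyEq
      (hdiff2.analyticOnNhd isOpen_ball) (convex_ball _ _).isPreconnected (mem_ball_self (by norm_num)) hev
    exact this hmem1
  have hfin := eq_of_big_balls (g := g) (a := ψ w0) (b := ψ (T w0)) (K := ‖φ c0‖ + 4) (ρ := 1 / 8)
    (w := fun n => T^[n] w0) (w' := fun n => T^[n+1] w0) (by norm_num) hgd ?_ hg0 hkey ?_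
  · simp only [hψ, add_right_inj] at hfin
    have hn0 := hw0'.norm hε
    have hn1 := (sec_iter hε hTs le_rfl hw0' 1).1.norm hε
    simp only [Function.iterate_one] at hn1
    have := ch_inj hS.hN hS.hX (norm_pos_iff.1 (by linarith [abs_nonneg w0.im]))
      (norm_pos_iff.1 (by push_cast at hn1; linarith [abs_nonneg (T w0).im])) hfin
    have h2 := hTs w0 hw0'
    rw [← this] at h2
    norm_num at h2
  · intro n z hz
    refine norm_le_of_iter h.hc.le (by linarith [norm_nonneg (φ c0)]) (L * n) ?_
    rw [hgi n z hz]
    have hs := (hball n z hz).norm hε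
    have := hch z (by linarith [abs_nonneg z.im])
    refine (norm_add_le _ _).trans ?_
    linarith
  · intro n
    have a1 := hTs _ (hball n _ (mem_ball_self (by positivity)))
    rw [← Function.iterate_succ_apply' T n w0] at a1
    have e : T^[n+1] w0 - T^[n] w0 = (T^[n.succ] w0 - (T^[n] w0 + (1:ℝ))) + 1 := by push_cast; ring
    simp only [e]
    refine (norm_add_le _ _).trans_lt ?_
    rw [norm_one]; linarith

set_option maxHeartbeats 1000000 in
lemma repel_hit {c0 : ℂ} {p q : ℕ} {φ : ℂ → ℂ} {N : ℕ} {X : ℂ} {Lam : ℂ → ℂ}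
    {Ψ : ℂ → ℂ → ℂ} (hS : ST Ψ Lam c0 N X (-1)) {r : ℝ} (hr : 0 < r)
    (hinv : ∀ x ∈ ball (0:ℂ) r, loc φ (p * q) c0 (Ψ c0 x) = x) {β : ℂ} (hβ : fq c0 β = β) (hβ0 : β ≠ 0) (E : ℝ) :
    ∃ M, ∃ w, Sec (-1) E w ∧ (fq c0)^[M] (φ c0 + ch N X w) = β := by
  obtain ⟨E0, hE0, hsec⟩ := hS.sector (show (0:ℝ) < 1 / 100 by norm_num)
  obtain ⟨E1, hE1, hch⟩ := ch_small hS.hN X hr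
  set E' := max E (max E0 E1) with hE'
  have hEE : E ≤ E' := le_max_left _ _
  have hE0E : E0 ≤ E' := (le_max_left _ _).trans (le_max_right _ _)
  have hE1E : E1 ≤ E' := (le_max_right _ _).trans (le_max_right _ _)
  set L := p * q with hL
  set T := tm Ψ N X c0 with hT
  set ψ : ℂ → ℂ := fun w => φ c0 + ch N X w with hψ
  have hε : (-1:ℝ) = 1 ∨ (-1:ℝ) = -1 := Or.inr rfl
  by_contra hcon
  push Not at hcon
  have hno : ∀ j w, Sec (-1) E' w → (fq c0)^[j] (ψ w) ≠ β := fun j w hw => hcon j w (hw.mono hEE)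
  have hno2 : ∀ j w, Sec (-1) E' w → (fq c0)^[j] (ψ w) ≠ -β := fun j w hw he => by
    apply hno (j + 1) w hw
    rw [Function.iterate_succ_apply', he]
    unfold fq at hβ ⊢
    linear_combination hβ
  have hTs : ∀ w, Sec (-1) E' w → ‖T w - (w + ((-1:ℝ):ℂ))‖ ≤ 1 / 100 := fun w hw => (hsec w (hw.mono hE0E)).2.1
  have hsemi : ∀ w, Sec (-1) E' w → (fq c0)^[L] (ψ (T w)) = ψ w := by
    intro w hw
    have h1 := (hsec w (hw.mono hE0E)).1
    have h2 := hw.norm hε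
    have h3 := hinv (ch N X w) (by simpa using hch w (by linarith [abs_nonneg w.im]))
    simp only [hψ, hT]
    rw [h1]
    rw [loc] at h3
    linear_combination h3
  have hψd : ∀ w, Sec (-1) E' w → DifferentiableAt ℂ ψ w := by
    intro w hw
    have h1 := hw.norm hε
    have h2 := abs_nonneg w.im
    refine (differentiableAt_ch ?_ (hw.reg hε (by linarith))).const_add _
    exact norm_pos_iff.1 (by linarith)
  set w0 : ℂ := ((-(E' + 20) : ℝ) : ℂ) with hw0
  have hw0s : Sec (-1) (E' + 15) w0 := by
    unfold Sec; rw [hw0, ofReal_im, ofReal_re]; simp; linarith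
  have hw0' : Sec (-1) E' w0 := hw0s.mono (by linarith)
  have hball : ∀ n : ℕ, ∀ u ∈ ball (T^[n] w0) (1 / 8 * ((n:ℝ) + 24)), Sec (-1) E' u := by
    intro n u hu
    exact ball_sec hε (sec_iter hε hTs (by linarith : E' ≤ E' + 15) hw0s n).1 hu
  have hiter : ∀ n : ℕ, ∀ w, Sec (-1) E' w → (fq c0)^[L * n] (ψ (T^[n] w)) = ψ w := by
    intro n
    induction n with
    | zero => intro w hw; simp
    | succ n ih =>
      intro w hw
      rw [Nat.mul_succ, add_comm, Function.iterate_add_apply, Function.iterate_succ_apply, ih (T w), hsemi w hw]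
      have := (sec_iter hε hTs le_rfl hw 1).1
      simp only [Function.iterate_one] at this
      exact this.mono (by norm_num)
  have hTw0 : Sec (-1) E' (T w0) := by
    have := (sec_iter hε hTs le_rfl hw0' 1).1
    simp only [Function.iterate_one] at this
    exact this.mono (by norm_num)
  obtain ⟨C, hC, hsch⟩ := schottky ((ψ w0 + β) / (2 * β))
  have h2β : (2 * β) ≠ 0 := mul_ne_zero two_ne_zero hβ0
  have hfin := eq_of_big_balls (g := fun n u => ((fq c0)^[L * n] (ψ u) + β) / (2 * β))
    (a := (ψ w0 + β) / (2 * β)) (b := (ψ (T w0) + β) / (2 * β)) (K := C) (ρ := 1 / 16)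
    (w := fun n => T^[n] w0) (w' := fun n => T^[n+1] w0) (by norm_num) ?_ ?_ ?_ ?_ ?_
  · have e : ψ w0 = ψ (T w0) := by
      field_simp at hfin
      linear_combination hfin
    simp only [hψ, add_right_inj] at e
    have hn0 := hw0'.norm hε
    have hn1 := hTw0.norm hε
    have := ch_inj hS.hN hS.hX (norm_pos_iff.1 (by linarith [abs_nonneg w0.im]))
      (norm_pos_iff.1 (by linarith [abs_nonneg (T w0).im])) e
    have h2 := hTs w0 hw0'
    rw [← this] at h2
    norm_num at h2
  · intro n u hu
    have hu' := hball n u (ball_subset_ball (by have : (0:ℝ) ≤ n := n.cast_nonneg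
                                                linarith) hu)
    refine DifferentiableAt.differentiableWithinAt ?_
    refine DifferentiableAt.div_const (DifferentiableAt.add_const _ ?_) _
    exact ((differentiable_iter c0 (L * n)) _).comp u (hψd u hu')
  · intro n z hz
    refine hsch (1 / 8 * ((n:ℝ) + 24)) (T^[n] w0) (fun u => ((fq c0)^[L * n] (ψ u) + β) / (2 * β)) (by positivity) ?_ ?_ ?_ z ?_
    · intro u hu
      refine DifferentiableAt.differentiableWithinAt ?_
      refine DifferentiableAt.div_const (DifferentiableAt.add_const _ ?_) _
      exact ((differentiable_iter c0 (L * n)) _).comp u (hψd u (hball n u hu))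
    · intro u hu
      constructor
      · refine div_ne_zero (fun h => hno2 _ u (hball n u hu) (eq_neg_of_add_eq_zero_left h)) h2β
      · intro h
        rw [div_eq_one_iff_eq h2β] at h
        exact hno _ u (hball n u hu) (by linear_combination h)
    · simp only [hiter n w0 hw0']
    · convert hz using 2; ring
  · intro n
    simp only [hiter n w0 hw0']
  · intro n
    simp only [Function.iterate_succ_apply]
    rw [hiter n (T w0) hTw0]
  · intro n
    have a1 := hTs _ (hball n _ (mem_ball_self (by positivity)))
    rw [← Function.iterate_succ_apply' T n w0] at a1
    have e : T^[n+1] w0 - T^[n] w0 = (T^[n.succ] w0 - (T^[n] w0 + ((-1:ℝ):ℂ))) - 1 := by push_cast; ring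
    simp only [e]
    refine (norm_sub_le _ _).trans_lt ?_
    rw [norm_one]; linarith

end Shi

open Complex Set Filter Topology Metric
open scoped ContDiff

namespace Shi

lemma sin_sum (α : ℂ) (k : ℕ) :
    (∑ j ∈ Finset.range k, exp (-(2 * α * I)) ^ j) * sin α * exp (k * α * I) = exp (α * I) * sin (k * α) := by
  induction k with
  | zero => simp
  | succ k ih =>
    rw [Finset.sum_range_succ, add_mul, add_mul]
    have e1 : exp (((k+1:ℕ):ℂ) * α * I) = exp (k * α * I) * exp (α * I) := by
      rw [← exp_add]; congr 1; push_cast; ring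
    have e2 : exp (-(2 * α * I)) ^ k = (exp (k * α * I))⁻¹ * (exp (k * α * I))⁻¹ := by
      rw [← exp_nat_mul, ← exp_neg, ← exp_add]; congr 1; ring
    rw [e1, e2, ← mul_assoc, ih]
    have h0 := exp_ne_zero (k * α * I)
    have h1 := exp_ne_zero (α * I)
    have e3 : sin (((k+1:ℕ):ℂ) * α) = sin (k * α) * cos α + cos (k * α) * sin α := by
      rw [← sin_add]; congr 1; push_cast; ring
    have e4 : (exp (k * α * I))⁻¹ = cos (k * α) - sin (k * α) * I := by
      rw [← exp_neg, show -(k * α * I) = (-(k * α)) * I by ring, exp_mul_I, cos_neg, sin_neg]; ring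
    have e5 : exp (α * I) = cos α + sin α * I := exp_mul_I α
    calc exp (α * I) * sin (k * α) * exp (α * I) + (exp (k * α * I))⁻¹ * (exp (k * α * I))⁻¹ * sin α * (exp (k * α * I) * exp (α * I))
        = exp (α * I) * (sin (k * α) * exp (α * I) + (exp (k * α * I))⁻¹ * sin α) := by field_simp
      _ = _ := by rw [e3, e4]; rw [e5]; ring

lemma gate_im {ε θ x y : ℝ} (hε : ε = 1 ∨ ε = -1) {k : ℕ} (hθ : 0 ≤ θ) (hk : θ * k ≤ Real.pi) (hx : 0 ≤ x) :
    ε * (exp (-(ε * θ * I)) ^ k * (x + y * I) + ∑ j ∈ Finset.range k, exp (-(ε * θ * I)) ^ j).im ≤ |y| := by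
  have hp : ∀ j : ℕ, exp (-(ε * θ * I)) ^ j = (Real.cos (θ * j) : ℂ) - (ε * Real.sin (θ * j) : ℝ) * I := by
    intro j
    rw [← exp_nat_mul]
    have : (j:ℂ) * (-(ε * θ * I)) = ((-(ε * (θ * j)) : ℝ) : ℂ) * I := by push_cast; ring
    rw [this, exp_mul_I, ← ofReal_cos, ← ofReal_sin, Real.cos_neg, Real.sin_neg]
    rcases hε with rfl | rfl
    · simp; ring
    · simp
  have hs : ∀ j : ℕ, j ≤ k → 0 ≤ Real.sin (θ * j) := by
    intro j hj
    apply Real.sin_nonneg_of_nonneg_of_le_pi (by positivity)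
    refine le_trans ?_ hk
    have : (j:ℝ) ≤ k := by exact_mod_cast hj
    gcongr
  have e : ε * (exp (-(ε * θ * I)) ^ k * (x + y * I) + ∑ j ∈ Finset.range k, exp (-(ε * θ * I)) ^ j).im =
      ε * y * Real.cos (θ * k) - x * Real.sin (θ * k) - ∑ j ∈ Finset.range k, Real.sin (θ * j) := by
    rw [add_im, im_sum]
    simp only [hp]
    simp only [mul_im, sub_re, ofReal_re, mul_re, I_re, ofReal_im, I_im, add_im, sub_im, add_re]
    have hεε : ε * ε = 1 := by rcases hε with rfl | rfl <;> norm_num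
    have e2 : ∀ j : ℕ, (0:ℝ) - (ε * Real.sin (θ * j) * 1 + 0 * 0) = -ε * Real.sin (θ * j) := fun j => by ring
    simp only [e2, ← Finset.mul_sum]
    linear_combination (-(x * Real.sin (θ * k)) - ∑ j ∈ Finset.range k, Real.sin (θ * j)) * hεε
  rw [e]
  have h1 : 0 ≤ ∑ j ∈ Finset.range k, Real.sin (θ * j) :=
    Finset.sum_nonneg fun j hj => hs j (Finset.mem_range.1 hj).le
  have h2 := mul_nonneg hx (hs k le_rfl)
  have h3 : ε * y * Real.cos (θ * k) ≤ |y| := by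
    refine (le_abs_self _).trans ?_
    rw [abs_mul, abs_mul]
    have : |ε| = 1 := by rcases hε with rfl | rfl <;> norm_num
    rw [this, one_mul]
    exact mul_le_of_le_one_right (abs_nonneg _) (Real.abs_cos_le_one _)
  linarith

lemma gate_norm {ε x y : ℝ} (hε : ε = 1 ∨ ε = -1) {n k : ℕ} (hn : 8 ≤ n) (hk : 2 * k ≤ n) (hx : 0 ≤ x)
    (hxn : x ≤ n / 100) :
    x - |y| + 59 / 100 * k - 1 / 25 ≤
      ‖exp (-(ε * (2 * Real.pi / n : ℝ) * I)) ^ k * (x + y * I) +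
        ∑ j ∈ Finset.range k, exp (-(ε * (2 * Real.pi / n : ℝ) * I)) ^ j‖ := by
  set a : ℝ := Real.pi / n with ha
  have hpi := Real.pi_pos
  have hpi2 : Real.pi < 3.15 := Real.pi_lt_d2
  have hn' : (8:ℝ) ≤ n := by exact_mod_cast hn
  have hk' : 2 * (k:ℝ) ≤ n := by exact_mod_cast hk
  have ha0 : 0 < a := by positivity
  have hna : a * n = Real.pi := by rw [ha]; field_simp
  have hkn : a * k ≤ Real.pi / 2 := by nlinarith
  set α : ℂ := ((ε * a : ℝ) : ℂ) with hα
  have e0 : -(ε * (2 * Real.pi / n : ℝ) * I) = -(2 * α * I) := by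
    rw [hα, ha]; push_cast; ring
  rw [e0]
  set S := ∑ j ∈ Finset.range k, exp (-(2 * α * I)) ^ j with hS
  have hsum := sin_sum α k
  rw [← hS] at hsum
  have hsa : 0 < Real.sin a := Real.sin_pos_of_pos_of_lt_pi ha0 (by nlinarith)
  set Q : ℝ := Real.sin (a * k) / Real.sin a with hQ
  have hsin : sin α = ((ε * Real.sin a : ℝ) : ℂ) := by
    rw [hα, ← ofReal_sin]
    rcases hε with rfl | rfl <;> simp
  have hsink : sin (k * α) = ((ε * Real.sin (a * k) : ℝ) : ℂ) := by
    have : (k:ℂ) * α = ((ε * (a * k) : ℝ) : ℂ) := by rw [hα]; push_cast; ring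
    rw [this, ← ofReal_sin]
    rcases hε with rfl | rfl <;> simp
  have hε0 : (ε:ℂ) ≠ 0 := by rcases hε with rfl | rfl <;> norm_num
  have hsaC : (Real.sin a : ℂ) ≠ 0 := by exact_mod_cast hsa.ne'
  have hS2 : S * exp (k * α * I) * exp (-(α * I)) = (Q : ℂ) := by
    have e1 : S * exp (k * α * I) = exp (α * I) * (Q:ℂ) := by
      rw [hsin, hsink] at hsum
      rw [hQ]
      push_cast at hsum hsaC ⊢
      rw [mul_div_assoc', eq_div_iff hsaC]
      have := mul_right_cancel₀ hε0 (b := ε) (a := S * exp (k * α * I) * Complex.sin a) (c := exp (α * I) * Complex.sin (a * k))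
        (by linear_combination hsum)
      exact this
    rw [e1, exp_neg]
    have := exp_ne_zero (α * I)
    field_simp
  have hP : (exp (-(2 * α * I)) ^ k * (x + y * I) + S) * (exp (k * α * I) * exp (-(α * I))) =
      exp (((-(ε * (a * (k + 1))) : ℝ) : ℂ) * I) * (x + y * I) + (Q:ℂ) := by
    rw [add_mul, ← mul_assoc S, hS2]
    congr 1
    have : exp (-(2 * α * I)) ^ k * exp (k * α * I) * exp (-(α * I)) = exp (((-(ε * (a * (k + 1))) : ℝ) : ℂ) * I) := by
      rw [← exp_nat_mul, ← exp_add, ← exp_add]; congr 1; rw [hα]; push_cast; ring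
    rw [← this]; ring
  have hn1 : ‖exp (k * α * I) * exp (-(α * I))‖ = 1 := by
    have h1 : exp (k * α * I) * exp (-(α * I)) = exp (((k * (ε * a) - ε * a : ℝ) : ℂ) * I) := by
      rw [← exp_add]; congr 1; rw [hα]; push_cast; ring
    rw [h1, norm_exp_ofReal_mul_I]
  have hnn := congrArg norm hP
  rw [norm_mul, hn1, mul_one] at hnn
  rw [hnn]
  refine le_trans ?_ (re_le_norm _)
  set g : ℝ := a * (k + 1) with hg
  have hre : (exp (((-(ε * g) : ℝ) : ℂ) * I) * (x + y * I) + (Q:ℂ)).re = Real.cos g * x + ε * Real.sin g * y + Q := by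
    rw [exp_mul_I, ← ofReal_cos, ← ofReal_sin]
    rcases hε with rfl | rfl <;> simp [Complex.cos_ofReal_re, Complex.sin_ofReal_re] <;> ring
  rw [hre]
  have hg0 : 0 ≤ g := by positivity
  have hg2 : g ≤ 2 := by
    have : g = a * k + a := by rw [hg]; ring
    have : a ≤ 3.15 / 8 := by rw [ha]; gcongr
    linarith
  have hgn : g * n ≤ 3.15 * (k + 1) := by
    have : g * n = Real.pi * (k + 1) := by rw [hg, ← hna]; ring
    rw [this]; gcongr
  have hcos : 1 - g ≤ Real.cos g := by
    have := Real.one_sub_sq_div_two_le_cos (x := g)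
    nlinarith
  have h1 : x - (k + 1) / 25 ≤ Real.cos g * x := by
    have h2 : (1 - g) * x ≤ Real.cos g * x := by gcongr
    have h3 : g * x ≤ g * (n / 100) := by gcongr
    have hk0 : (0:ℝ) ≤ k := k.cast_nonneg
    nlinarith
  have h2 : -|y| ≤ ε * Real.sin g * y := by
    have : |ε * Real.sin g * y| ≤ |y| := by
      rw [abs_mul, abs_mul]
      have : |ε| = 1 := by rcases hε with rfl | rfl <;> norm_num
      rw [this, one_mul]
      exact mul_le_of_le_one_left (abs_nonneg _) (Real.abs_sin_le_one _)
    linarith [neg_abs_le (ε * Real.sin g * y)]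
  have h3 : 63 / 100 * (k:ℝ) ≤ Q := by
    rw [hQ, le_div_iff₀ hsa]
    have j1 := Real.mul_le_sin (x := a * k) (by positivity) hkn
    have j2 := Real.sin_le ha0.le
    have hk0 : (0:ℝ) ≤ k := k.cast_nonneg
    have j3 : 63 / 100 ≤ 2 / Real.pi := by
      rw [le_div_iff₀ hpi]; linarith
    calc 63 / 100 * (k:ℝ) * Real.sin a ≤ 63 / 100 * k * a := by gcongr
      _ = 63 / 100 * (a * k) := by ring
      _ ≤ 2 / Real.pi * (a * k) := by gcongr
      _ ≤ _ := j1
  linarith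

end Shi

open Complex Set Filter Topology Metric
open scoped ContDiff

namespace Shi

/-- the gate multiplier -/
noncomputable def gm (ε : ℝ) (n : ℕ) (s : ℂ) : ℂ := exp (-(ε * ((2 * Real.pi * I + s) / n)))

lemma gm_sub {ε : ℝ} (hε : ε = 1 ∨ ε = -1) {n : ℕ} (hn : n ≠ 0) {s : ℂ} (hs : ‖s‖ ≤ 1) :
    ‖gm ε n 0‖ = 1 ∧ ‖gm ε n s - gm ε n 0‖ ≤ 2 * ‖s‖ / n := by
  have hε1 : ‖(ε:ℂ)‖ = 1 := by rcases hε with rfl | rfl <;> simp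
  have h0 : ‖gm ε n 0‖ = 1 := by
    unfold gm
    have : -((ε:ℂ) * ((2 * Real.pi * I + 0) / n)) = ((-(ε * (2 * Real.pi / n)) : ℝ) : ℂ) * I := by
      push_cast; ring
    rw [this, norm_exp_ofReal_mul_I]
  refine ⟨h0, ?_⟩
  have e : gm ε n s - gm ε n 0 = gm ε n 0 * (exp (-(ε * (s / n))) - 1) := by
    rw [mul_sub, mul_one]
    unfold gm
    rw [← exp_add]; congr 2; ring
  have hn1 : (1:ℝ) ≤ n := by exact_mod_cast Nat.one_le_iff_ne_zero.2 hn
  have hu : ‖-((ε:ℂ) * (s / n))‖ = ‖s‖ / n := by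
    rw [norm_neg, norm_mul, hε1, one_mul, norm_div, Complex.norm_natCast]
  rw [e, norm_mul, h0, one_mul]
  have := Complex.norm_exp_sub_one_le (x := -((ε:ℂ) * (s / n))) (by
    rw [hu, div_le_one (by linarith)]; linarith)
  rw [hu] at this
  rw [mul_div_assoc]; exact this

lemma geo_rec (ρ v0 : ℂ) (k : ℕ) : ρ ^ (k + 1) * v0 + ∑ j ∈ Finset.range (k + 1), ρ ^ j =
    ρ * (ρ ^ k * v0 + ∑ j ∈ Finset.range k, ρ ^ j) + 1 := by
  rw [geom_sum_succ, pow_succ]; ring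

lemma geo_norm {ρ : ℂ} (hρ : ‖ρ‖ = 1) (v0 : ℂ) (k : ℕ) :
    ‖ρ ^ k * v0 + ∑ j ∈ Finset.range k, ρ ^ j‖ ≤ ‖v0‖ + k := by
  refine (norm_add_le _ _).trans ?_
  rw [norm_mul, norm_pow, hρ, one_pow, one_mul]
  gcongr
  refine (norm_sum_le _ _).trans ?_
  simp [hρ]

set_option maxHeartbeats 1000000 in
lemma gate_est {ε : ℝ} (hε : ε = 1 ∨ ε = -1) {n m : ℕ} (hnm : n = 2 * m) (hn : 8 ≤ n) {s : ℂ}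
    (hs : ‖s‖ ≤ 1 / 1000) {δ : ℝ} (hδ0 : 0 ≤ δ) (hδ : δ ≤ 1 / 1000) {E : ℝ} (hE : 0 ≤ E) {v : ℕ → ℂ}
    (hv0 : Sec 1 (E + 1) (v 0)) (hvn : ‖v 0‖ ≤ n / 100)
    (hstep : ∀ k < m, E ≤ ‖v k‖ → ε * (v k).im ≤ ‖v k‖ / 2 → ‖v k‖ ≤ n →
      ‖v (k + 1) - (gm ε n s * v k + 1)‖ ≤ δ) :
    ∀ k ≤ m, (E + k / 2 ≤ ‖v k‖ ∧ ε * (v k).im ≤ ‖v k‖ / 2 ∧ ‖v k‖ ≤ n) ∧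
      ‖v k - (gm ε n s ^ k * v 0 + ∑ j ∈ Finset.range k, gm ε n s ^ j)‖ ≤ 2 * k * δ := by
  obtain ⟨hρ0, hρ⟩ := gm_sub hε (show n ≠ 0 by omega) (hs.trans (by norm_num))
  set ρ := gm ε n s with hρd
  set ρ0 := gm ε n 0 with hρdef
  have hnr : (8:ℝ) ≤ n := by exact_mod_cast hn
  have hρ1 : ‖ρ‖ ≤ 1 + 2 * ‖s‖ / n := by
    have := norm_sub_norm_le ρ ρ0
    linarith
  have hs0 := norm_nonneg s
  set x := (v 0).re with hx
  set y := (v 0).im with hy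
  have hv0' : (v 0) = x + y * I := (re_add_im _).symm
  unfold Sec at hv0
  rw [one_mul, ← hx, ← hy] at hv0
  have hy0 := abs_nonneg y
  have hxn : x ≤ n / 100 := (re_le_norm _).trans hvn
  have hgood : ∀ k ≤ m, ‖v k - (ρ0 ^ k * v 0 + ∑ j ∈ Finset.range k, ρ0 ^ j)‖ ≤ k / 100 →
      E + k / 2 ≤ ‖v k‖ ∧ ε * (v k).im ≤ ‖v k‖ / 2 ∧ ‖v k‖ ≤ n := by
    intro k hk hd
    set P := ρ0 ^ k * v 0 + ∑ j ∈ Finset.range k, ρ0 ^ j with hP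
    have hρe : ρ0 = exp (-(ε * (2 * Real.pi / n : ℝ) * I)) := by
      rw [hρdef, gm]; congr 1; push_cast; ring
    have g1 := gate_norm (y := y) hε hn (show 2 * k ≤ n by omega) (by linarith : 0 ≤ x) hxn
    have g2 := gate_im (y := y) (θ := 2 * Real.pi / n) (k := k) hε (by positivity) (by
      have : 2 * (k:ℝ) ≤ n := by exact_mod_cast (show 2 * k ≤ n by omega)
      rw [div_mul_eq_mul_div, div_le_iff₀ (by linarith)]
      nlinarith [Real.pi_pos]) (by linarith : 0 ≤ x)
    rw [← hρe, ← hv0', ← hP] at g1 g2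
    have g3 := geo_norm hρ0 (v 0) k
    rw [← hP] at g3
    have hk0 : (0:ℝ) ≤ k := k.cast_nonneg
    have hkn : 2 * (k:ℝ) ≤ n := by exact_mod_cast (show 2 * k ≤ n by omega)
    have n1 : ‖P‖ - ‖v k‖ ≤ k / 100 := by
      refine le_trans (norm_sub_norm_le _ _) ?_
      rwa [norm_sub_rev]
    have n2 : ‖v k‖ - ‖P‖ ≤ k / 100 := (norm_sub_norm_le _ _).trans hd
    have n3 : ε * (v k).im ≤ ε * P.im + k / 100 := by
      have := (abs_im_le_norm (v k - P)).trans hd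
      rw [sub_im, abs_le] at this
      rcases hε with rfl | rfl <;> linarith
    refine ⟨by linarith, by linarith, by linarith⟩
  have hmain : ∀ k ≤ m, ‖v k - (ρ0 ^ k * v 0 + ∑ j ∈ Finset.range k, ρ0 ^ j)‖ ≤ k / 100 ∧
      ‖v k - (ρ ^ k * v 0 + ∑ j ∈ Finset.range k, ρ ^ j)‖ ≤ 2 * k * δ := by
    intro k
    induction k with
    | zero => intro _; simp
    | succ k ih =>
      intro hk
      obtain ⟨i1, i2⟩ := ih (by omega)
      obtain ⟨a1, a2, a3⟩ := hgood k (by omega) i1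
      have hk0 : (0:ℝ) ≤ k := k.cast_nonneg
      have hst := hstep k (by omega) (by linarith) a2 a3
      have hkn : 2 * (k:ℝ) ≤ n := by exact_mod_cast (show 2 * k ≤ n by omega)
      have hsn : 2 * ‖s‖ / n * n = 2 * ‖s‖ := by field_simp
      have hsn0 : 0 ≤ 2 * ‖s‖ / n := by positivity
      rw [geo_rec, geo_rec]
      set P := ρ0 ^ k * v 0 + ∑ j ∈ Finset.range k, ρ0 ^ j with hP
      set Q := ρ ^ k * v 0 + ∑ j ∈ Finset.range k, ρ ^ j with hQ
      have g3 := geo_norm hρ0 (v 0) k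
      rw [← hP] at g3
      constructor
      · have e : v (k + 1) - (ρ0 * P + 1) = (v (k + 1) - (ρ * v k + 1)) + ρ * (v k - P) + (ρ - ρ0) * P := by ring
        rw [e]
        calc _ ≤ ‖v (k + 1) - (ρ * v k + 1)‖ + ‖ρ‖ * ‖v k - P‖ + ‖ρ - ρ0‖ * ‖P‖ := by
              rw [← norm_mul, ← norm_mul]; exact norm_add₃_le
          _ ≤ δ + (1 + 2 * ‖s‖ / n) * (k / 100) + 2 * ‖s‖ / n * n := by
              gcongr
              linarith
          _ = δ + k / 100 + (2 * ‖s‖ / n) * (k / 100) + 2 * ‖s‖ := by rw [hsn]; ring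
          _ ≤ δ + k / 100 + (2 * ‖s‖ / n) * n + 2 * ‖s‖ := by gcongr; linarith
          _ ≤ _ := by rw [hsn]; push_cast; linarith
      · have e : v (k + 1) - (ρ * Q + 1) = (v (k + 1) - (ρ * v k + 1)) + ρ * (v k - Q) := by ring
        rw [e]
        calc _ ≤ ‖v (k + 1) - (ρ * v k + 1)‖ + ‖ρ‖ * ‖v k - Q‖ := by
              rw [← norm_mul]; exact norm_add_le _ _
          _ ≤ δ + (1 + 2 * ‖s‖ / n) * (2 * k * δ) := by gcongr
          _ = δ + 2 * k * δ + (2 * ‖s‖ / n) * ((2 * k) * δ) := by ring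
          _ ≤ δ + 2 * k * δ + (2 * ‖s‖ / n) * (n * δ) := by gcongr
          _ = δ + 2 * k * δ + (2 * ‖s‖ / n * n) * δ := by ring
          _ ≤ δ + 2 * k * δ + 1 * δ := by rw [hsn]; gcongr; linarith
          _ = _ := by push_cast; ring
  exact fun k hk => ⟨hgood k hk (hmain k hk).1, (hmain k hk).2⟩

/-- meeting of the two half-turns -/
lemma gate_meet {n m : ℕ} (hnm : n = 2 * m) (hn : 1000 ≤ n) {s : ℂ} (hs : ‖s‖ ≤ 1 / 1000) {v w : ℕ → ℂ} {d K : ℝ}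
    (hd : 0 ≤ d)
    (hv : ‖v m - (gm 1 n s ^ m * v 0 + ∑ j ∈ Finset.range m, gm 1 n s ^ j)‖ ≤ d)
    (hw : ‖w m - (gm (-1) n s ^ m * w 0 + ∑ j ∈ Finset.range m, gm (-1) n s ^ j)‖ ≤ d)
    (hv0 : ‖v 0‖ ≤ K) (hw0 : ‖w 0‖ ≤ K) :
    ‖(1 - gm 1 n s) * (v m + w m) + s‖ ≤ ‖s‖ ^ 2 + 20 / n * (2 * d + 4 * K + 4) := by
  set σ := (2 * Real.pi * I + s) / n with hσ
  have hnr : (1000:ℝ) ≤ n := by exact_mod_cast hn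
  have hn0 : (n:ℂ) ≠ 0 := by
    have : n ≠ 0 := by omega
    exact_mod_cast this
  have hm0 : (m:ℂ) ≠ 0 := by
    have : m ≠ 0 := by omega
    exact_mod_cast this
  have eρ : gm 1 n s = exp (-σ) := by rw [gm, ← hσ]; simp
  have eρ' : gm (-1) n s = exp σ := by rw [gm, ← hσ]; simp
  have hmσ : (m:ℂ) * σ = Real.pi * I + s / 2 := by
    rw [hσ, hnm]; push_cast; field_simp
  have hpm : gm 1 n s ^ m = -exp (-(s / 2)) := by
    rw [eρ, ← exp_nat_mul, mul_neg, hmσ, neg_add, exp_add, exp_neg, exp_pi_mul_I]; norm_num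
  have hpm' : gm (-1) n s ^ m = -exp (s / 2) := by
    rw [eρ', ← exp_nat_mul, hmσ, exp_add, exp_pi_mul_I]; ring
  have hσn : ‖σ‖ ≤ 10 / n := by
    rw [hσ, norm_div, Complex.norm_natCast]
    gcongr
    refine (norm_add_le _ _).trans ?_
    have : ‖2 * (Real.pi:ℂ) * I‖ = 2 * Real.pi := by
      simp [abs_of_pos Real.pi_pos]
    rw [this]
    have := Real.pi_lt_d2
    norm_num at this ⊢
    linarith
  have h10 : 10 / (n:ℝ) ≤ 1 / 100 := by
    rw [div_le_div_iff₀ (by linarith) (by norm_num)]; linarith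
  have h1ρ : ‖1 - gm 1 n s‖ ≤ 20 / n := by
    rw [eρ, norm_sub_rev]
    have := Complex.norm_exp_sub_one_le (x := -σ) (by rw [norm_neg]; linarith)
    rw [norm_neg] at this
    refine this.trans ?_
    have e : 20 / (n:ℝ) = 2 * (10 / n) := by ring
    rw [e]; gcongr
  set ρ := gm 1 n s with hρ
  have hinv : gm (-1) n s = ρ⁻¹ := by rw [eρ', eρ, exp_neg, inv_inv]
  have hρ0 : ρ ≠ 0 := by rw [eρ]; exact exp_ne_zero _
  have g1 : (1 - ρ) * ∑ j ∈ Finset.range m, ρ ^ j = 1 + exp (-(s / 2)) := by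
    rw [mul_neg_geom_sum, hpm]; ring
  have g2 : (1 - ρ) * ∑ j ∈ Finset.range m, gm (-1) n s ^ j = -(ρ * (1 + exp (s / 2))) := by
    have := mul_neg_geom_sum (gm (-1) n s) m
    rw [hpm', hinv] at this
    rw [hinv]
    have e : (1 - ρ) = -ρ * (1 - ρ⁻¹) := by field_simp; ring
    rw [e, mul_assoc, this]; ring
  have hes : ‖exp (s / 2)‖ ≤ 2 ∧ ‖exp (-(s / 2))‖ ≤ 2 ∧ ‖exp (-(s/2)) - exp (s/2) + s‖ ≤ ‖s‖ ^ 2 := by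
    have hs2 : ‖s / 2‖ = ‖s‖ / 2 := by rw [norm_div]; norm_num
    have b1 := Complex.norm_exp_sub_one_sub_id_le (x := s / 2) (by rw [hs2]; linarith [norm_nonneg s])
    have b2 := Complex.norm_exp_sub_one_sub_id_le (x := -(s / 2)) (by rw [norm_neg, hs2]; linarith [norm_nonneg s])
    rw [norm_neg] at b2
    rw [hs2] at b1 b2
    have c1 := Complex.norm_exp_sub_one_le (x := s / 2) (by rw [hs2]; linarith [norm_nonneg s])
    have c2 := Complex.norm_exp_sub_one_le (x := -(s / 2)) (by rw [norm_neg, hs2]; linarith [norm_nonneg s])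
    rw [norm_neg] at c2
    rw [hs2] at c1 c2
    have d1 := norm_sub_norm_le (exp (s/2)) 1
    have d2 := norm_sub_norm_le (exp (-(s/2))) 1
    rw [norm_one] at d1 d2
    refine ⟨by linarith, by linarith, ?_⟩
    have e : exp (-(s/2)) - exp (s/2) + s = (exp (-(s/2)) - 1 - -(s/2)) - (exp (s/2) - 1 - s/2) := by ring
    rw [e]
    refine (norm_sub_le _ _).trans ?_
    nlinarith [sq_nonneg ‖s‖]
  obtain ⟨he1, he2, he3⟩ := hes
  set dv := v m - (ρ ^ m * v 0 + ∑ j ∈ Finset.range m, ρ ^ j) with hdv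
  set dw := w m - (gm (-1) n s ^ m * w 0 + ∑ j ∈ Finset.range m, gm (-1) n s ^ j) with hdw
  have key : (1 - ρ) * (v m + w m) + s = (exp (-(s/2)) - exp (s/2) + s) +
      (1 - ρ) * (dv + dw - exp (-(s/2)) * v 0 - exp (s/2) * w 0 + (1 + exp (s/2))) := by
    have e1 : v m = dv + (-exp (-(s/2)) * v 0 + ∑ j ∈ Finset.range m, ρ ^ j) := by rw [hdv, hpm]; ring
    have e2 : w m = dw + (-exp (s/2) * w 0 + ∑ j ∈ Finset.range m, gm (-1) n s ^ j) := by rw [hdw, hpm']; ring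
    rw [e1, e2]
    linear_combination g1 + g2
  rw [key]
  refine (norm_add_le _ _).trans (add_le_add he3 ?_)
  rw [norm_mul]
  have hK : 0 ≤ K := (norm_nonneg _).trans hv0
  refine mul_le_mul h1ρ ?_ (norm_nonneg _) (by positivity)
  have t1 : ‖exp (-(s/2)) * v 0‖ ≤ 2 * K := by rw [norm_mul]; gcongr
  have t2 : ‖exp (s/2) * w 0‖ ≤ 2 * K := by rw [norm_mul]; gcongr
  have t3 : ‖1 + exp (s/2)‖ ≤ 3 := by
    refine (norm_add_le _ _).trans ?_
    rw [norm_one]; linarith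
  calc _ ≤ ‖dv‖ + ‖dw‖ + ‖exp (-(s/2)) * v 0‖ + ‖exp (s/2) * w 0‖ + ‖1 + exp (s/2)‖ := by
        refine (norm_add_le _ _).trans (add_le_add_left ?_ _)
        refine (norm_sub_le _ _).trans (add_le_add_left ?_ _)
        refine (norm_sub_le _ _).trans (add_le_add_left ?_ _)
        exact norm_add_le _ _
    _ ≤ _ := by linarith

end Shi

open Complex Set Filter Topology Metric
open scoped ContDiff

namespace Shi

/-- conclusions of the chart step, with explicit constants -/
def StepOK (Φ : ℂ → ℂ → ℂ) (Lam : ℂ → ℂ) (c0 : ℂ) (N : ℕ) (X : ℂ) (ε M δ E r : ℝ) : Prop :=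
  ∀ c ∈ ball c0 r, ∀ w : ℂ,
    E ≤ ‖w‖ → w.im ≤ ‖w‖ / 2 → ‖c - c0‖ * ‖w‖ ≤ M →
      ch N X (tm Φ N X c w) = Φ c (ch N X w) ∧
      ‖tm Φ N X c w - (w / Lam c ^ N + ε)‖ ≤ δ ∧
      ‖Φ c (ch N X w) / ch N X w - 1‖ ≤ 1 / 2 ∧
      DifferentiableAt ℂ (fun u : ℂ × ℂ => Φ u.1 u.2) (c, ch N X w)

lemma half_gate {Φ : ℂ → ℂ → ℂ} {Lam : ℂ → ℂ} {c0 : ℂ} {N : ℕ} {X : ℂ} {ε M δ E r : ℝ}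
    (hst : StepOK Φ Lam c0 N X ε M δ E r) (hε : ε = 1 ∨ ε = -1) (hδ0 : 0 ≤ δ) (hδ : δ ≤ 1 / 1000) (hE : 0 ≤ E)
    {n m : ℕ} (hnm : n = 2 * m) (hn : 8 ≤ n) {s : ℂ} (hs : ‖s‖ ≤ 1 / 1000) {c : ℂ} (hc : c ∈ ball c0 r)
    (hcn : ‖c - c0‖ * n ≤ M) (hmul : ∀ w, w / Lam c ^ N = gm ε n s * w) {w0 : ℂ} (hw0 : Sec ε (E + 1) w0)
    (hw0n : ‖w0‖ ≤ n / 100) : ∀ k ≤ m,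
      (E + k / 2 ≤ ‖(tm Φ N X c)^[k] w0‖ ∧ ((tm Φ N X c)^[k] w0).im ≤ ‖(tm Φ N X c)^[k] w0‖ / 2 ∧
        ‖c - c0‖ * ‖(tm Φ N X c)^[k] w0‖ ≤ M) ∧
      ‖ε * (tm Φ N X c)^[k] w0 - (gm ε n s ^ k * (ε * w0) + ∑ j ∈ Finset.range k, gm ε n s ^ j)‖ ≤ 2 * k * δ := by
  have hε1 : ‖(ε:ℂ)‖ = 1 := by rcases hε with rfl | rfl <;> simp
  have hεε : (ε:ℂ) * ε = 1 := by rcases hε with rfl | rfl <;> simp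
  have hεεr : ε * ε = 1 := by rcases hε with rfl | rfl <;> simp
  have hcM : ∀ w : ℂ, ‖w‖ ≤ n → ‖c - c0‖ * ‖w‖ ≤ M := fun w hw =>
    (mul_le_mul_of_nonneg_left hw (norm_nonneg _)).trans hcn
  have him : ∀ w : ℂ, ε * ((ε:ℂ) * w).im = w.im := by
    intro w
    rw [im_ofReal_mul, ← mul_assoc, hεεr, one_mul]
  have hnm' : ∀ w : ℂ, ‖(ε:ℂ) * w‖ = ‖w‖ := fun w => by rw [norm_mul, hε1, one_mul]
  have main := gate_est (v := fun k => ε * (tm Φ N X c)^[k] w0) hε hnm hn hs hδ0 hδ hE ?_ ?_ ?_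
  · intro k hk
    obtain ⟨⟨a1, a2, a3⟩, a4⟩ := main k hk
    rw [hnm'] at a1 a2 a3
    rw [him] at a2
    exact ⟨⟨a1, a2, hcM _ a3⟩, by simpa using a4⟩
  · simp only [Function.iterate_zero, id_eq]
    unfold Sec at hw0 ⊢
    rw [im_ofReal_mul, re_ofReal_mul, abs_mul, one_mul]
    have : |ε| = 1 := by rcases hε with rfl | rfl <;> simp
    rw [this, one_mul]; exact hw0
  · simp only [Function.iterate_zero, id_eq]
    rw [hnm']; exact hw0n
  · intro k hk b1 b2 b3
    simp only [hnm', him] at b1 b2 b3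
    obtain ⟨-, q, -, -⟩ := hst c hc _ b1 b2 (hcM _ b3)
    rw [hmul, ← Function.iterate_succ_apply' (tm Φ N X c) k w0] at q
    have e : ε * (tm Φ N X c)^[k+1] w0 - (gm ε n s * (ε * (tm Φ N X c)^[k] w0) + 1) =
       ε * ((tm Φ N X c)^[k.succ] w0 - (gm ε n s * (tm Φ N X c)^[k] w0 + ε)) := by
      linear_combination hεε
    rw [e, hnm']; exact q

lemma near_id_zero {G : ℂ → ℂ} {R R' b : ℝ} (hR : R < R') (hd : DifferentiableOn ℂ G (ball 0 R')) (hb : 0 < R)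
    (hG : ∀ z ∈ closedBall (0:ℂ) R, ‖G z + z‖ ≤ b) (hbR : 2 * b < R) : ∃ z ∈ closedBall (0:ℂ) R, G z = 0 := by
  by_contra hcon
  push Not at hcon
  have hsub : closedBall (0:ℂ) R ⊆ ball 0 R' := closedBall_subset_ball hR
  have hd' : DiffContOnCl ℂ (fun z => (G z)⁻¹) (ball 0 R) := by
    have : DifferentiableOn ℂ (fun z => (G z)⁻¹) (closedBall 0 R) := (hd.mono hsub).inv hcon
    rw [← closure_ball _ hb.ne'] at this
    exact this.diffContOnCl
  have h0 := hG 0 (mem_closedBall_self hb.le)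
  rw [add_zero] at h0
  have hfr : ∀ z ∈ frontier (ball (0:ℂ) R), ‖(G z)⁻¹‖ ≤ (R - b)⁻¹ := by
    intro z hz
    rw [frontier_ball _ hb.ne', mem_sphere_zero_iff_norm] at hz
    have h1 := hG z (by simp [hz])
    rw [norm_inv]
    have h2 : R - b ≤ ‖G z‖ := by
      have := norm_sub_norm_le z (G z + z)
      have e : ‖z - (G z + z)‖ = ‖G z‖ := by rw [show z - (G z + z) = -G z by ring, norm_neg]
      rw [e, hz] at this; linarith
    exact inv_anti₀ (by linarith [(norm_nonneg (G z + z)).trans h1]) h2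
  have := Complex.norm_le_of_forall_mem_frontier_norm_le isBounded_ball hd' hfr (z := 0)
    (subset_closure (mem_ball_self hb))
  rw [norm_inv] at this
  have h0p : 0 < ‖G 0‖ := norm_pos_iff.2 (hcon 0 (mem_closedBall_self hb.le))
  rw [inv_le_inv₀ h0p (by linarith)] at this
  linarith

lemma iter_diff {Φ : ℂ → ℂ → ℂ} {N : ℕ} {X : ℂ} (hX : X ≠ 0) {c w : ℂ → ℂ} {s : ℂ}
    (hc : DifferentiableAt ℂ c s) (hw : DifferentiableAt ℂ w s) (m : ℕ)
    (hgood : ∀ k ≤ m, (tm Φ N X (c s))^[k] (w s) ≠ 0 ∧ ((tm Φ N X (c s))^[k] (w s)).im ≤ ‖(tm Φ N X (c s))^[k] (w s)‖ / 2 ∧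
      ‖Φ (c s) (ch N X ((tm Φ N X (c s))^[k] (w s))) / ch N X ((tm Φ N X (c s))^[k] (w s)) - 1‖ ≤ 1 / 2 ∧
      DifferentiableAt ℂ (fun u : ℂ × ℂ => Φ u.1 u.2) (c s, ch N X ((tm Φ N X (c s))^[k] (w s)))) :
    ∀ k ≤ m, DifferentiableAt ℂ (fun s => (tm Φ N X (c s))^[k] (w s)) s := by
  intro k
  induction k with
  | zero => intro _; exact hw
  | succ k ih =>
    intro hk
    obtain ⟨g1, g2, g3, g4⟩ := hgood k (by omega)
    have := differentiableAt_tm_comp (Φ := Φ) (N := N) (w := fun s => (tm Φ N X (c s))^[k] (w s)) hX g1 g2 g3 g4 hc (ih (by omega))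
    simp only [Function.iterate_succ_apply']
    exact this

end Shi

open Complex Set Filter Topology Metric
open scoped ContDiff

namespace Shi

lemma StepOK.mono {Φ : ℂ → ℂ → ℂ} {Lam : ℂ → ℂ} {c0 : ℂ} {N : ℕ} {X : ℂ} {ε M δ E r E' r' : ℝ}
    (h : StepOK Φ Lam c0 N X ε M δ E r) (hE : E ≤ E') (hr : r' ≤ r) : StepOK Φ Lam c0 N X ε M δ E' r' :=
  fun c hc w h1 h2 h3 => h c (ball_subset_ball hr hc) w (hE.trans h1) h2 h3

lemma sec_eventually {ε E : ℝ} {om : ℂ → ℂ} {c0 : ℂ} (h : ContinuousAt om c0) (hs : Sec ε E (om c0)) :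
    ∀ᶠ c in 𝓝 c0, Sec ε E (om c) := by
  unfold Sec at *
  have h1 : ContinuousAt (fun c => E + 4 * |(om c).im|) c0 := by
    have := (Complex.continuous_im.continuousAt.comp h : ContinuousAt (fun c => (om c).im) c0)
    fun_prop
  have h2 : ContinuousAt (fun c => ε * (om c).re) c0 := by
    have := (Complex.continuous_re.continuousAt.comp h : ContinuousAt (fun c => (om c).re) c0)
    fun_prop
  exact h1.eventually_lt h2 hs

lemma exists_kappa {Lm : ℂ → ℂ} {c0 : ℂ} (hL : AnalyticAt ℂ Lm c0) (h1 : Lm c0 = 1) (hd : deriv Lm c0 ≠ 0) :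
    ∃ κ : ℂ → ℂ, ∃ C > 0, κ 1 = c0 ∧ ContinuousAt κ 1 ∧ ∀ᶠ y in 𝓝 (1:ℂ), Lm (κ y) = y ∧ DifferentiableAt ℂ κ y ∧
      ‖κ y - c0‖ ≤ C * ‖y - 1‖ := by
  obtain ⟨κ, k1, k2, k3, -⟩ := ift (G := fun u : ℂ × ℂ => Lm u.2 - u.1) (u := ((1:ℂ), c0)) (d := deriv Lm c0)
    ((hL.contDiffAt.comp (((1:ℂ), c0) : ℂ × ℂ) contDiffAt_snd).sub contDiffAt_fst) (by simp [h1])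
    (by simpa using hL.differentiableAt.hasDerivAt.sub_const 1) hd
  simp only at k1 k2 k3
  obtain ⟨C, hC, hb⟩ := k1.differentiableAt.hasFDerivAt.isBigO_sub.exists_pos
  refine ⟨κ, C, hC, k2, k1.continuousAt, ?_⟩
  filter_upwards [k3, k1.eventually_analyticAt, hb.bound] with y y1 y2 y3
  refine ⟨sub_eq_zero.1 y1, y2.differentiableAt, ?_⟩
  rw [k2] at y3
  exact y3

set_option maxHeartbeats 1000000 in
theorem gate {Φ Ψ : ℂ → ℂ → ℂ} {Lm : ℂ → ℂ} {c0 X : ℂ} {N : ℕ} (hL : AnalyticAt ℂ Lm c0) (hd : deriv Lm c0 ≠ 0)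
    (hS : ST Φ Lm c0 N X 1) (hT : ST Ψ (fun c => (Lm c)⁻¹) c0 N X (-1)) (E0 : ℝ) :
    ∃ Eg > 0, ∀ omp omm : ℂ → ℂ, AnalyticAt ℂ omp c0 → AnalyticAt ℂ omm c0 → Sec 1 Eg (omp c0) → Sec (-1) Eg (omm c0) →
      ∃ᶠ c in 𝓝 c0, ∃ m : ℕ, (tm Φ N X c)^[m] (omp c) = (tm Ψ N X c)^[m] (omm c) ∧
        (∀ k ≤ m, E0 + (k:ℝ) / 2 ≤ ‖(tm Φ N X c)^[k] (omp c)‖ ∧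
          ch N X ((tm Φ N X c)^[k+1] (omp c)) = Φ c (ch N X ((tm Φ N X c)^[k] (omp c)))) ∧
        (∀ k ≤ m, E0 + (k:ℝ) / 2 ≤ ‖(tm Ψ N X c)^[k] (omm c)‖ ∧
          ch N X ((tm Ψ N X c)^[k+1] (omm c)) = Ψ c (ch N X ((tm Ψ N X c)^[k] (omm c)))) := by
  obtain ⟨κ, C, hC, κ1, κc, hκ⟩ := exists_kappa hL hS.hL1 hd
  obtain ⟨E1, hE1, r1, hr1, s1⟩ := hS.step (16 * C) (by positivity) (1/10^6) (by norm_num)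
  obtain ⟨E2, hE2, r2, hr2, s2⟩ := hT.step (16 * C) (by positivity) (1/10^6) (by norm_num)
  set E := max (max E1 E2) E0 with hEdef
  set r := min r1 r2 with hrdef
  have hE : 0 < E := lt_of_lt_of_le hE1 ((le_max_left _ _).trans (le_max_left _ _))
  have hr : 0 < r := lt_min hr1 hr2
  have hs1 : StepOK Φ Lm c0 N X 1 (16 * C) (1/10^6) E r :=
    StepOK.mono (E := E1) (r := r1) (by simpa [StepOK] using s1) ((le_max_left _ _).trans (le_max_left _ _)) (min_le_left _ _)
  have hs2 : StepOK Ψ (fun c => (Lm c)⁻¹) c0 N X (-1) (16 * C) (1/10^6) E r :=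
    StepOK.mono (E := E2) (r := r2) (by simpa [StepOK] using s2) ((le_max_right _ _).trans (le_max_left _ _)) (min_le_right _ _)
  clear s1 s2
  refine ⟨E + 1, by positivity, ?_⟩
  intro omp omm hp hm hsp hsm
  rw [Filter.frequently_iff]
  intro U hU
  set K := max ‖omp c0‖ ‖omm c0‖ + 1 with hK
  have hK0 : 0 < K := by positivity
  have hev : ∀ᶠ c in 𝓝 c0, c ∈ U ∧ c ∈ ball c0 r ∧ Sec 1 (E+1) (omp c) ∧ Sec (-1) (E+1) (omm c) ∧
      DifferentiableAt ℂ omp c ∧ DifferentiableAt ℂ omm c ∧ ‖omp c‖ ≤ K ∧ ‖omm c‖ ≤ K := by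
    have b1 : ∀ᶠ c in 𝓝 c0, ‖omp c‖ < K := hp.continuousAt.norm.eventually_lt continuousAt_const
      (by rw [hK]; linarith [le_max_left ‖omp c0‖ ‖omm c0‖])
    have b2 : ∀ᶠ c in 𝓝 c0, ‖omm c‖ < K := hm.continuousAt.norm.eventually_lt continuousAt_const
      (by rw [hK]; linarith [le_max_right ‖omp c0‖ ‖omm c0‖])
    filter_upwards [hU, ball_mem_nhds c0 hr, sec_eventually hp.continuousAt hsp, sec_eventually hm.continuousAt hsm,
      hp.eventually_analyticAt, hm.eventually_analyticAt, b1, b2] with c a1 a2 a3 a4 a5 a6 a7 a8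
    exact ⟨a1, a2, a3, a4, a5.differentiableAt, a6.differentiableAt, a7.le, a8.le⟩
  have hev2 : ∀ᶠ y in 𝓝 (1:ℂ), _ := hκ.and (κc.tendsto.eventually (by rw [κ1]; exact hev))
  obtain ⟨t, ht, htb⟩ := Metric.eventually_nhds_iff_ball.1 hev2
  obtain ⟨m, hmb⟩ := exists_nat_gt (max (max 500 (16 / t)) (max (100 * K) (10^7 * (K + 1))))
  obtain ⟨⟨m1, m2⟩, m3, m4⟩ : ((500:ℝ) < m ∧ 16 / t < m) ∧ 100 * K < m ∧ 10^7 * (K + 1) < m := by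
    simpa only [max_lt_iff] using hmb
  set n := 2 * m with hn
  have hnr : (n:ℝ) = 2 * m := by rw [hn]; push_cast; ring
  have hn1000 : 1000 ≤ n := by
    have : (500:ℕ) < m := by exact_mod_cast m1
    omega
  have hn0 : (0:ℝ) < n := by rw [hnr]; linarith
  have hN0 : (N:ℂ) ≠ 0 := by exact_mod_cast hS.hN
  have hn0c : (n:ℂ) ≠ 0 := by
    have : n ≠ 0 := by omega
    exact_mod_cast this
  -- the parameter
  set Y : ℂ → ℂ := fun s => exp ((2 * Real.pi * I + s) / n / N) with hY
  have hσ : ∀ s : ℂ, ‖s‖ < 1/1000 → ‖Y s - 1‖ ≤ 16 / n := by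
    intro s hs
    have h1 : ‖(2 * Real.pi * I + s) / n / N‖ ≤ 8 / n := by
      rw [norm_div, norm_div, Complex.norm_natCast, Complex.norm_natCast]
      have h2 : ‖2 * Real.pi * I + s‖ ≤ 8 := by
        refine (norm_add_le _ _).trans ?_
        have : ‖(2 * Real.pi * I : ℂ)‖ = 2 * Real.pi := by
          simp [abs_of_pos Real.pi_pos]
        rw [this]; linarith [Real.pi_lt_d2]
      have hN1 : (1:ℝ) ≤ N := by exact_mod_cast Nat.one_le_iff_ne_zero.2 hS.hN
      calc _ ≤ ‖2 * Real.pi * I + s‖ / n := div_le_self (by positivity) hN1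
        _ ≤ 8 / n := by gcongr
    have h3 : 8 / (n:ℝ) ≤ 1 := by
      rw [div_le_one hn0]; rw [hnr]; linarith
    have := Complex.norm_exp_sub_one_le (h1.trans h3)
    calc _ ≤ _ := this
      _ ≤ 2 * (8 / n) := by gcongr
      _ = 16 / n := by ring
  have hYt : ∀ s : ℂ, ‖s‖ < 1/1000 → Y s ∈ ball (1:ℂ) t := by
    intro s hs
    rw [mem_ball, dist_eq_norm]
    refine (hσ s hs).trans_lt ?_
    rw [div_lt_iff₀ ht] at m2
    rw [div_lt_iff₀ hn0, hnr]
    nlinarith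
  set cs : ℂ → ℂ := fun s => κ (Y s) with hcs
  have hYd : ∀ s, DifferentiableAt ℂ Y s := by intro s; rw [hY]; fun_prop
  have hcd : ∀ s : ℂ, ‖s‖ < 1/1000 → DifferentiableAt ℂ cs s := fun s hs =>
    (htb _ (hYt s hs)).1.2.1.comp s (hYd s)
  have hLp : ∀ s : ℂ, ‖s‖ < 1/1000 → Lm (cs s) ^ N = exp ((2 * Real.pi * I + s) / n) := by
    intro s hs
    rw [hcs, (htb _ (hYt s hs)).1.1, hY]
    simp only
    rw [← Complex.exp_nat_mul]
    congr 1
    field_simp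
  have hmul1 : ∀ s : ℂ, ‖s‖ < 1/1000 → ∀ w, w / Lm (cs s) ^ N = gm 1 n s * w := by
    intro s hs w
    rw [hLp s hs, gm, div_eq_mul_inv, ← Complex.exp_neg, mul_comm]; simp
  have hmul2 : ∀ s : ℂ, ‖s‖ < 1/1000 → ∀ w, w / ((fun c => (Lm c)⁻¹) (cs s)) ^ N = gm (-1) n s * w := by
    intro s hs w
    simp only
    rw [inv_pow, hLp s hs, gm, div_inv_eq_mul, mul_comm]; simp
  have hcn : ∀ s : ℂ, ‖s‖ < 1/1000 → ‖cs s - c0‖ * n ≤ 16 * C := by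
    intro s hs
    have h1 := (htb _ (hYt s hs)).1.2.2
    have h2 := hσ s hs
    calc ‖cs s - c0‖ * n ≤ (C * (16 / n)) * n := by
          gcongr; exact h1.trans (by gcongr)
      _ = 16 * C := by field_simp
  have hKn : K ≤ n / 100 := by rw [hnr]; linarith
  have H1 : ∀ s : ℂ, ‖s‖ < 1/1000 → _ := fun s hs => half_gate hs1 (Or.inl rfl) (by norm_num) (by norm_num) hE.le hn (by omega) hs.le
    (htb _ (hYt s hs)).2.2.1 (hcn s hs) (hmul1 s hs) (htb _ (hYt s hs)).2.2.2.1 ((htb _ (hYt s hs)).2.2.2.2.2.2.2.1.trans hKn)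
  have H2 : ∀ s : ℂ, ‖s‖ < 1/1000 → _ := fun s hs => half_gate hs2 (Or.inr rfl) (by norm_num) (by norm_num) hE.le hn (by omega) hs.le
    (htb _ (hYt s hs)).2.2.1 (hcn s hs) (hmul2 s hs) (htb _ (hYt s hs)).2.2.2.2.1 ((htb _ (hYt s hs)).2.2.2.2.2.2.2.2.trans hKn)
  have hpos : ∀ (k:ℕ) (x : ℝ), E + k / 2 ≤ x → E ≤ x := by
    intro k x h
    have : (0:ℝ) ≤ k / 2 := by positivity
    linarith
  set v : ℂ → ℂ := fun s => (tm Φ N X (cs s))^[m] (omp (cs s)) with hv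
  set w : ℂ → ℂ := fun s => (tm Ψ N X (cs s))^[m] (omm (cs s)) with hw
  have hvd : ∀ s : ℂ, ‖s‖ < 1/1000 → DifferentiableAt ℂ v s := by
    intro s hs
    refine iter_diff (Φ := Φ) (c := cs) (w := fun s => omp (cs s)) hS.hX (hcd s hs)
      ((htb _ (hYt s hs)).2.2.2.2.2.1.comp s (hcd s hs)) m ?_ m le_rfl
    intro k hk
    obtain ⟨⟨a1, a2, a3⟩, -⟩ := H1 s hs k hk
    obtain ⟨-, -, q1, q2⟩ := hs1 _ (htb _ (hYt s hs)).2.2.1 _ (hpos k _ a1) a2 a3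
    exact ⟨norm_pos_iff.1 (hE.trans_le (hpos k _ a1)), a2, q1, q2⟩
  have hwd : ∀ s : ℂ, ‖s‖ < 1/1000 → DifferentiableAt ℂ w s := by
    intro s hs
    refine iter_diff (Φ := Ψ) (c := cs) (w := fun s => omm (cs s)) hS.hX (hcd s hs)
      ((htb _ (hYt s hs)).2.2.2.2.2.2.1.comp s (hcd s hs)) m ?_ m le_rfl
    intro k hk
    obtain ⟨⟨a1, a2, a3⟩, -⟩ := H2 s hs k hk
    obtain ⟨-, -, q1, q2⟩ := hs2 _ (htb _ (hYt s hs)).2.2.1 _ (hpos k _ a1) a2 a3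
    exact ⟨norm_pos_iff.1 (hE.trans_le (hpos k _ a1)), a2, q1, q2⟩
  have hgd : ∀ s, DifferentiableAt ℂ (fun s => gm 1 n s) s := by
    intro s; unfold gm; fun_prop
  obtain ⟨s, hs, hs0⟩ := near_id_zero (G := fun s => (1 - gm 1 n s) * (v s - w s)) (R := 1/2000) (R' := 1/1000) (b := 1/10^4)
    (by norm_num) (by
      intro s hs
      rw [mem_ball_zero_iff] at hs
      exact (((hgd s).const_sub 1).mul ((hvd s hs).sub (hwd s hs))).differentiableWithinAt) (by norm_num) (by
      intro s hs
      rw [mem_closedBall_zero_iff] at hs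
      have hs' : ‖s‖ < 1/1000 := by linarith
      have a1 := (H1 s hs' m le_rfl).2
      have a2 := (H2 s hs' m le_rfl).2
      have G := gate_meet (v := fun k => (tm Φ N X (cs s))^[k] (omp (cs s)))
        (w := fun k => -(tm Ψ N X (cs s))^[k] (omm (cs s))) (d := 2 * m * (1/10^6)) (K := K) hn hn1000 hs'.le (by positivity)
        (by simpa using a1) (by simpa using a2) (by simpa using (htb _ (hYt s hs')).2.2.2.2.2.2.2.1)
        (by simpa using (htb _ (hYt s hs')).2.2.2.2.2.2.2.2)
      simp only [← sub_eq_add_neg] at G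
      refine G.trans ?_
      rw [hnr]
      have e : 20 / (2 * (m:ℝ)) * (2 * (2 * m * (1 / 10 ^ 6)) + 4 * K + 4) = 40 / 10^6 + 40 * (K + 1) / m := by
        have : (m:ℝ) ≠ 0 := by linarith
        field_simp; ring
      rw [e]
      have e2 : 40 * (K + 1) / m ≤ 40 / 10^7 := by
        rw [div_le_div_iff₀ (by linarith) (by norm_num)]; nlinarith
      have e3 : ‖s‖ ^ 2 ≤ (1/2000)^2 := by gcongr
      norm_num at e2 e3 ⊢
      linarith) (by norm_num)
  rw [mem_closedBall_zero_iff] at hs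
  have hs' : ‖s‖ < 1/1000 := by linarith
  have hgm : 1 - gm 1 n s ≠ 0 := by
    intro h
    have h1 : exp (-((1:ℝ) * ((2 * Real.pi * I + s) / n))) = 1 := (sub_eq_zero.1 h).symm
    rw [Complex.exp_eq_one_iff] at h1
    obtain ⟨z, hz⟩ := h1
    have him := congrArg Complex.im hz
    have : (2 * Real.pi * I + s) = -(z * n) * (2 * Real.pi * I) := by
      field_simp at hz
      simp at hz
      linear_combination -hz
    have him : 2 * Real.pi + s.im = -(z * n) * (2 * Real.pi) := by
      have := congrArg Complex.im this
      simpa using this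
    have h3 : |s.im| ≤ 1/2000 := (Complex.abs_im_le_norm s).trans hs
    have h4 := Real.pi_gt_three
    rw [abs_le] at h3
    have h5 : ((1 + z * n : ℤ) : ℝ) * (2 * Real.pi) = - s.im := by push_cast; linear_combination him
    have h6 : (1 + z * n : ℤ) = 0 := by
      by_contra hne
      have : (1:ℝ) ≤ |((1 + z * n : ℤ) : ℝ)| := by exact_mod_cast Int.one_le_abs hne
      have h7 : |((1 + z * n : ℤ) : ℝ)| * (2 * Real.pi) = |s.im| := by
        rw [← abs_of_pos (show 0 < 2 * Real.pi by positivity), ← abs_mul, h5, abs_neg]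
      have h8 : |s.im| ≤ 1/2000 := (Complex.abs_im_le_norm s).trans hs
      nlinarith
    have h7 : (n:ℤ) ∣ 1 := ⟨-z, by linear_combination h6⟩
    have := Int.le_of_dvd one_pos h7
    omega
  have hvw : v s = w s := sub_eq_zero.1 ((mul_eq_zero.1 hs0).resolve_left hgm)
  refine ⟨cs s, (htb _ (hYt s hs')).2.1, m, hvw, ?_, ?_⟩
  · intro k hk
    obtain ⟨⟨a1, a2, a3⟩, -⟩ := H1 s hs' k hk
    refine ⟨by linarith [le_max_right (max E1 E2) E0], ?_⟩
    rw [Function.iterate_succ_apply']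
    exact (hs1 _ (htb _ (hYt s hs')).2.2.1 _ (hpos k _ a1) a2 a3).1
  · intro k hk
    obtain ⟨⟨a1, a2, a3⟩, -⟩ := H2 s hs' k hk
    refine ⟨by linarith [le_max_right (max E1 E2) E0], ?_⟩
    rw [Function.iterate_succ_apply']
    exact (hs2 _ (htb _ (hYt s hs')).2.2.1 _ (hpos k _ a1) a2 a3).1

end Shi

open Complex Set Filter Topology Metric
open scoped ContDiff

namespace Shi

lemma exists_beta {c : ℂ} (hc : c ≠ 1 / 4) : ∃ β, fq c β = β ∧ 1 < ‖2 * β‖ := by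
  obtain ⟨d, hd⟩ := IsAlgClosed.exists_pow_nat_eq (1 - 4 * c) (show 0 < 2 by norm_num)
  have r1 : fq c ((1 + d) / 2) = (1 + d) / 2 := by unfold fq; linear_combination hd / 4
  have r2 : fq c ((1 - d) / 2) = (1 - d) / 2 := by unfold fq; linear_combination hd / 4
  by_contra hcon
  push Not at hcon
  have h1 := hcon _ r1
  have h2 := hcon _ r2
  rw [mul_div_cancel₀ _ (two_ne_zero)] at h1 h2
  have hp := parallelogram_law_with_norm ℝ (1:ℂ) d
  have hd0 : ‖d‖ * ‖d‖ = 0 := by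
    have : ‖(1:ℂ)‖ = 1 := norm_one
    rw [this] at hp
    nlinarith [norm_nonneg d, norm_nonneg (1 + d), norm_nonneg (1 - d)]
  have : d = 0 := by simpa using hd0
  rw [this] at hd
  apply hc
  linear_combination hd / 4

lemma lift_ch {N : ℕ} (hN : N ≠ 0) {X w0 c0 : ℂ} (hX : X ≠ 0) (hw : w0 ≠ 0) (hr : w0.im ≤ ‖w0‖ / 2) {ψ : ℂ → ℂ}
    (hψ : AnalyticAt ℂ ψ c0) (h0 : ch N X w0 = ψ c0) :
    ∃ om : ℂ → ℂ, AnalyticAt ℂ om c0 ∧ om c0 = w0 ∧ ∀ᶠ c in 𝓝 c0, ch N X (om c) = ψ c := by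
  have hN' : (N:ℂ) ≠ 0 := by exact_mod_cast hN
  have hs := slit_of_reg hw hr
  have hdd : HasDerivAt (ch N X) (X * (exp (-(1 / N) * log (I * w0)) * (-(1 / N) * ((I * 1) / (I * w0))))) w0 := by
    unfold ch
    exact (((((hasDerivAt_id w0).const_mul I).clog hs).const_mul _).cexp).const_mul X
  have hcd : AnalyticAt ℂ (ch N X) w0 := by
    unfold ch
    have : AnalyticAt ℂ (fun w => log (I * w)) w0 := (analyticAt_const.mul analyticAt_id).clog hs
    exact analyticAt_const.mul (analyticAt_const.mul this).cexp
  have hne : X * (exp (-(1 / N) * log (I * w0)) * (-(1 / N) * ((I * 1) / (I * w0)))) ≠ 0 := by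
    have := exp_ne_zero (-(1 / N) * log (I * w0))
    have hI := I_ne_zero
    exact mul_ne_zero hX (mul_ne_zero this (mul_ne_zero (neg_ne_zero.2 (div_ne_zero one_ne_zero hN'))
      (div_ne_zero (mul_ne_zero hI one_ne_zero) (mul_ne_zero hI hw))))
  have hdd' : HasDerivAt (fun z => ch N X z - ψ c0) (X * (exp (-(1 / N) * log (I * w0)) * (-(1 / N) * ((I * 1) / (I * w0))))) w0 :=
    hdd.sub_const _
  obtain ⟨om, o1, o2, o3, -⟩ := ift (G := fun u : ℂ × ℂ => ch N X u.2 - ψ u.1) (u := (c0, w0))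
    ((hcd.contDiffAt.comp ((c0, w0) : ℂ × ℂ) contDiffAt_snd).sub (hψ.contDiffAt.comp ((c0, w0) : ℂ × ℂ) contDiffAt_fst))
    (by simp [h0]) hdd' hne
  exact ⟨om, o1, o2, o3.mono fun c hc => sub_eq_zero.1 hc⟩

lemma ST.orbit {Φ : ℂ → ℂ → ℂ} {Lam : ℂ → ℂ} {c0 X : ℂ} {N : ℕ} {ε : ℝ} (h : ST Φ Lam c0 N X ε) :
    ∃ E0 > 0, ∀ E ≥ E0, ∀ w, Sec ε E w →
      (∀ k, ch N X ((tm Φ N X c0)^[k+1] w) = Φ c0 (ch N X ((tm Φ N X c0)^[k] w))) ∧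
      Tendsto (fun k => ch N X ((tm Φ N X c0)^[k] w)) atTop (𝓝 0) ∧ (∀ k, E ≤ ‖(tm Φ N X c0)^[k] w‖) ∧
      ∀ om : ℂ → ℂ, AnalyticAt ℂ om c0 → om c0 = w → ∀ k,
        ContinuousAt (fun c => ch N X ((tm Φ N X c)^[k] (om c))) c0 := by
  obtain ⟨E0, hE0, r, hr, hst⟩ := h.step 0 le_rfl (1 / 100) (by norm_num)
  have good : ∀ w, Sec ε E0 w → _ := fun w hw => hst c0 (mem_ball_self hr) w
    (by have := hw.norm h.hε; linarith [abs_nonneg w.im]) (hw.reg h.hε hE0.le) (by simp)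
  have hT : ∀ w, Sec ε E0 w → ‖tm Φ N X c0 w - (w + ε)‖ ≤ 1 / 100 := by
    intro w hw
    simpa [h.hL1] using (good w hw).2.1
  refine ⟨E0, hE0, fun E hE w hw => ?_⟩
  have hsec := fun k => (sec_iter h.hε hT hE hw k).1
  have hsec0 : ∀ k, Sec ε E0 ((tm Φ N X c0)^[k] w) := fun k => (hsec k).mono (by
    have : (0:ℝ) ≤ k := k.cast_nonneg
    linarith)
  have hnorm : ∀ k : ℕ, E + 9 / 10 * k ≤ ‖(tm Φ N X c0)^[k] w‖ := fun k => by
    have := (hsec k).norm h.hε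
    linarith [abs_nonneg ((tm Φ N X c0)^[k] w).im]
  refine ⟨fun k => ?_, ?_, fun k => ?_, ?_⟩
  · rw [Function.iterate_succ_apply']; exact (good _ (hsec0 k)).1
  · rw [Metric.tendsto_atTop]
    intro e he
    obtain ⟨E1, hE1, hch⟩ := ch_small h.hN X he
    obtain ⟨k0, hk0⟩ := exists_nat_gt (2 * E1)
    refine ⟨k0, fun k hk => ?_⟩
    rw [dist_zero_right]
    refine hch _ (le_trans ?_ (hnorm k))
    have : (k0:ℝ) ≤ k := by exact_mod_cast hk
    linarith
  · have : (0:ℝ) ≤ k := k.cast_nonneg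
    linarith [hnorm k]
  · intro om ho how k
    have h0 : ∀ k, (tm Φ N X c0)^[k] w ≠ 0 := fun k => norm_pos_iff.1 (by
      have : (0:ℝ) ≤ k := k.cast_nonneg
      linarith [hnorm k])
    have hreg : ∀ k, ((tm Φ N X c0)^[k] w).im ≤ ‖(tm Φ N X c0)^[k] w‖ / 2 := fun k => (hsec0 k).reg h.hε hE0.le
    have := iter_diff (Φ := Φ) (N := N) (c := fun c => c) (w := om) (s := c0) h.hX differentiableAt_id ho.differentiableAt k
      (by
        intro j _
        rw [how]
        exact ⟨h0 j, hreg j, (good _ (hsec0 j)).2.2.1, (good _ (hsec0 j)).2.2.2⟩) k le_rfl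
    refine ContinuousAt.comp (g := ch N X) (f := fun c => (tm Φ N X c)^[k] (om c)) ?_ this.continuousAt
    simp only [how]
    exact (differentiableAt_ch (h0 k) (hreg k)).continuousAt

lemma shadow {Φ : ℂ → ℂ → ℂ} {c0 X w : ℂ} {N : ℕ} (hN : N ≠ 0) {φ om : ℂ → ℂ} {E0 : ℝ} (hE0 : 0 ≤ E0) (hom : om c0 = w) (hφ : ContinuousAt φ c0)
    (hcont : ∀ k, ContinuousAt (fun c => ch N X ((tm Φ N X c)^[k] (om c))) c0) {η : ℝ} (hη : 0 < η) :
    ∀ᶠ c in 𝓝 c0, ∀ k : ℕ, E0 + k / 2 ≤ ‖(tm Φ N X c)^[k] (om c)‖ →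
      ∃ y ∈ insert (φ c0) (range fun k => φ c0 + ch N X ((tm Φ N X c0)^[k] w)),
        dist (φ c + ch N X ((tm Φ N X c)^[k] (om c))) y < η := by
  obtain ⟨E1, hE1, hch⟩ := ch_small hN X (half_pos hη)
  obtain ⟨k0, hk0⟩ := exists_nat_gt (2 * E1)
  have e1 : ∀ᶠ c in 𝓝 c0, ∀ k ∈ Finset.range k0, dist (φ c + ch N X ((tm Φ N X c)^[k] (om c)))
      (φ c0 + ch N X ((tm Φ N X c0)^[k] w)) < η := by
    rw [Finset.eventually_all]
    intro k _
    have := (hφ.add (hcont k)).eventually (Metric.ball_mem_nhds _ hη)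
    simpa only [hom, mem_ball, Pi.add_apply] using this
  filter_upwards [e1, hφ.eventually (Metric.ball_mem_nhds _ (half_pos hη))] with c a1 a2 k hk
  by_cases hkk : k < k0
  · exact ⟨_, mem_insert_of_mem _ (mem_range_self k), a1 k (Finset.mem_range.2 hkk)⟩
  · refine ⟨_, mem_insert _ _, ?_⟩
    have h1 : (k0:ℝ) ≤ k := by exact_mod_cast not_lt.1 hkk
    have h2 := hch _ (show E1 ≤ ‖(tm Φ N X c)^[k] (om c)‖ by linarith)
    rw [dist_eq_norm] at a2 ⊢
    calc _ = ‖(φ c - φ c0) + ch N X ((tm Φ N X c)^[k] (om c))‖ := by congr 1; ring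
      _ ≤ _ := norm_add_le _ _
      _ < η := by linarith

lemma near_compact {S : Set ℂ} (hS : IsCompact S) (c0 : ℂ) (n : ℕ) {η : ℝ} (hη : 0 < η) :
    ∃ η' > 0, ∀ᶠ c in 𝓝 c0, ∀ y ∈ S, ∀ z, dist z y < η' → dist ((fq c)^[n] z) ((fq c0)^[n] y) < η := by
  have hK : IsCompact (closedBall c0 1 ×ˢ cthickening 1 S) := (isCompact_closedBall c0 1).prod hS.cthickening
  have hu := hK.uniformContinuousOn_of_continuous (continuous_iter2 n).continuousOn
  rw [Metric.uniformContinuousOn_iff] at hu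
  obtain ⟨δ, hδ, H⟩ := hu η hη
  refine ⟨min δ 1, by positivity, ?_⟩
  filter_upwards [Metric.ball_mem_nhds c0 hδ, Metric.ball_mem_nhds c0 one_pos] with c hc hc1 y hy z hz
  refine H (c, z) ⟨(mem_ball.1 hc1).le, ?_⟩ (c0, y) ⟨mem_closedBall_self zero_le_one, self_subset_cthickening _ hy⟩ ?_
  · exact mem_cthickening_of_dist_le _ y _ _ hy (hz.le.trans (min_le_right _ _))
  · rw [Prod.dist_eq, max_lt_iff]; exact ⟨hc, hz.trans_le (min_le_left _ _)⟩

end Shi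

open Complex Set Filter Topology Metric
open scoped ContDiff

namespace Shi

lemma crit_no_fix {c0 z0 : ℂ} {L j0 : ℕ} {x : ℕ → ℂ} (hL : L ≠ 0) (hx : ∀ k, (fq c0)^[L] (z0 + x k) = z0 + x (k + 1))
    (h0 : xi c0 j0 = z0 + x 0) (hne : ∀ k, x k ≠ 0) (hlim : Tendsto x atTop (𝓝 0)) (j : ℕ) :
    (fq c0)^[L] (xi c0 j) ≠ xi c0 j := by
  intro hj
  have hk : ∀ k, xi c0 (j0 + k * L) = z0 + x k := by
    intro k
    induction k with
    | zero => simpa using h0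
    | succ k ih => rw [← hx, ← ih, xi_add]; congr 1; ring
  have hfix : ∀ i, (fq c0)^[L] (xi c0 (j + i)) = xi c0 (j + i) := by
    intro i
    rw [xi_add, show L + (j + i) = i + (L + j) by ring, ← xi_add, ← xi_add c0 L j, hj, xi_add, add_comm]
  have hconst : ∀ i, xi c0 (j0 + (j + i) * L) = xi c0 (j0 + j * L) := by
    intro i
    induction i with
    | zero => rfl
    | succ i ih =>
      rw [← ih, show j0 + (j + (i+1)) * L = L + (j0 + (j + i) * L) by ring, ← xi_add]
      have : j ≤ j0 + (j + i) * L := by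
        have := Nat.one_le_iff_ne_zero.2 hL
        nlinarith
      obtain ⟨d, hd⟩ := Nat.exists_eq_add_of_le this
      rw [hd, hfix]
  have h1 : ∀ i, x (j + i) = x j := by
    intro i
    have := hconst i
    rw [hk, hk] at this
    exact add_left_cancel this
  have h2 : Tendsto (fun i => x (j + i)) atTop (𝓝 0) := by
    have := (tendsto_add_atTop_iff_nat j).2 hlim
    simpa [add_comm] using this
  simp only [h1] at h2
  exact hne j (tendsto_nhds_unique tendsto_const_nhds h2)

lemma Par.L_ne {c0 : ℂ} {p q : ℕ} {φ : ℂ → ℂ} (h : Par c0 p q φ) : p * q ≠ 0 := mul_ne_zero h.hp h.hq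

lemma Par.deriv_L {c0 : ℂ} {p q : ℕ} {φ : ℂ → ℂ} (h : Par c0 p q φ) : deriv (fun c => dq c (p * q) (φ c)) c0 ≠ 0 := by
  have e : (fun c => dq c (p * q) (φ c)) =ᶠ[𝓝 c0] fun c => (dq c p (φ c)) ^ q := by
    filter_upwards [h.fix] with c hc
    exact dq_mul_fix hc q
  rw [e.deriv_eq]
  have := ((analyticAt_dq_comp h.an p).differentiableAt.hasDerivAt.pow q).deriv
  have e2 : ((fun c => dq c p (φ c)) ^ q) = fun c => (dq c p (φ c)) ^ q := rfl
  rw [e2] at this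
  rw [this]
  have hq : (q:ℂ) ≠ 0 := by exact_mod_cast h.hq
  have : dq c0 p (φ c0) ≠ 0 := h.prim.ne_zero h.hq
  exact mul_ne_zero (mul_ne_zero hq (pow_ne_zero _ this)) h.der

lemma fix_iter_ge {c β : ℂ} (h : fq c β = β) (n : ℕ) : (fq c)^[n] β = β := Function.iterate_fixed h n

lemma dq_fix {c β : ℂ} (h : fq c β = β) (n : ℕ) : dq c n β = (2 * β) ^ n := by
  simp [dq, fix_iter_ge h]

set_option maxHeartbeats 1000000 in
theorem stepB_local {c0 : ℂ} {p q : ℕ} {φ : ℂ → ℂ} (h : Par c0 p q φ) (hc : c0 ≠ 1 / 4) :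
    ∃ Qs : Set ℂ, IsCompact Qs ∧ Qs.Countable ∧ -φ c0 ∉ Qs ∧ ∀ η > 0, ∃ᶠ c in 𝓝 c0, Mis c ∧
      ∀ j, ∃ y ∈ Qs, dist (xi c j) y < η := by
  obtain ⟨N, -, hN, X, Ψ, hS, hT, r, hr, hinv⟩ := h.setup
  set L := p * q with hL
  have hL0 : L ≠ 0 := h.L_ne
  set z0 := φ c0 with hz0
  have hLz : (fq c0)^[L] z0 = z0 := fix_mul h.fix0 q
  have hz00 : z0 ≠ 0 := by
    intro h0
    have := h.dq0
    rw [← hL, ← hz0, h0] at this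
    obtain ⟨l, hl⟩ := Nat.exists_eq_succ_of_ne_zero hL0
    rw [hl, dq] at this
    simp [Finset.prod_range_succ'] at this
  obtain ⟨β, hβ, hβ1⟩ := exists_beta hc
  have hβ0 : β ≠ 0 := by rintro rfl; norm_num at hβ1
  -- cycle avoids β
  have hcyc : ∀ i, (fq c0)^[i] z0 ≠ β := by
    intro i hi
    have h1 : (fq c0)^[L * i] z0 = z0 := fix_mul hLz i
    have h2 : i ≤ L * i := Nat.le_mul_of_pos_left i (Nat.pos_of_ne_zero hL0)
    obtain ⟨d, hd⟩ := Nat.exists_eq_add_of_le' h2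
    rw [hd, Function.iterate_add_apply, hi, fix_iter_ge hβ] at h1
    have h3 := h.dq0
    rw [← hL, ← hz0, ← h1, dq_fix hβ] at h3
    have h4 := congrArg norm h3
    rw [norm_pow, norm_one] at h4
    exact absurd h4 (one_lt_pow₀ hβ1 hL0).ne'
  obtain ⟨E1, hE1, orb1⟩ := hS.orbit
  obtain ⟨E2, hE2, orb2⟩ := hT.orbit
  obtain ⟨E3, hE3, hch⟩ := ch_small hN X hr
  obtain ⟨Eg, hEg, hgate⟩ := gate (analyticAt_dq_comp h.an L) h.deriv_L hS hT E3
  set E := max (max E1 E2) (max E3 Eg) with hE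
  have e1 : E1 ≤ E := (le_max_left _ _).trans (le_max_left _ _)
  have e2 : E2 ≤ E := (le_max_right _ _).trans (le_max_left _ _)
  have e3 : E3 ≤ E := (le_max_left _ _).trans (le_max_right _ _)
  have e4 : Eg ≤ E := (le_max_right _ _).trans (le_max_right _ _)
  have hE0 : 0 < E := hE1.trans_le e1
  obtain ⟨j0, wp, hwp, hxi0⟩ := crit_enter h hS E
  obtain ⟨M, wm, hwm, hb0⟩ := repel_hit (φ := φ) hT hr (fun x hx => hinv c0 (mem_ball_self hr) x hx) hβ hβ0 E
  rw [← hz0] at hxi0 hb0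
  obtain ⟨o1, o2, o3, o4⟩ := orb1 E e1 wp hwp
  obtain ⟨u1, u2, u3, u4⟩ := orb2 E e2 wm hwm
  set x : ℕ → ℂ := fun k => ch N X ((tm (loc φ L) N X c0)^[k] wp) with hx
  set y : ℕ → ℂ := fun k => ch N X ((tm Ψ N X c0)^[k] wm) with hy
  have hxstep : ∀ k, (fq c0)^[L] (z0 + x k) = z0 + x (k + 1) := by
    intro k
    have : x (k+1) = (fq c0)^[L] (z0 + x k) - z0 := o1 k
    rw [this]; ring
  have hystep : ∀ k, (fq c0)^[L] (z0 + y (k + 1)) = z0 + y k := by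
    intro k
    have h1 : y (k+1) = Ψ c0 (y k) := u1 k
    have h2 := hinv c0 (mem_ball_self hr) (y k) (by rw [mem_ball_zero_iff]; exact hch _ (e3.trans (u3 k)))
    rw [← h1] at h2
    have h3 : (fq c0)^[L] (z0 + y (k+1)) - z0 = y k := h2
    rw [← h3]; ring
  have hcrit := crit_no_fix hL0 hxstep hxi0 (fun k => ch_ne hS.hX) o2
  have hxk : ∀ k, xi c0 (k * L + j0) = z0 + x k := by
    intro k
    induction k with
    | zero => rw [zero_mul, zero_add]; exact hxi0
    | succ k ih => rw [← hxstep, ← ih, xi_add]; congr 1; ring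
  have hyk : ∀ k, (fq c0)^[M + k * L] (z0 + y k) = β := by
    intro k
    induction k with
    | zero => rw [zero_mul, add_zero]; exact hb0
    | succ k ih =>
      rw [show M + (k+1) * L = (M + k * L) + L by ring, Function.iterate_add_apply, hystep, ih]
  -- the set
  set S : Set ℂ := insert z0 (range fun k => z0 + x k) ∪ insert z0 (range fun k => z0 + y k) with hSdef
  have hScomp : IsCompact S := by
    have h1 : Tendsto (fun k => z0 + x k) atTop (𝓝 z0) := by simpa using o2.const_add z0
    have h2 : Tendsto (fun k => z0 + y k) atTop (𝓝 z0) := by simpa using u2.const_add z0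
    exact h1.isCompact_insert_range.union h2.isCompact_insert_range
  have hScount : S.Countable := ((countable_range _).insert _).union ((countable_range _).insert _)
  set Qs : Set ℂ := (⋃ i ∈ Finset.range (L + M + 1), (fun z => (fq c0)^[i] z) '' S) ∪ (xi c0 '' (Finset.range j0 : Set ℕ)) with hQs
  have hQmem : ∀ i < L + M + 1, ∀ s ∈ S, (fq c0)^[i] s ∈ Qs := by
    intro i hi s hs
    refine Or.inl (mem_iUnion₂.2 ⟨i, Finset.mem_range.2 hi, s, hs, rfl⟩)
  refine ⟨Qs, ?_, ?_, ?_, ?_⟩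
  · refine (Finset.isCompact_biUnion _ fun i _ => hScomp.image (continuous_iter c0 i)).union ?_
    exact ((Finset.finite_toSet _).image _).isCompact
  · refine (Set.Countable.biUnion (Finset.countable_toSet _) fun i _ => hScount.image _).union ?_
    exact ((Finset.finite_toSet _).image _).countable
  · have hneg : (fq c0)^[L] (-z0) = z0 := by rw [fq_neg_iter c0 L hL0, hLz]
    have key : ∀ j, xi c0 j ≠ -z0 := by
      intro j hj
      have h1 : xi c0 (L + j) = z0 := by rw [← xi_add, hj, hneg]
      exact hcrit (L + j) (by rw [h1, hLz])
    have key1 : ∀ i, (fq c0)^[i] z0 ≠ -z0 := by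
      intro i hi
      have h1 : (fq c0)^[L] ((fq c0)^[i] z0) = (fq c0)^[i] z0 := by
        rw [← Function.iterate_add_apply, add_comm, Function.iterate_add_apply, hLz]
      rw [hi, hneg] at h1
      apply hz00
      linear_combination h1 / 2
    rintro (hm | ⟨j, -, hj⟩)
    · obtain ⟨i, -, s, hs, hi⟩ := mem_iUnion₂.1 hm
      simp only at hi
      rcases hs with (rfl | ⟨k, rfl⟩) | (rfl | ⟨k, rfl⟩)
      · exact key1 i hi
      · simp only at hi
        rw [← hxk, xi_add] at hi
        exact key _ hi
      · exact key1 i hi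
      · simp only at hi
        have h1 : (fq c0)^[L + i] (z0 + y k) = z0 := by rw [Function.iterate_add_apply, hi, hneg]
        refine hcyc (M + k * L) ?_
        rw [← h1, ← Function.iterate_add_apply, add_comm, Function.iterate_add_apply, hyk, fix_iter_ge hβ]
    · exact key j hj
  -- analytic continuations
  have hβne : dq c0 1 β ≠ 1 := by
    intro h1
    rw [dq_fix hβ, pow_one] at h1
    rw [h1, norm_one] at hβ1
    exact lt_irrefl _ hβ1
  obtain ⟨bt, bt1, bt2, bt3, -⟩ := ift_fix (c0 := c0) (z0 := β) (n := 1) (by simpa using hβ) hβne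
  set b0 := z0 + ch N X wm with hb0def
  have hdb : dq c0 M b0 ≠ 0 := by
    intro hd
    obtain ⟨i, hi, hi0⟩ := dq_eq_zero hd
    obtain ⟨d, rfl⟩ := Nat.exists_eq_add_of_le' hi.le
    rw [Function.iterate_add_apply, hi0] at hb0
    have h1 : xi c0 d = β := hb0
    exact hcrit d (by rw [h1, fix_iter_ge hβ])
  obtain ⟨bc, bc1, bc2, bc3, -⟩ := ift (G := fun u : ℂ × ℂ => (fq u.1)^[M] u.2 - bt u.1) (u := (c0, b0)) (d := dq c0 M b0)
    ((contDiff_iter2 M).contDiffAt.sub (bt1.contDiffAt.comp ((c0, b0) : ℂ × ℂ) contDiffAt_fst))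
    (by simp [bt2, hb0]) (by simpa using (hasDerivAt_iter c0 M b0).sub_const (bt c0)) hdb
  simp only at bc1 bc2 bc3
  have hxian : AnalyticAt ℂ (fun c => xi c j0 - φ c) c0 :=
    ((differentiable_xi j0).analyticAt c0).sub h.an
  have hreg : ∀ {ε : ℝ} {w : ℂ}, (ε = 1 ∨ ε = -1) → Sec ε E w → w ≠ 0 ∧ w.im ≤ ‖w‖ / 2 := by
    intro ε w hε hs
    refine ⟨norm_pos_iff.1 ?_, hs.reg hε hE0.le⟩
    have := hs.norm hε
    linarith [abs_nonneg w.im]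
  obtain ⟨omp, p1, p2, p3⟩ := lift_ch hN hS.hX (hreg (Or.inl rfl) hwp).1 (hreg (Or.inl rfl) hwp).2 hxian
    (by rw [hxi0]; ring)
  obtain ⟨omm, m1, m2, m3⟩ := lift_ch hN hS.hX (hreg (Or.inr rfl) hwm).1 (hreg (Or.inr rfl) hwm).2 (bc1.sub h.an)
    (by simp [bc2, hb0def, ← hz0])
  intro η hη
  -- shadowing constants
  have hnc : ∀ i ∈ Finset.range (L + M + 1), ∃ η' > 0, ∀ᶠ c in 𝓝 c0, ∀ y ∈ S, ∀ z, dist z y < η' →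
      dist ((fq c)^[i] z) ((fq c0)^[i] y) < η := fun i _ => near_compact hScomp c0 i hη
  choose! η' hη' hev' using hnc
  obtain ⟨η1, hη1, hηlebd⟩ : ∃ η1 > 0, ∀ i ∈ Finset.range (L + M + 1), η1 ≤ η' i := by
    refine ⟨(Finset.range (L + M + 1)).inf' (by simp) η', ?_, fun i hi => Finset.inf'_le _ hi⟩
    rw [gt_iff_lt, Finset.lt_inf'_iff]
    exact hη'
  have hevS : ∀ᶠ c in 𝓝 c0, ∀ i ∈ Finset.range (L + M + 1), ∀ y ∈ S, ∀ z, dist z y < η1 →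
      dist ((fq c)^[i] z) ((fq c0)^[i] y) < η := by
    rw [Finset.eventually_all]
    intro i hi
    filter_upwards [hev' i hi] with c hc y hy z hz
    exact hc y hy z (hz.trans_le (hηlebd i hi))
  have sh1 := shadow (Φ := loc φ L) (X := X) hN hE3.le p2 h.an.continuousAt (o4 omp p1 p2) hη1
  have sh2 := shadow (Φ := Ψ) (X := X) hN hE3.le m2 h.an.continuousAt (u4 omm m1 m2) hη1
  have hj0 : ∀ᶠ c in 𝓝 c0, ∀ j ∈ Finset.range j0, dist (xi c j) (xi c0 j) < η := by
    rw [Finset.eventually_all]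
    intro j _
    exact (differentiable_xi j).continuous.continuousAt.eventually (Metric.ball_mem_nhds _ hη)
  have hbtβ : ∀ᶠ c in 𝓝 c0, 1 < ‖2 * bt c‖ := by
    refine (continuousAt_const (y := (1:ℝ))).eventually_lt (bt1.continuousAt.const_mul 2).norm ?_
    rw [bt2]; exact hβ1
  have hfreq := hgate omp omm p1 m1 (by rw [p2]; exact hwp.mono e4) (by rw [m2]; exact hwm.mono e4)
  refine (hfreq.and_eventually (hevS.and (sh1.and (sh2.and (hj0.and (hbtβ.and (bt3.and (bc3.and (p3.and (m3.and
    (Metric.ball_mem_nhds c0 hr))))))))))).mono ?_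
  rintro c ⟨⟨m, hmeet, hg1, hg2⟩, hS', s1, s2, hj, hb1, hbf, hbM, hp, hm, hcr⟩
  rw [Function.iterate_one] at hbf
  set xc : ℕ → ℂ := fun k => ch N X ((tm (loc φ L) N X c)^[k] (omp c)) with hxc
  set yc : ℕ → ℂ := fun k => ch N X ((tm Ψ N X c)^[k] (omm c)) with hyc
  have f1 : ∀ k ≤ m, xi c (k * L + j0) = φ c + xc k := by
    intro k
    induction k with
    | zero => intro _; rw [hxc]; simp [hp]
    | succ k ih =>
      intro hk
      have h1 : xc (k+1) = (fq c)^[L] (φ c + xc k) - φ c := (hg1 k (by omega)).2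
      rw [h1, ← ih (by omega), xi_add, show (k+1) * L + j0 = L + (k * L + j0) by ring]; ring
  have f2 : ∀ k ≤ m, (fq c)^[k * L] (φ c + yc k) = bc c := by
    intro k
    induction k with
    | zero => intro _; rw [hyc]; simp [hm]
    | succ k ih =>
      intro hk
      have h1 : yc (k+1) = Ψ c (yc k) := (hg2 k (by omega)).2
      have h2 := hinv c hcr (yc k) (by
        rw [mem_ball_zero_iff]
        refine hch _ (le_trans ?_ (hg2 k (by omega)).1)
        have : (0:ℝ) ≤ k := k.cast_nonneg
        linarith)
      rw [← h1] at h2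
      have h3 : (fq c)^[L] (φ c + yc (k+1)) = φ c + yc k := by
        have : (fq c)^[L] (φ c + yc (k+1)) - φ c = yc k := h2
        rw [← this]; ring
      rw [show (k+1) * L = k * L + L by ring, Function.iterate_add_apply, h3, ih (by omega)]
  have hxy : xc m = yc m := by simp only [hxc, hyc]; rw [hmeet]
  have f3 : ∀ k ≤ m, xi c (k * L + m * L + j0) = φ c + yc (m - k) := by
    intro k
    induction k with
    | zero => intro _; simp [f1 m le_rfl, hxy]
    | succ k ih =>
      intro hk
      have h1 : yc (m - (k+1) + 1) = Ψ c (yc (m - (k+1))) := (hg2 (m - (k+1)) (by omega)).2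
      have h2 := hinv c hcr (yc (m - (k+1))) (by
        rw [mem_ball_zero_iff]
        refine hch _ (le_trans ?_ (hg2 (m - (k+1)) (by omega)).1)
        have : (0:ℝ) ≤ ((m - (k+1) : ℕ) : ℝ) := Nat.cast_nonneg _
        linarith)
      rw [← h1, show m - (k+1) + 1 = m - k by omega] at h2
      have h3 : (fq c)^[L] (φ c + yc (m - k)) - φ c = yc (m - (k+1)) := h2
      rw [← h3, ← ih (by omega), xi_add, show (k+1) * L + m * L + j0 = L + (k * L + m * L + j0) by ring]; ring
  have f4 : xi c (m * L + m * L + j0) = bc c := by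
    rw [f3 m le_rfl]
    simp [hyc, hm]
  have f5 : xi c (M + (m * L + m * L + j0)) = bt c := by
    rw [← xi_add, f4]; exact sub_eq_zero.1 hbM
  refine ⟨⟨bt c, _, hbf, hb1, f5⟩, ?_⟩
  -- shadowing
  have close : ∀ i < L + M + 1, ∀ z, (∃ y ∈ S, dist z y < η1) → ∃ y ∈ Qs, dist ((fq c)^[i] z) y < η := by
    rintro i hi z ⟨y, hy, hd⟩
    exact ⟨_, hQmem i hi y hy, hS' i (Finset.mem_range.2 hi) y hy z hd⟩
  have n1 : ∀ k ≤ m, ∃ y ∈ S, dist (φ c + xc k) y < η1 := by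
    intro k hk
    obtain ⟨y, hy, hd⟩ := s1 k (hg1 k hk).1
    exact ⟨y, Or.inl hy, hd⟩
  have n2 : ∀ k ≤ m, ∃ y ∈ S, dist (φ c + yc k) y < η1 := by
    intro k hk
    obtain ⟨y, hy, hd⟩ := s2 k (hg2 k hk).1
    exact ⟨y, Or.inr hy, hd⟩
  have hLp : 0 < L := Nat.pos_of_ne_zero hL0
  intro j
  rcases lt_or_ge j j0 with hjj | hjj
  · exact ⟨_, Or.inr ⟨j, by simpa using hjj, rfl⟩, hj j (Finset.mem_range.2 hjj)⟩
  obtain ⟨j1, rfl⟩ := Nat.exists_eq_add_of_le' hjj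
  have hmod := Nat.mod_add_div j1 L
  have hlt := Nat.mod_lt j1 hLp
  rcases lt_or_ge j1 (m * L) with h1 | h1
  · have hk : j1 / L ≤ m := (Nat.div_lt_of_lt_mul (by rw [mul_comm]; exact h1)).le
    have := close (j1 % L) (by omega) _ (n1 (j1 / L) hk)
    rwa [← f1 _ hk, xi_add, show j1 % L + (j1 / L * L + j0) = j1 + j0 by linarith [mul_comm L (j1/L)]] at this
  obtain ⟨j2, rfl⟩ := Nat.exists_eq_add_of_le' h1
  have hmod := Nat.mod_add_div j2 L
  have hlt := Nat.mod_lt j2 hLp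
  rcases lt_or_ge j2 (m * L) with h2 | h2
  · have hk : j2 / L ≤ m := (Nat.div_lt_of_lt_mul (by rw [mul_comm]; exact h2)).le
    have := close (j2 % L) (by omega) _ (n2 (m - j2 / L) (Nat.sub_le _ _))
    rwa [← f3 _ hk, xi_add, show j2 % L + (j2 / L * L + m * L + j0) = j2 + m * L + j0 by linarith [mul_comm L (j2/L)]] at this
  obtain ⟨j3, rfl⟩ := Nat.exists_eq_add_of_le' h2
  have hbc0 : φ c + yc 0 = bc c := by simpa using f2 0 (by omega)
  have hn := n2 0 (by omega)
  rw [hbc0, ← f4] at hn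
  rcases le_or_gt j3 M with h3 | h3
  · have := close j3 (by omega) _ hn
    rwa [xi_add, ← add_assoc, ← add_assoc] at this
  · have := close M (by omega) _ hn
    rw [xi_add, f5] at this
    obtain ⟨d, rfl⟩ := Nat.exists_eq_add_of_le' h3.le
    rw [show d + M + m * L + m * L + j0 = d + (M + (m * L + m * L + j0)) by ring, ← xi_add, f5, fix_iter_ge hbf]
    exact this

end Shi

open Complex Set Filter Topology Metric
open scoped ContDiff
namespace Shi

def Sh (Qs : Set ℂ) (η : ℝ) (c : ℂ) : Prop := ∀ j, ∃ y ∈ Qs, dist (xi c j) y < η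

theorem Sh.mono {Qs : Set ℂ} {η η' : ℝ} {c : ℂ} (h : Sh Qs η c) (hη : η ≤ η') : Sh Qs η' c := by
  intro j
  obtain ⟨y, hy, h1⟩ := h j
  exact ⟨y, hy, lt_of_lt_of_le h1 hη⟩

/-- comparison relation between base points of inverse branches -/
def Rel (Qs : Set ℂ) (w w' : ℂ) : Prop := ∃ C ≥ (1:ℝ), ∃ η > 0, ∀ c n z, Sh Qs η c →
  dist ((fq c)^[n] z) w < η → ∀ w'', dist w'' w' < η → ∃ z', (fq c)^[n] z' = w'' ∧
    ‖dq c n z‖ ≤ C * ‖dq c n z'‖ ∧ ‖dq c n z'‖ ≤ C * ‖dq c n z‖ ∧ ‖z' - z‖ * ‖dq c n z‖ ≤ C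

theorem Rel.local {Qs : Set ℂ} {w w' : ℂ} {d : ℝ} (hd : 0 < d) (hQ : ∀ y ∈ Qs, d ≤ dist y w)
    (hw : dist w' w < d / 256) : Rel Qs w w' := by
  obtain ⟨K, hK, hk⟩ := koebe
  refine ⟨K * (1 + d), by nlinarith, d / 256, by positivity, ?_⟩
  intro c n z hS hz w'' hw''
  set u := (fq c)^[n] z with hu
  have hav : ∀ s ∈ ball u (d/2), ∀ j, 1 ≤ j → j ≤ n → s ≠ xi c j := by
    rintro s hs j - - rfl
    obtain ⟨y, hy, h1⟩ := hS j
    have h2 := hQ y hy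
    rw [mem_ball] at hs
    have h3 := dist_triangle4 y (xi c j) u w
    rw [dist_comm y (xi c j)] at h3
    linarith
  obtain ⟨g, hg, hgu, hgr, hgi, hgd⟩ := inv_branch n hav hu.symm
  have hd2 : 0 < d / 2 := by positivity
  have hne : ∀ x ∈ ball u (d/2), deriv g x ≠ 0 := by
    intro x hx h0
    have := hgd x hx
    rw [h0] at this; simp at this
  obtain ⟨-, hk2, hk3⟩ := hk u (d/2) g hd2 hg hgi hne
  have hdu : dist w'' u < d / 32 := by
    have := dist_triangle4 w'' w' w u
    rw [dist_comm w u] at this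
    linarith
  have hm : w'' ∈ ball u (d/2) := by rw [mem_ball]; linarith
  have e1 := hgd u (mem_ball_self hd2)
  have e2 := hgd w'' hm
  rw [hgu] at e1
  have e1' : ‖dq c n z‖ * ‖deriv g u‖ = 1 := by rw [← norm_mul, e1, norm_one]
  have e2' : ‖dq c n (g w'')‖ * ‖deriv g w''‖ = 1 := by rw [← norm_mul, e2, norm_one]
  obtain ⟨h4, h5⟩ := hk3 w'' (by rw [mem_ball]; linarith)
  have h6 := hk2 w'' (by rw [mem_ball]; linarith)
  have a1 : 0 ≤ ‖dq c n z‖ := norm_nonneg _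
  have a2 : 0 ≤ ‖dq c n (g w'')‖ := norm_nonneg _
  have b1 : 0 < ‖deriv g u‖ := norm_pos_iff.mpr (hne _ (mem_ball_self hd2))
  have b2 : 0 < ‖deriv g w''‖ := norm_pos_iff.mpr (hne _ hm)
  have hKd : K ≤ K * (1 + d) := by nlinarith
  refine ⟨g w'', hgr _ hm, ?_, ?_, ?_⟩
  · calc ‖dq c n z‖ = ‖dq c n z‖ * (‖dq c n (g w'')‖ * ‖deriv g w''‖) := by rw [e2', mul_one]
      _ ≤ ‖dq c n z‖ * (‖dq c n (g w'')‖ * (K * ‖deriv g u‖)) := by gcongr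
      _ = K * ‖dq c n (g w'')‖ * (‖dq c n z‖ * ‖deriv g u‖) := by ring
      _ = K * ‖dq c n (g w'')‖ := by rw [e1', mul_one]
      _ ≤ _ := by gcongr
  · calc ‖dq c n (g w'')‖ = ‖dq c n (g w'')‖ * (‖dq c n z‖ * ‖deriv g u‖) := by rw [e1', mul_one]
      _ ≤ ‖dq c n (g w'')‖ * (‖dq c n z‖ * (K * ‖deriv g w''‖)) := by gcongr
      _ = K * ‖dq c n z‖ * (‖dq c n (g w'')‖ * ‖deriv g w''‖) := by ring
      _ = K * ‖dq c n z‖ := by rw [e2', mul_one]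
      _ ≤ _ := by gcongr
  · rw [hgu] at h6
    calc ‖g w'' - z‖ * ‖dq c n z‖ ≤ (K * (d/2) * ‖deriv g u‖) * ‖dq c n z‖ := by gcongr
      _ = K * (d/2) * (‖dq c n z‖ * ‖deriv g u‖) := by ring
      _ = K * (d/2) := by rw [e1', mul_one]
      _ ≤ _ := by nlinarith

theorem Rel.trans {Qs : Set ℂ} {w₁ w₂ w₃ : ℂ} (h12 : Rel Qs w₁ w₂) (h23 : Rel Qs w₂ w₃) :
    Rel Qs w₁ w₃ := by
  obtain ⟨C, hC, η, hη, h⟩ := h12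
  obtain ⟨D, hD, θ, hθ, k⟩ := h23
  refine ⟨C + C * D, by nlinarith, min η θ, lt_min hη hθ, ?_⟩
  intro c n z hS hz w'' hw''
  obtain ⟨z', e1, e2, e3, e4⟩ := h c n z (hS.mono (min_le_left _ _)) (lt_of_lt_of_le hz (min_le_left _ _))
    w₂ (by simpa using hη)
  obtain ⟨z'', f1, f2, f3, f4⟩ := k c n z' (hS.mono (min_le_right _ _)) (by rw [e1]; simpa using hθ)
    w'' (lt_of_lt_of_le hw'' (min_le_right _ _))
  have a1 : 0 ≤ ‖dq c n z‖ := norm_nonneg _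
  have a2 : 0 ≤ ‖dq c n z''‖ := norm_nonneg _
  refine ⟨z'', f1, ?_, ?_, ?_⟩
  · calc ‖dq c n z‖ ≤ C * ‖dq c n z'‖ := e2
      _ ≤ C * (D * ‖dq c n z''‖) := by gcongr
      _ ≤ _ := by nlinarith [mul_nonneg (by linarith : (0:ℝ) ≤ C) a2]
  · calc ‖dq c n z''‖ ≤ D * ‖dq c n z'‖ := f3
      _ ≤ D * (C * ‖dq c n z‖) := by gcongr
      _ ≤ _ := by nlinarith [mul_nonneg (by linarith : (0:ℝ) ≤ C) a1]
  · calc ‖z'' - z‖ * ‖dq c n z‖ ≤ (‖z'' - z'‖ + ‖z' - z‖) * ‖dq c n z‖ := by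
          gcongr
          calc ‖z'' - z‖ = ‖(z'' - z') + (z' - z)‖ := by ring_nf
            _ ≤ _ := norm_add_le _ _
      _ = ‖z' - z‖ * ‖dq c n z‖ + ‖z'' - z'‖ * ‖dq c n z‖ := by ring
      _ ≤ C + ‖z'' - z'‖ * (C * ‖dq c n z'‖) := by gcongr
      _ = C + C * (‖z'' - z'‖ * ‖dq c n z'‖) := by ring
      _ ≤ _ := by gcongr

theorem Rel.all {Qs : Set ℂ} (hQc : IsClosed Qs) (hQ : Qs.Countable) {w w' : ℂ} (hw : w ∉ Qs)
    (hw' : w' ∉ Qs) : Rel Qs w w' := by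
  have hcon : IsPreconnected Qsᶜ :=
    (Set.Countable.isConnected_compl_of_one_lt_rank (by simp) hQ).isPreconnected
  refine hcon.induction₂' (Rel Qs) ?_ (fun x y z _ _ _ h1 h2 => h1.trans h2) hw hw'
  intro x hx
  obtain ⟨d, hd, hdb⟩ := Metric.isOpen_iff.mp hQc.isOpen_compl x hx
  have hQd : ∀ y ∈ Qs, d ≤ dist y x := by
    intro y hy
    by_contra hlt
    push Not at hlt
    exact hdb (mem_ball.mpr hlt) hy
  apply eventually_nhdsWithin_of_eventually_nhds
  filter_upwards [Metric.ball_mem_nhds x (by positivity : 0 < d / 512)] with y hy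
  rw [mem_ball] at hy
  refine ⟨Rel.local hd hQd (by linarith), Rel.local (d := d/2) (by positivity) ?_ ?_⟩
  · intro q hq
    have := hQd q hq
    have h2 := dist_triangle q y x
    linarith
  · rw [dist_comm]; linarith

theorem transfer {Qs : Set ℂ} (hQc : IsClosed Qs) (hQ : Qs.Countable)
    (hQb : ∀ y ∈ Qs, ‖y‖ < 3) {a0 : ℂ} (ha : a0 ∉ Qs) :
    ∃ C ≥ (1:ℝ), ∃ η > 0, ∀ c n z a, Sh Qs η c → 3 ≤ ‖(fq c)^[n] z‖ → ‖(fq c)^[n] z‖ ≤ 12 →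
      dist a a0 < η → ∃ z', (fq c)^[n] z' = a ∧ ‖dq c n z‖ ≤ C * ‖dq c n z'‖ ∧
      ‖dq c n z'‖ ≤ C * ‖dq c n z‖ ∧ ‖z' - z‖ * ‖dq c n z‖ ≤ C := by
  have hA : IsCompact (closedBall (0:ℂ) 12 ∩ {w | 3 ≤ ‖w‖}) :=
    (isCompact_closedBall 0 12).inter_right (isClosed_le continuous_const continuous_norm)
  have key : ∃ C ≥ (1:ℝ), ∃ η > 0, ∀ c n z, Sh Qs η c →
      (fq c)^[n] z ∈ closedBall (0:ℂ) 12 ∩ {w | 3 ≤ ‖w‖} → ∀ a,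
      dist a a0 < η → ∃ z', (fq c)^[n] z' = a ∧ ‖dq c n z‖ ≤ C * ‖dq c n z'‖ ∧
      ‖dq c n z'‖ ≤ C * ‖dq c n z‖ ∧ ‖z' - z‖ * ‖dq c n z‖ ≤ C := by
    refine hA.induction_on (p := fun S => ∃ C ≥ (1:ℝ), ∃ η > 0, ∀ c n z, Sh Qs η c →
      (fq c)^[n] z ∈ S → ∀ a,
      dist a a0 < η → ∃ z', (fq c)^[n] z' = a ∧ ‖dq c n z‖ ≤ C * ‖dq c n z'‖ ∧
      ‖dq c n z'‖ ≤ C * ‖dq c n z‖ ∧ ‖z' - z‖ * ‖dq c n z‖ ≤ C) ?_ ?_ ?_ ?_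
    · exact ⟨1, le_rfl, 1, one_pos, fun c n z _ h => absurd h (notMem_empty _)⟩
    · rintro s t hst ⟨C, hC, η, hη, h⟩
      exact ⟨C, hC, η, hη, fun c n z hS hz => h c n z hS (hst hz)⟩
    · rintro s t ⟨C, hC, η, hη, h⟩ ⟨D, hD, θ, hθ, k⟩
      refine ⟨max C D, le_max_of_le_left hC, min η θ, lt_min hη hθ, ?_⟩
      rintro c n z hS (hz | hz) a ha
      · obtain ⟨z', e1, e2, e3, e4⟩ := h c n z (hS.mono (min_le_left _ _)) hz a
          (lt_of_lt_of_le ha (min_le_left _ _))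
        refine ⟨z', e1, e2.trans ?_, e3.trans ?_, e4.trans (le_max_left _ _)⟩ <;>
          exact mul_le_mul_of_nonneg_right (le_max_left _ _) (norm_nonneg _)
      · obtain ⟨z', e1, e2, e3, e4⟩ := k c n z (hS.mono (min_le_right _ _)) hz a
          (lt_of_lt_of_le ha (min_le_right _ _))
        refine ⟨z', e1, e2.trans ?_, e3.trans ?_, e4.trans (le_max_right _ _)⟩ <;>
          exact mul_le_mul_of_nonneg_right (le_max_right _ _) (norm_nonneg _)
    · rintro w ⟨-, hw⟩
      have hwQ : w ∉ Qs := fun h => by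
        have := hQb w h
        have h3 : 3 ≤ ‖w‖ := hw
        linarith
      obtain ⟨C, hC, η, hη, h⟩ := Rel.all hQc hQ hwQ ha
      exact ⟨ball w η, mem_nhdsWithin_of_mem_nhds (ball_mem_nhds w hη), C, hC, η, hη,
        fun c n z hS hz a ha => h c n z hS hz a ha⟩
  obtain ⟨C, hC, η, hη, h⟩ := key
  refine ⟨C, hC, η, hη, fun c n z a hS h1 h2 ha => h c n z hS ⟨by simpa using h2, h1⟩ a ha⟩

/-- `stepB_local` with bounded shadow set. -/
theorem stepB_local' {c0 : ℂ} {p q : ℕ} {φ : ℂ → ℂ} (h : Par c0 p q φ) (hc : c0 ≠ 1/4) :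
    ∃ Qs : Set ℂ, IsClosed Qs ∧ Qs.Countable ∧ -φ c0 ∉ Qs ∧ (∀ y ∈ Qs, ‖y‖ < 3) ∧
      ∀ η > 0, ∃ᶠ c in 𝓝 c0, Mis c ∧ Sh Qs η c := by
  obtain ⟨Qs, h1, h2, h3, h4⟩ := stepB_local h hc
  refine ⟨Qs ∩ closedBall 0 (11/4), h1.isClosed.inter isClosed_closedBall,
    h2.mono inter_subset_left, fun h => h3 h.1, ?_, ?_⟩
  · rintro y ⟨-, hy⟩
    have : ‖y‖ ≤ 11/4 := by simpa using hy
    linarith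
  · intro η hη
    have hev : ∀ᶠ c in 𝓝 c0, ‖c‖ < 3 :=
      (continuous_norm.tendsto c0).eventually (gt_mem_nhds h.hc)
    refine ((h4 (min η (1/4)) (by positivity)).and_eventually hev).mono ?_
    rintro c ⟨⟨hM, hS⟩, hc3⟩
    refine ⟨hM, fun j => ?_⟩
    obtain ⟨y, hy, hd⟩ := hS j
    refine ⟨y, ⟨hy, ?_⟩, lt_of_lt_of_le hd (min_le_left _ _)⟩
    have hK : ‖xi c j‖ < 5/2 := by
      obtain ⟨β, l, hβ, -, hl⟩ := hM
      have h0 : (0:ℂ) ∈ Kset c := by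
        exact mem_K_of_eventually_fixed (n := l) hc3.le hβ hl
      exact (mem_K_iff hc3.le).mp h0 j
    have hd' := lt_of_lt_of_le hd (min_le_right _ _)
    rw [mem_closedBall, dist_zero_right]
    have : ‖y‖ ≤ ‖xi c j‖ + dist (xi c j) y := by
      rw [dist_comm, dist_eq_norm]
      calc ‖y‖ = ‖xi c j + (y - xi c j)‖ := by ring_nf
        _ ≤ _ := norm_add_le _ _
    linarith

end Shi

open Complex Set Filter Topology Metric
open scoped ContDiff
namespace Shi

theorem dyadic_class {T x : ℝ} (hx : 0 < x) (hxT : x ≤ T) :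
    ∃ k : ℕ, T / 2^(k+1) < x ∧ x ≤ T / 2^k := by
  obtain ⟨k, h1, h2⟩ := exists_nat_pow_near (x := T / x) (y := 2) (by rwa [one_le_div hx]) one_lt_two
  refine ⟨k, ?_, ?_⟩
  · rw [div_lt_iff₀ hx] at h2
    rw [div_lt_iff₀ (by positivity)]; linarith
  · rw [le_div_iff₀ hx] at h1
    rw [le_div_iff₀ (by positivity)]; linarith

theorem dyadic_sum {ι : Type*} [DecidableEq ι] {s T A : ℝ} (hs : 0 < s) (hs2 : s < 2) (hT : 0 < T) (hA : 0 ≤ A)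
    (t : ι → ℝ) (F : Finset ι) (ht : ∀ i ∈ F, 0 < t i ∧ t i ≤ T)
    (hG : ∀ k : ℕ, ∀ G ⊆ F, (∀ i ∈ G, T / 2^(k+1) < t i ∧ t i ≤ T / 2^k) →
      (G.card : ℝ) ≤ A * (2^(k+1) / T) ^ s) :
    ∑ i ∈ F, t i ^ 2 ≤ A * 2 ^ s * T ^ (2 - s) / (1 - 2 ^ (s - 2)) := by
  have hex : ∀ i, ∃ k : ℕ, i ∈ F → T / 2^(k+1) < t i ∧ t i ≤ T / 2^k := by
    intro i
    by_cases hi : i ∈ F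
    · obtain ⟨k, hk⟩ := dyadic_class (ht i hi).1 (ht i hi).2
      exact ⟨k, fun _ => hk⟩
    · exact ⟨0, fun h => absurd h hi⟩
  choose κ hκ using hex
  have hx1 : (2:ℝ) ^ (s - 2) < 1 := Real.rpow_lt_one_of_one_lt_of_neg one_lt_two (by linarith)
  have hx0 : 0 < (2:ℝ) ^ (s - 2) := by positivity
  rw [← Finset.sum_fiberwise_of_maps_to (s := F) (t := F.image κ) (g := κ)
    (fun i hi => Finset.mem_image_of_mem κ hi)]
  have hterm : ∀ k : ℕ, ∑ i ∈ F with κ i = k, t i ^ 2 ≤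
      A * 2 ^ s * T ^ (2 - s) * ((2:ℝ) ^ (s - 2)) ^ k := by
    intro k
    have h1 := hG k (F.filter (fun i => κ i = k)) (Finset.filter_subset _ _) (by
      intro i hi
      rw [Finset.mem_filter] at hi
      have := hκ i hi.1
      rwa [hi.2] at this)
    have h2 : ∑ i ∈ F with κ i = k, t i ^ 2 ≤ ((F.filter (fun i => κ i = k)).card : ℝ) * (T / 2^k)^2 := by
      rw [← nsmul_eq_mul]
      apply Finset.sum_le_card_nsmul
      intro i hi
      rw [Finset.mem_filter] at hi
      have := hκ i hi.1
      rw [hi.2] at this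
      have := (ht i hi.1).1
      gcongr
      exact (by assumption : _ ∧ _).2
    refine h2.trans ?_
    refine (mul_le_mul_of_nonneg_right h1 (by positivity)).trans (le_of_eq ?_)
    have e1 : (2 ^ (k+1) / T : ℝ) ^ s = 2 ^ s * ((2:ℝ) ^ s) ^ k * (T ^ s)⁻¹ := by
      rw [Real.div_rpow (by positivity) hT.le, ← Real.rpow_natCast, ← Real.rpow_mul (by norm_num),
        mul_comm ((k+1 : ℕ) : ℝ) s, Real.rpow_mul (by norm_num), Real.rpow_natCast, pow_succ]
      ring
    have e2 : T ^ (2 - s) = T^2 * (T ^ s)⁻¹ := by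
      rw [Real.rpow_sub hT, Real.rpow_two]; rfl
    have e3 : (2:ℝ) ^ (s - 2) = 2 ^ s / 4 := by
      rw [Real.rpow_sub (by norm_num), Real.rpow_two]; norm_num
    rw [e1, e2, e3, div_pow, div_pow, ← pow_mul, mul_comm k 2, pow_mul]
    norm_num
    ring
  calc _ ≤ ∑ k ∈ F.image κ, A * 2 ^ s * T ^ (2 - s) * ((2:ℝ) ^ (s - 2)) ^ k :=
        Finset.sum_le_sum fun k _ => hterm k
    _ = A * 2 ^ s * T ^ (2 - s) * ∑ k ∈ F.image κ, ((2:ℝ) ^ (s - 2)) ^ k := by rw [Finset.mul_sum]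
    _ ≤ A * 2 ^ s * T ^ (2 - s) * (1 - 2 ^ (s - 2))⁻¹ := by
        gcongr
        rw [← tsum_geometric_of_lt_one hx0.le hx1]
        exact (summable_geometric_of_lt_one hx0.le hx1).sum_le_tsum _ (fun i _ => by positivity)
    _ = _ := by rw [div_eq_mul_inv]

open MeasureTheory in
theorem count_bound {s T A B r : ℝ} (hs : 0 < s) (hs2 : s < 2) (hT : 0 < T) (hA : 0 ≤ A) (hB : 0 < B)
    (hr : 0 < r) {X : Set ℂ} {a : ℂ} (t : ℂ → ℝ) (ht : ∀ z ∈ X, 0 < t z ∧ t z ≤ T)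
    (hv : volume (closedBall a r) ≤ volume X)
    (hG : ∀ k : ℕ, ∀ G : Finset ℂ, (G : Set ℂ) ⊆ X →
      ((G : Set ℂ).PairwiseDisjoint fun z => closedBall z (B * t z)) →
      (∀ i ∈ G, T / 2^(k+1) < t i ∧ t i ≤ T / 2^k) → (G.card : ℝ) ≤ A * (2^(k+1) / T) ^ s) :
    r ^ 2 ≤ 25 * B ^ 2 * (A * 2 ^ s * T ^ (2 - s) / (1 - 2 ^ (s - 2))) := by
  obtain ⟨u, huX, hud, hcov⟩ := Vitali.exists_disjoint_subfamily_covering_enlargement_closedBall X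
    (fun z : ℂ => z) (fun z => B * t z) (B * T) (fun z hz => by have := (ht z hz).2; gcongr) 5 (by norm_num)
  set S := A * 2 ^ s * T ^ (2 - s) / (1 - 2 ^ (s - 2)) with hS
  have hx1 : (2:ℝ) ^ (s - 2) < 1 := Real.rpow_lt_one_of_one_lt_of_neg one_lt_two (by linarith)
  have hS0 : 0 ≤ S := by
    rw [hS]
    apply div_nonneg (by positivity); linarith
  have hcount : u.Countable := by
    refine hud.countable_of_nonempty_interior (fun z hz => ?_)
    refine ⟨z, ball_subset_interior_closedBall (mem_ball_self ?_)⟩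
    have := (ht z (huX hz)).1
    positivity
  have hsub : X ⊆ ⋃ b ∈ u, closedBall b (5 * (B * t b)) := by
    intro x hx
    obtain ⟨b, hb, hsb⟩ := hcov x hx
    refine mem_biUnion hb (hsb (mem_closedBall_self ?_))
    have := (ht x hx).1
    positivity
  have h1 : volume X ≤ ∑' b : u, volume (closedBall (b:ℂ) (5 * (B * t b))) :=
    (measure_mono hsub).trans (measure_biUnion_le _ hcount _)
  have h2 : ∑' b : u, volume (closedBall (b:ℂ) (5 * (B * t b))) ≤
      ENNReal.ofReal (25 * B^2 * S) * NNReal.pi := by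
    rw [ENNReal.tsum_eq_iSup_sum]
    refine iSup_le fun F => ?_
    simp_rw [Complex.volume_closedBall]
    rw [← Finset.sum_mul]
    gcongr
    have e : ∀ b ∈ F, ENNReal.ofReal (5 * (B * t (b:ℂ))) ^ 2 = ENNReal.ofReal (25 * B^2 * t (b:ℂ)^2) := by
      intro b _
      have := (ht b (huX b.2)).1
      rw [← ENNReal.ofReal_pow (by positivity)]
      congr 1; ring
    rw [Finset.sum_congr rfl e, ← ENNReal.ofReal_sum_of_nonneg (fun b _ => by positivity)]
    apply ENNReal.ofReal_le_ofReal
    rw [← Finset.mul_sum]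
    gcongr
    have hsum : ∑ b ∈ F, t (b:ℂ)^2 = ∑ z ∈ F.map (Function.Embedding.subtype _), t z ^ 2 := by
      rw [Finset.sum_map]; rfl
    rw [hsum]
    have hFu : ∀ z ∈ F.map (Function.Embedding.subtype (· ∈ u)), z ∈ u := by
      intro z hz
      rw [Finset.mem_map] at hz
      obtain ⟨b, -, rfl⟩ := hz
      exact b.2
    classical
    refine dyadic_sum hs hs2 hT hA t _ (fun z hz => ht z (huX (hFu z hz))) ?_
    intro k G hGF hcl
    have hGu : (G : Set ℂ) ⊆ u := fun z hz => hFu z (hGF hz)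
    exact hG k G (hGu.trans huX) (hud.subset hGu) hcl
  have h3 := (hv.trans h1).trans h2
  rw [Complex.volume_closedBall, ENNReal.mul_le_mul_iff_left (by simp [NNReal.pi_ne_zero]) (by simp),
    ← ENNReal.ofReal_pow hr.le, ENNReal.ofReal_le_ofReal_iff (by positivity)] at h3
  exact h3

end Shi

open Complex Set Filter Topology Metric
open scoped ContDiff
namespace Shi

theorem Par.return_small {c0 : ℂ} {p q : ℕ} {φ : ℂ → ℂ} (h : Par c0 p q φ) :
    ∃ C3 > (0:ℝ), ∃ r0 > (0:ℝ), ∀ ρ, 0 < ρ → ρ < r0 → ∀ᶠ c in 𝓝 c0, ∀ z ∈ closedBall (φ c) ρ,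
      ‖(fq c)^[p*q] z - z‖ ≤ C3 * ρ^(q+1) := by
  obtain ⟨N, hN, A, hA, C, hC, r, hr, hn⟩ := h.normal
  refine ⟨(‖A‖ + C) * 2^(q+1) + 1, by positivity, min (r/2) (1/2), by positivity, ?_⟩
  intro ρ hρ hρr
  have hρ1 : 2 * ρ < r := by have := lt_of_lt_of_le hρr (min_le_left _ _); linarith
  have hρ2 : 2 * ρ < 1 := by have := lt_of_lt_of_le hρr (min_le_right _ _); linarith
  have hcont : Continuous fun x : ℂ × ℂ => ‖(fq x.1)^[p*q] x.2 - x.2‖ :=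
    ((continuous_iter2 (p*q)).sub continuous_snd).norm
  have hev := eventually_lt_of_compact (isCompact_closedBall (φ c0) (2*ρ)) hcont
    (continuous_const (y := ((‖A‖ + C) * 2^(q+1) + 1) * ρ^(q+1))) (c := c0) (by
      intro z hz
      rw [mem_closedBall, dist_eq_norm] at hz
      set x := z - φ c0 with hx
      have h1 := hn x (by rw [mem_ball_zero_iff]; linarith)
      have e : (fq c0)^[p*q] z - z = (loc φ (p*q) c0 x - x - A*x^(N+1)) + A*x^(N+1) := by
        simp only [loc, hx]
        rw [add_sub_cancel]; ring
      show ‖(fq c0)^[p*q] z - z‖ < _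
      rw [e]
      have hx1 : ‖x‖ ≤ 1 := by linarith
      have p1 : ‖x‖^(N+2) ≤ ‖x‖^(q+1) := pow_le_pow_of_le_one (norm_nonneg _) hx1 (by omega)
      have p2 : ‖x‖^(N+1) ≤ ‖x‖^(q+1) := pow_le_pow_of_le_one (norm_nonneg _) hx1 (by omega)
      have p3 : ‖x‖^(q+1) ≤ (2*ρ)^(q+1) := pow_le_pow_left₀ (norm_nonneg _) hz _
      calc _ ≤ C*‖x‖^(N+2) + ‖A‖*‖x‖^(N+1) := by
            refine (norm_add_le _ _).trans (add_le_add h1 ?_)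
            rw [norm_mul, norm_pow]
        _ ≤ C * (2*ρ)^(q+1) + ‖A‖ * (2*ρ)^(q+1) := by gcongr <;> linarith
        _ = (‖A‖ + C) * 2^(q+1) * ρ^(q+1) := by rw [mul_pow]; ring
        _ < _ := by
            have : 0 < ρ^(q+1) := by positivity
            linarith)
  have hφ : ∀ᶠ c in 𝓝 c0, dist (φ c) (φ c0) < ρ :=
    h.an.continuousAt.eventually (ball_mem_nhds _ hρ)
  filter_upwards [hev, hφ] with c h1 h2 z hz
  refine (h1 z ?_).le
  rw [mem_closedBall] at hz ⊢
  have := dist_triangle z (φ c) (φ c0)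
  linarith

theorem escape_time {c z : ℂ} (hc : ‖c‖ ≤ 3) (hz : z ∉ Kset c) (hz3 : ‖z‖ ≤ 3) :
    ∃ n, 3 ≤ ‖(fq c)^[n] z‖ ∧ ‖(fq c)^[n] z‖ ≤ 12 := by
  have hex := exists_escape_gt hc hz
  classical
  refine ⟨Nat.find hex, (Nat.find_spec hex).le, ?_⟩
  have h0 : Nat.find hex ≠ 0 := by
    intro h0
    have := Nat.find_spec hex
    rw [h0] at this
    simp at this
    linarith
  obtain ⟨m, hm⟩ := Nat.exists_eq_succ_of_ne_zero h0
  have h1 : ‖(fq c)^[m] z‖ ≤ 3 := by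
    have := Nat.find_min hex (m := m) (by omega)
    linarith
  rw [hm, Function.iterate_succ_apply']
  calc ‖((fq c)^[m] z)^2 + c‖ ≤ ‖(fq c)^[m] z‖^2 + ‖c‖ := by
        refine (norm_add_le _ _).trans ?_
        rw [norm_pow]
    _ ≤ 12 := by nlinarith [norm_nonneg ((fq c)^[m] z)]

theorem r_small : ∃ K ≥ (1:ℝ), ∀ c z n L, ‖c‖ ≤ 3 → (∀ j, ‖xi c j‖ < 5/2) → L ≠ 0 →
    3 ≤ ‖(fq c)^[n] z‖ → 0 < ‖dq c n z‖ ∧ ‖dq c n z‖⁻¹ ≤ 2 * K * ‖(fq c)^[L] z - z‖ := by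
  obtain ⟨K, hK, hk⟩ := koebe
  refine ⟨K, hK, fun c z n L hc hxi hL h3 => ?_⟩
  set w := (fq c)^[n] z with hw
  have hav : ∀ s ∈ ball w (1/2), ∀ j, 1 ≤ j → j ≤ n → s ≠ xi c j := by
    rintro s hs j - - rfl
    have h1 := hxi j
    rw [mem_ball, dist_eq_norm] at hs
    have : ‖w‖ ≤ ‖xi c j‖ + ‖xi c j - w‖ := by
      calc ‖w‖ = ‖xi c j - (xi c j - w)‖ := by ring_nf
        _ ≤ _ := norm_sub_le _ _
    linarith
  obtain ⟨g, hg, hgu, hgr, hgi, hgd⟩ := inv_branch n hav hw.symm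
  have hd2 : (0:ℝ) < 1 / 2 := by positivity
  have hne : ∀ x ∈ ball w (1/2), deriv g x ≠ 0 := by
    intro x hx h0
    have := hgd x hx
    rw [h0] at this; simp at this
  obtain ⟨hk1, -, -⟩ := hk w (1/2) g hd2 hg hgi hne
  have e1 := hgd w (mem_ball_self hd2)
  rw [hgu] at e1
  have e1' : ‖dq c n z‖ * ‖deriv g w‖ = 1 := by rw [← norm_mul, e1, norm_one]
  have hpos : 0 < ‖dq c n z‖ := by
    rw [norm_pos_iff]; intro h0; rw [h0] at e1; simp at e1
  refine ⟨hpos, ?_⟩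
  have e3 : ‖deriv g w‖ = ‖dq c n z‖⁻¹ := eq_inv_of_mul_eq_one_right e1'
  rw [← e3]
  by_contra hlt
  push Not at hlt
  have hmem : (fq c)^[L] z ∈ ball (g w) (1/2 * ‖deriv g w‖ / K) := by
    rw [hgu, mem_ball, dist_eq_norm, lt_div_iff₀ (by linarith)]
    linarith
  obtain ⟨s, hs, hgs⟩ := hk1 hmem
  have h4 := hgr s hs
  rw [hgs, ← Function.iterate_add_apply, add_comm, Function.iterate_add_apply, ← hw] at h4
  have h5 := escape_iter hc (z := w) (by linarith) L
  rw [h4] at h5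
  have h6 : (13/10:ℝ) ≤ (13/10)^L := le_self_pow₀ (by norm_num) hL
  rw [mem_ball, dist_eq_norm] at hs
  have h7 : ‖s‖ ≤ ‖s - w‖ + ‖w‖ := by
    calc ‖s‖ = ‖(s - w) + w‖ := by ring_nf
      _ ≤ _ := norm_add_le _ _
  have h8 : 13/10 * ‖w‖ ≤ (13/10)^L * ‖w‖ := by gcongr
  linarith

set_option maxHeartbeats 1000000 in
theorem branch_geom : ∃ K ≥ (1:ℝ), ∀ c p n a zc ζ e ρ, 0 < e → 0 < ρ → 131072 * K^2 * ρ < e →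
    (∀ s ∈ ball a e, ∀ j, s ≠ xi c j) → (∀ s ∈ ball a e, 1/2 < ‖dq c p s‖ ∧ ‖dq c p s‖ < 4) →
    (fq c)^[p] a = zc → (fq c)^[n] ζ = a →
    ∃ t > 0, t = ‖dq c n ζ‖⁻¹ ∧ (fq c)^[n+p] ζ = zc ∧
    (∀ x ∈ sphere ζ (8*ρ*t), 3*ρ < ‖(fq c)^[n+p] x - (fq c)^[n+p] ζ‖) ∧
    ∀ x ∈ closedBall ζ (8*ρ*t), 1/(4*K*t) < ‖dq c (n+p) x‖ ∧ ‖dq c (n+p) x‖ < 4*K/t := by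
  obtain ⟨K, hK, hk⟩ := koebe
  refine ⟨K, hK, fun c p n a zc ζ e ρ he hρ hρe hxi hdp hpa hζ => ?_⟩
  obtain ⟨g, hg, hgu, hgr, hgi, hgd⟩ := inv_branch (r := e) n (fun s hs j _ _ => hxi s hs j) hζ
  have hne : ∀ x ∈ ball a e, deriv g x ≠ 0 := by
    intro x hx h0
    have := hgd x hx
    rw [h0] at this; simp at this
  obtain ⟨-, -, hk3⟩ := hk a e g he hg hgi hne
  have hss : ball a (e/16) ⊆ ball a e := ball_subset_ball (by linarith)
  obtain ⟨hk1, -, -⟩ := hk a (e/16) g (by positivity) (hg.mono hss) (hgi.mono hss)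
    (fun x hx => hne x (hss hx))
  have e1 := hgd a (mem_ball_self he)
  rw [hgu] at e1
  have e1' : ‖dq c n ζ‖ * ‖deriv g a‖ = 1 := by rw [← norm_mul, e1, norm_one]
  have e3 : ‖deriv g a‖ = ‖dq c n ζ‖⁻¹ := eq_inv_of_mul_eq_one_right e1'
  set t := ‖dq c n ζ‖⁻¹ with ht
  have htpos : 0 < t := by rw [← e3]; exact norm_pos_iff.mpr (hne a (mem_ball_self he))
  have hdζ : ‖dq c n ζ‖ = 1 / t := by rw [ht]; simp
  have hit : ∀ x, (fq c)^[n+p] x = (fq c)^[p] ((fq c)^[n] x) := by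
    intro x; rw [add_comm, Function.iterate_add_apply]
  set κ := e / (16 * K) with hκ
  have hκ0 : 0 < κ := by positivity
  have hK0 : 0 < K := by linarith
  have hball : ∀ x ∈ ball ζ (κ * t), ∃ s ∈ ball a (e/16), g s = x := by
    intro x hx
    apply hk1
    rw [hgu, e3]
    convert hx using 2
    rw [hκ]; field_simp
  have h8 : 8 * ρ < κ := by
    rw [hκ, lt_div_iff₀ (by positivity)]
    nlinarith [mul_pos hρ hK0, mul_nonneg (mul_nonneg hρ.le hK0.le) (by linarith : (0:ℝ) ≤ K - 1)]
  have h8t : 8 * ρ * t < κ * t := by gcongr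
  have hder : ∀ x ∈ ball ζ (κ * t), 1/(4*K*t) < ‖dq c (n+p) x‖ ∧ ‖dq c (n+p) x‖ < 4*K/t := by
    intro x hx
    obtain ⟨s, hs, rfl⟩ := hball x hx
    obtain ⟨a1, a2⟩ := hk3 s hs
    obtain ⟨b1, b2⟩ := hdp s (hss hs)
    have e4 := hgd s (hss hs)
    have e4' : ‖dq c n (g s)‖ * ‖deriv g s‖ = 1 := by rw [← norm_mul, e4, norm_one]
    rw [dq_add, hgr s (hss hs), norm_mul]
    rw [e3] at a1 a2
    have c0 : 0 < ‖deriv g s‖ := norm_pos_iff.mpr (hne s (hss hs))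
    have e5 : ‖dq c n (g s)‖ = 1 / ‖deriv g s‖ := by field_simp; exact e4'
    have c1 : 1/(K*t) ≤ ‖dq c n (g s)‖ := by
      rw [e5]; gcongr
    have c2 : ‖dq c n (g s)‖ ≤ K / t := by
      rw [e5, div_le_div_iff₀ c0 htpos]; linarith
    have c3 : 0 < 1/(K*t) := by positivity
    constructor
    · calc 1/(4*K*t) = 1/(K*t) * (1/4) := by field_simp
        _ < 1/(K*t) * (1/2) := by gcongr; norm_num
        _ ≤ ‖dq c n (g s)‖ * ‖dq c p s‖ := by gcongr
    · calc ‖dq c n (g s)‖ * ‖dq c p s‖ ≤ K/t * ‖dq c p s‖ := by gcongr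
        _ < K/t * 4 := by gcongr
        _ = _ := by ring
  refine ⟨t, htpos, rfl, by rw [hit, hζ, hpa], ?_, fun x hx => hder x (closedBall_subset_ball h8t hx)⟩
  intro x hx
  rw [mem_sphere, dist_eq_norm] at hx
  have hbd : ∀ y ∈ ball ζ (κ * t), ‖(fq c)^[n+p] y - (fq c)^[n+p] ζ‖ ≤ 4 * e := by
    intro y hy
    obtain ⟨s, hs, rfl⟩ := hball y hy
    rw [hit, hit, hgr s (hss hs), hζ]
    have hs' : ‖s - a‖ ≤ e := by
      have := hss hs
      rw [mem_ball, dist_eq_norm] at this; exact this.le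
    refine ((convex_ball a e).norm_image_sub_le_of_norm_deriv_le (𝕜 := ℂ) (C := 4)
      (fun y _ => (differentiable_iter c p).differentiableAt) (fun y hy => ?_)
      (mem_ball_self he) (hss hs)).trans ?_
    · rw [deriv_iter]; exact (hdp y hy).2.le
    · linarith
  have hT := taylor_one (H := (fq c)^[n+p]) (ζ := ζ) (t := κ * t) (M := 4*e) (x := x)
    ((differentiable_iter c (n+p)).differentiableOn) hbd
    (by rw [mem_ball, dist_eq_norm, hx]; exact h8t)
  rw [deriv_iter, hx] at hT
  have hmain : ‖dq c (n+p) ζ * (x - ζ)‖ ≥ 4 * ρ := by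
    rw [dq_add, hζ, norm_mul, norm_mul, hdζ, hx]
    have := (hdp a (mem_ball_self he)).1
    calc 1/t * ‖dq c p a‖ * (8*ρ*t) = 8 * ρ * ‖dq c p a‖ := by field_simp
      _ ≥ 4 * ρ := by nlinarith
  have herr : 2 * (4*e) * (8*ρ*t)^2 / (κ*t)^2 < ρ := by
    have : 2 * (4*e) * (8*ρ*t)^2 / (κ*t)^2 = 131072 * K^2 * ρ * ρ / e := by
      rw [hκ]; field_simp; ring
    rw [this, div_lt_iff₀ he]
    nlinarith
  set D := (fq c)^[n+p] x - (fq c)^[n+p] ζ with hD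
  have htri : ‖dq c (n+p) ζ * (x - ζ)‖ ≤ ‖D‖ + ‖D - dq c (n+p) ζ * (x - ζ)‖ := by
    calc ‖dq c (n+p) ζ * (x - ζ)‖ = ‖D - (D - dq c (n+p) ζ * (x - ζ))‖ := by ring_nf
      _ ≤ _ := norm_sub_le _ _
  linarith

end Shi

open Complex Set Filter Topology Metric
open scoped ContDiff
namespace Shi

set_option maxHeartbeats 1000000 in
open MeasureTheory in
theorem Es_of_geom {c zc : ℂ} {s ρ T B K : ℝ} (hs : 0 < s) (hs2 : s < 2)
    (hvol : volume (Kset c) = 0) (hρ : 0 < ρ) (hρ8 : 8 * ρ ≤ 1) (hB : 1 ≤ B) (hT : 0 < T)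
    (hK : 1 ≤ K) (hBT : B * T ≤ 3 * ρ / 4) (hKT : 8 * K * T ≤ 1)
    (hfin : 25 * B^2 * ((4*K)^s * 2^s * T^(2-s) / (1 - 2^(s-2))) < (ρ/4)^2)
    (hdata : ∀ z ∈ closedBall zc (ρ/4) \ Kset c, ∃ (m : ℕ) (ζ : ℂ) (t : ℝ), 0 < t ∧ t ≤ T ∧
      ‖ζ - z‖ ≤ (B - 1) * t ∧ (fq c)^[m] ζ = zc ∧
      (∀ x ∈ sphere ζ (8*ρ*t), 3*ρ < ‖(fq c)^[m] x - (fq c)^[m] ζ‖) ∧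
      ∀ x ∈ closedBall ζ (8*ρ*t), 1/(4*K*t) < ‖dq c m x‖ ∧ ‖dq c m x‖ < 4*K/t) : Es s c := by
  by_contra hEs
  set X := closedBall zc (ρ/4) \ Kset c with hX
  have hdata' : ∀ z : ℂ, ∃ (m : ℕ) (ζ : ℂ) (t : ℝ), z ∈ X → 0 < t ∧ t ≤ T ∧
      ‖ζ - z‖ ≤ (B - 1) * t ∧ (fq c)^[m] ζ = zc ∧
      (∀ x ∈ sphere ζ (8*ρ*t), 3*ρ < ‖(fq c)^[m] x - (fq c)^[m] ζ‖) ∧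
      ∀ x ∈ closedBall ζ (8*ρ*t), 1/(4*K*t) < ‖dq c m x‖ ∧ ‖dq c m x‖ < 4*K/t := by
    intro z
    by_cases hz : z ∈ X
    · obtain ⟨m, ζ, t, h⟩ := hdata z hz
      exact ⟨m, ζ, t, fun _ => h⟩
    · exact ⟨0, 0, 0, fun h => absurd h hz⟩
  choose m ζ t hd using hdata'
  have hv : volume (closedBall zc (ρ/4)) ≤ volume X := by
    rw [hX, measure_sdiff_null hvol]
  refine absurd (count_bound (A := (4*K)^s) hs hs2 hT (by positivity) (by linarith : 0 < B)
    (by positivity : 0 < ρ/4) t (fun z hz => ⟨(hd z hz).1, (hd z hz).2.1⟩) hv ?_) (not_le.mpr hfin)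
  intro k G hGX hGd hcl
  by_contra hlt
  push Not at hlt
  apply hEs
  have hR : (4*K)^s * (2^(k+1)/T)^s = (4*K*(2^(k+1)/T))^s :=
    (Real.mul_rpow (by positivity) (by positivity)).symm
  rw [hR] at hlt
  let e := G.equivFin.symm
  have he : ∀ i, (e i : ℂ) ∈ X := fun i => hGX (e i).2
  refine ⟨G.card, zc, ρ, 4*K*(2^(k+1)/T), fun i => ζ (e i), fun i => 8*ρ*t (e i), fun i => m (e i),
    hρ, ?_, hlt, ?_, ?_, ?_, ?_⟩
  · rw [← mul_div_assoc, lt_div_iff₀ hT]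
    have : (1:ℝ) ≤ 2^(k+1) := one_le_pow₀ (by norm_num)
    nlinarith
  · intro i
    have := (hd _ (he i)).1
    positivity
  · intro i
    obtain ⟨h1, h2, h3, -⟩ := hd _ (he i)
    apply closedBall_subset_closedBall'
    have h4 := (he i).1
    rw [mem_closedBall] at h4
    have h5 := dist_triangle (ζ (e i)) (e i) zc
    rw [dist_eq_norm (ζ (e i)) (e i : ℂ)] at h5
    show 8*ρ*t (e i) + dist (ζ (e i)) zc ≤ ρ
    have h6 : 8*ρ*t (e i) ≤ 1 * t (e i) := by gcongr
    have h7 : B * t (e i) ≤ B * T := by gcongr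
    linarith
  · intro i j hij
    obtain ⟨h1, h2, h3, -⟩ := hd _ (he i)
    obtain ⟨k1, k2, k3, -⟩ := hd _ (he j)
    have hne : (e i : ℂ) ≠ e j := fun h => hij (e.injective (Subtype.ext h))
    have hdis := hGd (e i).2 (e j).2 hne
    rw [Function.onFun, disjoint_closedBall_closedBall_iff (by positivity) (by positivity)] at hdis
    have h5 := dist_triangle4 (e i : ℂ) (ζ (e i)) (ζ (e j)) (e j)
    rw [dist_comm (e i : ℂ) (ζ (e i)), dist_eq_norm (ζ (e i)) (e i : ℂ), dist_eq_norm (ζ (e j)) (e j : ℂ)] at h5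
    have h6 : 8*ρ*t (e i) ≤ 1 * t (e i) := by gcongr
    have h7 : 8*ρ*t (e j) ≤ 1 * t (e j) := by gcongr
    show 8*ρ*t (e i) + 8*ρ*t (e j) < _
    linarith
  · intro i
    obtain ⟨h1, h2, h3, h4, h5, h6⟩ := hd _ (he i)
    refine ⟨h5, by rw [h4]; simpa using hρ, fun x hx => ?_⟩
    obtain ⟨a1, a2⟩ := h6 x hx
    obtain ⟨b1, b2⟩ := hcl _ (e i).2
    constructor
    · refine lt_of_le_of_lt ?_ a1
      rw [le_div_iff₀ (by positivity)]
      have : 8 * K * t (e i) ≤ 8 * K * T := by gcongr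
      linarith
    · refine a2.trans ?_
      rw [div_lt_iff₀ (by positivity)] at b1
      rw [← mul_div_assoc, div_lt_div_iff₀ h1 hT]
      have := mul_lt_mul_of_pos_left b1 (by positivity : 0 < 4 * K)
      linarith

/-- the derivative along the cycle has modulus close to one also near `-φ c` -/
theorem Par.near_neg {c0 : ℂ} {p q : ℕ} {φ : ℂ → ℂ} (h : Par c0 p q φ) {Qs : Set ℂ}
    (hQ : IsClosed Qs) (ha : -φ c0 ∉ Qs) :
    ∃ e > (0:ℝ), ∃ η > (0:ℝ), ∀ᶠ c in 𝓝 c0,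
      (Sh Qs η c → ∀ s ∈ ball (-φ c) e, ∀ j, s ≠ xi c j) ∧
      (∀ s ∈ ball (-φ c) e, 1/2 < ‖dq c p s‖ ∧ ‖dq c p s‖ < 4) := by
  obtain ⟨d, hd, hdb⟩ := Metric.isOpen_iff.mp hQ.isOpen_compl (-φ c0) ha
  have h1 : ‖dq c0 p (-φ c0)‖ = 1 := by
    have hn : ‖dq c0 p (-φ c0)‖ = ‖dq c0 p (φ c0)‖ := by
      unfold dq
      rw [norm_prod, norm_prod]
      refine Finset.prod_congr rfl fun i _ => ?_
      rcases Nat.eq_zero_or_pos i with rfl | hi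
      · simp
      · rw [fq_neg_iter c0 i hi.ne']
    rw [hn]
    exact h.prim.norm'_eq_one h.hq
  have hcont : ContinuousAt (fun x : ℂ × ℂ => ‖dq x.1 p x.2‖) (c0, -φ c0) :=
    (continuous_dq2 p).norm.continuousAt
  have hev : ∀ᶠ x : ℂ × ℂ in 𝓝 (c0, -φ c0), 1/2 < ‖dq x.1 p x.2‖ ∧ ‖dq x.1 p x.2‖ < 4 := by
    refine (hcont.eventually (lt_mem_nhds ?_)).and (hcont.eventually (gt_mem_nhds ?_)) <;>
    · show _ < _
      simp only [h1]; norm_num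
  obtain ⟨ε, hε, hεb⟩ := Metric.eventually_nhds_iff.mp hev
  set e := min (d/4) (ε/2) with he
  have he0 : 0 < e := by positivity
  have hed : e ≤ d/4 := min_le_left _ _
  have heε : e ≤ ε/2 := min_le_right _ _
  refine ⟨e, he0, d/4, by positivity, ?_⟩
  have hφ : ∀ᶠ c in 𝓝 c0, dist (φ c) (φ c0) < e :=
    h.an.continuousAt.eventually (ball_mem_nhds _ he0)
  have hcc : ∀ᶠ c in 𝓝 c0, dist c c0 < ε := ball_mem_nhds _ hε
  filter_upwards [hφ, hcc] with c h2 h3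
  have h2' : dist (-φ c) (-φ c0) < e := by rwa [dist_neg_neg]
  constructor
  · rintro hS s hs j rfl
    obtain ⟨y, hy, hyj⟩ := hS j
    rw [mem_ball] at hs
    have := dist_triangle4 y (xi c j) (-φ c) (-φ c0)
    rw [dist_comm y (xi c j)] at this
    exact hdb (mem_ball.mpr (by linarith)) hy
  · intro s hs
    rw [mem_ball] at hs
    refine hεb (y := (c, s)) ?_
    rw [Prod.dist_eq]
    have := dist_triangle s (-φ c) (-φ c0)
    exact max_lt h3 (by show dist s (-φ c0) < ε; linarith)

end Shi

open Complex Set Filter Topology Metric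
open scoped ContDiff
namespace Shi

theorem choose_rho {s B D E K2 r0 e : ℝ} {q : ℕ} (hs2 : s < 2) (hq0 : q ≠ 0)
    (hq : 2 < ((q:ℝ)+1) * (2 - s)) (hD : 0 < D) (hr0 : 0 < r0) (he : 0 < e) :
    ∃ ρ > (0:ℝ), ρ < r0 ∧ 131072 * K2^2 * ρ < e ∧ 8 * ρ ≤ 1 ∧ B * (D * ρ^(q+1)) ≤ 3*ρ/4 ∧
      8 * K2 * (D * ρ^(q+1)) ≤ 1 ∧ E * (D * ρ^(q+1))^(2-s) < (ρ/4)^2 := by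
  set θ := ((q:ℝ)+1) * (2 - s) with hθ
  have lim : ∀ f : ℝ → ℝ, Continuous f → f 0 = 0 → ∀ ε > 0, ∀ᶠ x in 𝓝[>] (0:ℝ), f x < ε := by
    intro f hf h0 ε hε
    have := (hf.tendsto 0).eventually (gt_mem_nhds (by rw [h0]; exact hε))
    exact nhdsWithin_le_nhds this
  have h1 := lim (fun x => x) continuous_id rfl r0 hr0
  have h2 := lim (fun x => 131072 * K2^2 * x) (by fun_prop) (by simp) e he
  have h3 := lim (fun x => 8 * x) (by fun_prop) (by simp) 1 one_pos
  have h4 := lim (fun x => B * D * x^q) (by fun_prop) (by simp [hq0]) (3/4) (by norm_num)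
  have h5 := lim (fun x => 8 * K2 * (D * x^(q+1))) (by fun_prop) (by simp) 1 one_pos
  have h6 := lim (fun x => E * D^(2-s) * x^(θ-2))
    (continuous_const.mul (Real.continuous_rpow_const (by linarith)))
    (by rw [Real.zero_rpow (by linarith)]; simp) (1/16) (by norm_num)
  obtain ⟨ρ, ⟨⟨⟨⟨⟨g1, g2⟩, g3⟩, g4⟩, g5⟩, g6⟩, hρ⟩ :=
    ((((((h1.and h2).and h3).and h4).and h5).and h6).and self_mem_nhdsWithin).exists
  have hρ0 : 0 < ρ := hρ
  refine ⟨ρ, hρ0, g1, g2, g3.le, ?_, g5.le, ?_⟩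
  · have := mul_lt_mul_of_pos_right g4 hρ0
    rw [pow_succ]; nlinarith
  · have e1 : (D * ρ^(q+1))^(2-s) = D^(2-s) * (ρ^(θ-2) * ρ^2) := by
      rw [Real.mul_rpow hD.le (by positivity), ← Real.rpow_natCast ρ (q+1), ← Real.rpow_mul hρ0.le,
        ← Real.rpow_natCast ρ 2, ← Real.rpow_add hρ0]
      congr 2
      rw [hθ]; push_cast; ring
    rw [e1]
    have := mul_lt_mul_of_pos_right g6 (by positivity : 0 < ρ^2)
    nlinarith

set_option maxHeartbeats 1000000 in
open MeasureTheory in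
theorem stepB {c0 : ℂ} {p q : ℕ} {φ : ℂ → ℂ} (h : Par c0 p q φ) (hc : c0 ≠ 1/4) {s : ℝ}
    (hs : 0 < s) (hs2 : s < 2) (hq : 2 < ((q:ℝ)+1) * (2 - s))
    (hvol : ∀ c : ℂ, ‖c‖ ≤ 3 → Mis c → volume (Kset c) = 0) :
    ∃ᶠ c in 𝓝 c0, Mis c ∧ Es s c := by
  obtain ⟨Qs, hQc, hQ, haQ, hQb, hfreq⟩ := stepB_local' h hc
  obtain ⟨C, hC, η, hη, htr⟩ := transfer hQc hQ hQb haQ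
  obtain ⟨K1, hK1, hrs⟩ := r_small
  obtain ⟨K2, hK2, hbg⟩ := branch_geom
  obtain ⟨C3, hC3, r0, hr0, hret⟩ := h.return_small
  obtain ⟨e, he, η1, hη1, hnear⟩ := h.near_neg hQc haQ
  set D := C * (2 * K1 * C3) with hDdef
  have hD : 0 < D := by positivity
  set B := C^2 + 1 with hBdef
  set E := 25 * B^2 * ((4*K2)^s * 2^s / (1 - 2^(s-2))) with hE
  obtain ⟨ρ, hρ, hρr, hρe, hρ8, hBT, hKT, hfin⟩ :=
    choose_rho (B := B) (E := E) (K2 := K2) hs2 h.hq hq hD hr0 he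
  set T := D * ρ^(q+1) with hT
  have hT0 : 0 < T := by positivity
  have ev1 : ∀ᶠ c in 𝓝 c0, ‖c‖ < 3 :=
    (continuous_norm.tendsto c0).eventually (gt_mem_nhds h.hc)
  have ev2 : ∀ᶠ c in 𝓝 c0, dist (-φ c) (-φ c0) < η :=
    (h.an.continuousAt.neg).eventually (ball_mem_nhds _ hη)
  refine ((hfreq (min η η1) (lt_min hη hη1)).and_eventually
    ((((ev1.and ev2).and (hret ρ hρ hρr)).and hnear).and h.fix)).mono ?_
  rintro c ⟨⟨hM, hS⟩, ⟨⟨⟨hc3, hφη⟩, hrt⟩, hn1, hn2⟩, hfix⟩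
  refine ⟨hM, ?_⟩
  have hS1 := hS.mono (min_le_left _ _)
  have hS2 := hn1 (hS.mono (min_le_right _ _))
  have hxi : ∀ j, ‖xi c j‖ < 5/2 := by
    obtain ⟨β, l, hβ, -, hl⟩ := hM
    have h0 : (0:ℂ) ∈ Kset c := mem_K_of_eventually_fixed (n := l) hc3.le hβ hl
    exact fun j => (mem_K_iff hc3.le).mp h0 j
  have hzK : ‖φ c‖ < 5/2 := (mem_K_iff hc3.le).mp (fix_mem_K hc3.le h.hp hfix) 0
  have hpa : (fq c)^[p] (-φ c) = φ c := by rw [fq_neg_iter c p h.hp, hfix]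
  refine Es_of_geom (zc := φ c) (ρ := ρ) (T := T) (B := B) (K := K2) hs hs2
    (hvol c hc3.le hM) hρ hρ8 (by rw [hBdef]; nlinarith) hT0 hK2 hBT hKT ?_ ?_
  · refine lt_of_eq_of_lt ?_ hfin
    rw [hE]; ring
  · rintro z ⟨hz, hzK'⟩
    have hz1 : ‖z‖ ≤ 3 := by
      rw [mem_closedBall, dist_eq_norm] at hz
      have : ‖z‖ ≤ ‖z - φ c‖ + ‖φ c‖ := by
        calc ‖z‖ = ‖(z - φ c) + φ c‖ := by ring_nf
          _ ≤ _ := norm_add_le _ _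
      linarith
    obtain ⟨n, hn3, hn12⟩ := escape_time hc3.le hzK' hz1
    obtain ⟨hpos, hr⟩ := hrs c z n (p*q) hc3.le hxi h.L_ne hn3
    have hr' := hrt z (closedBall_subset_closedBall (by linarith) hz)
    obtain ⟨ζ, f1, f2, f3, f4⟩ := htr c n z (-φ c) hS1 hn3 hn12 hφη
    obtain ⟨t, ht0, ht, g1, g2, g3⟩ := hbg c p n (-φ c) (φ c) ζ e ρ he hρ hρe hS2 hn2 hpa f1
    have hdζ : ‖dq c n ζ‖ = t⁻¹ := by rw [ht, inv_inv]
    set rz := ‖dq c n z‖⁻¹ with hrz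
    have hdz : ‖dq c n z‖ = rz⁻¹ := by rw [hrz, inv_inv]
    have hrz0 : 0 < rz := by positivity
    rw [hdz, hdζ] at f2 f3
    rw [hdz] at f4
    have k1 : t ≤ C * rz := by
      rw [← div_eq_mul_inv, inv_eq_one_div, div_le_div_iff₀ hrz0 ht0] at f2
      linarith
    have k2 : rz ≤ C * t := by
      rw [← div_eq_mul_inv, inv_eq_one_div, div_le_div_iff₀ ht0 hrz0] at f3
      linarith
    have k3 : ‖ζ - z‖ ≤ C * rz := by
      rwa [← div_eq_mul_inv, div_le_iff₀ hrz0] at f4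
    refine ⟨n+p, ζ, t, ht0, ?_, ?_, g1, g2, g3⟩
    · calc t ≤ C * rz := k1
        _ ≤ C * (2 * K1 * (C3 * ρ^(q+1))) := by
            gcongr
            exact hr.trans (by gcongr)
        _ = T := by rw [hT, hDdef]; ring
    · calc ‖ζ - z‖ ≤ C * rz := k3
        _ ≤ C * (C * t) := by gcongr
        _ = _ := by rw [hBdef]; ring

end Shi

open Complex Set Filter Topology Metric
open scoped ContDiff
namespace Shi

theorem Mis.ne_quarter {c : ℂ} (h : Mis c) : c ≠ 1/4 := by
  rintro rfl
  obtain ⟨β, l, h1, h2, -⟩ := h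
  unfold fq at h1
  have h3 : (β - 1/2)^2 = 0 := by linear_combination h1
  have h4 : β = 1/2 := by
    have := pow_eq_zero_iff (two_ne_zero) |>.mp h3
    linear_combination this
  rw [h4] at h2
  norm_num at h2

theorem mis_neg_two : Mis (-2) := by
  refine ⟨2, 2, by unfold fq; norm_num, by norm_num, ?_⟩
  simp [xi, fq]
  norm_num

open MeasureTheory in
theorem one_step (hvol : ∀ c : ℂ, ‖c‖ ≤ 3 → Mis c → volume (Kset c) = 0) {c : ℂ} (hM : Mis c)
    {r : ℝ} (hr : 0 < r) (hb : ball c r ⊆ ball 0 3) {s : ℝ} (hs : 0 < s) (hs2 : s < 2) :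
    ∃ c' r', Mis c' ∧ 0 < r' ∧ closedBall c' r' ⊆ ball c r ∧ ∀ x ∈ closedBall c' r', Es s x := by
  have hne := hM.ne_quarter
  have hd : 0 < dist (1/4) c := dist_pos.mpr hne.symm
  set r2 := min r (dist (1/4) c) with hr2
  have hsub : ball c r2 ⊆ ball c r := ball_subset_ball (min_le_left _ _)
  obtain ⟨Q, hQ⟩ := exists_nat_gt (2 / (2 - s))
  obtain ⟨c0, hc0, p, hp, q, hqQ, φ, hq, an, fix, prim, der⟩ :=
    stepA hM (lt_min hr hd) (hsub.trans hb) Q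
  have hPar : Par c0 p q φ := ⟨by simpa using hb (hsub hc0), hp, hq, an, fix, prim, der⟩
  have hc4 : c0 ≠ 1/4 := by
    rintro rfl
    rw [mem_ball] at hc0
    exact absurd hc0 (not_lt.mpr (min_le_right _ _))
  have hqs : 2 < ((q:ℝ)+1) * (2 - s) := by
    rw [div_lt_iff₀ (by linarith)] at hQ
    have : (Q:ℝ) ≤ q + 1 := by exact_mod_cast (by omega)
    nlinarith
  have hf := stepB hPar hc4 hs hs2 hqs hvol
  obtain ⟨c', ⟨hM', hE'⟩, hc'⟩ := (hf.and_eventually (isOpen_ball.mem_nhds (hsub hc0))).exists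
  have hnb : ∀ᶠ x in 𝓝 c', Es s x ∧ x ∈ ball c r := (Es_open hE').and (isOpen_ball.mem_nhds hc')
  obtain ⟨r', hr', h⟩ := Metric.nhds_basis_closedBall.eventually_iff.mp hnb
  exact ⟨c', r', hM', hr', fun x hx => (h hx).2, fun x hx => (h hx).1⟩

open MeasureTheory in
theorem main_aux : ∃ c : ℂ, ‖c‖ ≤ 3 ∧ 2 ≤ dimH (frontier (Kset c)) := by
  by_cases hvol : ∀ c : ℂ, ‖c‖ ≤ 3 → Mis c → volume (Kset c) = 0
  swap
  · push Not at hvol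
    obtain ⟨c, hc, hM, hv⟩ := hvol
    exact ⟨c, hc, dim_two_of_volume_pos hc hM hv⟩
  let S := {x : ℂ × ℝ // Mis x.1 ∧ 0 < x.2 ∧ ball x.1 x.2 ⊆ ball 0 3}
  let sq : ℕ → ℝ := fun k => 2 - 1 / ((k:ℝ) + 1)
  have hsq : ∀ k, 0 < sq k ∧ sq k < 2 := by
    intro k
    have h1 : 1 / ((k:ℝ)+1) ≤ 1 := by
      rw [div_le_one (by positivity)]; linarith [Nat.cast_nonneg (α := ℝ) k]
    have h2 : 0 < 1 / ((k:ℝ)+1) := by positivity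
    constructor <;> simp only [sq] <;> linarith
  have hstep : ∀ (k : ℕ) (x : S), ∃ y : S, closedBall y.1.1 y.1.2 ⊆ ball x.1.1 x.1.2 ∧
      ∀ w ∈ closedBall y.1.1 y.1.2, Es (sq k) w := by
    rintro k ⟨⟨c, r⟩, hM, hr, hb⟩
    obtain ⟨c', r', h1, h2, h3, h4⟩ := one_step hvol hM hr hb (hsq k).1 (hsq k).2
    exact ⟨⟨(c', r'), h1, h2, (ball_subset_closedBall.trans h3).trans hb⟩, h3, h4⟩
  choose nxt hn1 hn2 using hstep
  let x0 : S := ⟨(-2, 1), mis_neg_two, one_pos, by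
    apply ball_subset_ball'
    simp; norm_num⟩
  let X : ℕ → S := fun k => Nat.rec x0 (fun k x => nxt k x) k
  have hX : ∀ k, X (k+1) = nxt k (X k) := fun k => rfl
  have hne := IsCompact.nonempty_iInter_of_sequence_nonempty_isCompact_isClosed
    (fun k => closedBall (X k).1.1 (X k).1.2)
    (fun k => by
      show closedBall (X (k+1)).1.1 (X (k+1)).1.2 ⊆ closedBall (X k).1.1 (X k).1.2
      rw [hX]
      exact (hn1 k (X k)).trans ball_subset_closedBall)
    (fun k => nonempty_closedBall.mpr (X k).2.2.1.le)
    (isCompact_closedBall _ _) (fun k => isClosed_closedBall)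
  obtain ⟨c, hc⟩ := hne
  rw [mem_iInter] at hc
  have hc3 : ‖c‖ ≤ 3 := by
    have h1 := hc (0+1)
    rw [hX 0] at h1
    have := (X 0).2.2.2 (hn1 0 (X 0) h1)
    rw [mem_ball_zero_iff] at this
    exact this.le
  refine ⟨c, hc3, ?_⟩
  have hge : ∀ k, ENNReal.ofReal (sq k) ≤ dimH (frontier (Kset c)) := by
    intro k
    have h1 := hc (k+1)
    rw [hX k] at h1
    exact Es_dim hc3 (hsq k).1 (hn2 k (X k) c h1)
  have hlim : Tendsto (fun k => ENNReal.ofReal (sq k)) atTop (𝓝 (ENNReal.ofReal 2)) := by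
    apply ENNReal.tendsto_ofReal
    have := (tendsto_const_nhds (x := (2:ℝ))).sub (tendsto_one_div_add_atTop_nhds_zero_nat (𝕜 := ℝ))
    rwa [sub_zero] at this
  have := le_of_tendsto' hlim hge
  simpa using this

theorem main_final : ∃ c : ℂ, dimH (frontier {z : ℂ | Bornology.IsBounded (Set.range fun n : ℕ =>
    (fun w : ℂ => w ^ 2 + c)^[n] z)}) = 2 := by
  obtain ⟨c, hc, h⟩ := main_aux
  refine ⟨c, le_antisymm ?_ h⟩
  have h1 := dimH_mono (subset_univ (frontier {z : ℂ | Bornology.IsBounded (Set.range fun n : ℕ =>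
    (fun w : ℂ => w ^ 2 + c)^[n] z)}))
  refine h1.trans ?_
  rw [Real.dimH_univ_eq_finrank ℂ]
  simp

end Shi

end ShiDev



/-- Shishikura: there exists a quadratic polynomial `z ↦ z² + c` whose Julia set
(the frontier of the filled Julia set) has Hausdorff dimension 2. -/
theorem exists_quadratic_julia_set_of_hausdorff_dimension_two :
    ∃ c : ℂ, dimH (frontier {z : ℂ |
      Bornology.IsBounded (Set.range fun n : ℕ => (fun w : ℂ => w ^ 2 + c)^[n] z)}) = 2 := by
  exact Shi.main_final
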